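/- Let Ψ ∈ P_dLV(ℝⁿ) be translation invariant, i.e. Ψ(f(· − x₀); x₀ + B) = Ψ(f; B) for all x₀ ∈ ℝⁿ, f ∈ Conv(ℝⁿ,ℝ) and bounded Borel sets B. Then there exists a unique complex-valued polynomial P(s,v,A) on ℝ × ℝⁿ × Sym²(ℝⁿ) which has degree at most d in the variables (s,v) and, for each fixed (s,v), belongs to M_n as a function of A, such that Ψ(f;B) = ∫_B P(f(x), ∇f(x), D²f(x)) dx for all f ∈ Conv(ℝⁿ,ℝ) ∩ C²(ℝⁿ) and all bounded Borel sets B ⊂ ℝⁿ. Conversely, for every such polynomial P there exists a unique translation invariant Ψ ∈ P_dLV(ℝⁿ) satisfying this formula on all C² convex functions. -/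

import Mathlib

open scoped CompactlySupported NNReal

noncomputable section

abbrev Eucl (n : ℕ) := EuclideanSpace ℝ (Fin n)

def RadonMeasure (n : ℕ) : Submodule ℂ (C_c(Eucl n, ℂ) →ₗ[ℂ] ℂ) where
  carrier := {μ | ∀ A : Set (Eucl n), IsCompact A → ∃ C : ℝ, ∀ φ : C_c(Eucl n, ℂ),
      tsupport ⇑φ ⊆ A → (∀ x, ‖φ x‖ ≤ 1) → ‖μ φ‖ ≤ C}
  add_mem' := by
    intro μ ν hμ hν A hA
    obtain ⟨C₁, h₁⟩ := hμ A hA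
    obtain ⟨C₂, h₂⟩ := hν A hA
    refine ⟨C₁ + C₂, fun φ h h' => ?_⟩
    calc ‖(μ + ν) φ‖ = ‖μ φ + ν φ‖ := by simp
    _ ≤ ‖μ φ‖ + ‖ν φ‖ := norm_add_le _ _
    _ ≤ C₁ + C₂ := add_le_add (h₁ φ h h') (h₂ φ h h')
  zero_mem' := fun _ _ => ⟨0, fun φ _ _ => by simp⟩
  smul_mem' := by
    intro c μ hμ A hA
    obtain ⟨C, h⟩ := hμ A hA
    refine ⟨‖c‖ * C, fun φ hs hb => ?_⟩
    simp only [LinearMap.smul_apply, norm_smul]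
    exact mul_le_mul_of_nonneg_left (h φ hs hb) (norm_nonneg c)

abbrev ConvFn (n : ℕ) := {f : C(Eucl n, ℝ) // ConvexOn ℝ Set.univ ⇑f}

def IsLocalFunctional {n : ℕ} (Ψ : ConvFn n → RadonMeasure n) : Prop :=
  ∀ (f h : ConvFn n) (U : Set (Eucl n)), IsOpen U → (∀ x ∈ U, f.1 x = h.1 x) →
    ∀ φ : C_c(Eucl n, ℂ), tsupport ⇑φ ⊆ U → (Ψ f).1 φ = (Ψ h).1 φ

def IsContinuousFunctional {n : ℕ} (Ψ : ConvFn n → RadonMeasure n) : Prop :=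
  ∀ φ : C_c(Eucl n, ℂ), Continuous fun f : ConvFn n => (Ψ f).1 φ

lemma convexOn_affine {n : ℕ} (s : ℝ) (v : Eucl n) :
    ConvexOn ℝ Set.univ (fun x : Eucl n => s + inner ℝ v x) := by
  refine ⟨convex_univ, fun x _ y _ a b _ _ hab => le_of_eq ?_⟩
  simp only [smul_eq_mul, inner_add_right, real_inner_smul_right]
  linear_combination s * hab.symm

/-- Add the affine function `ℓ(x) = s + ⟨v, x⟩` to a convex function. -/
def addAffine {n : ℕ} (f : ConvFn n) (s : ℝ) (v : Eucl n) : ConvFn n :=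
  ⟨⟨fun x => f.1 x + (s + inner ℝ v x),
    (map_continuous f.1).add (continuous_const.add (Continuous.inner continuous_const continuous_id))⟩,
    f.2.add (convexOn_affine s v)⟩

/-- `Ψ` is polynomial of degree at most `d`: for every `f` and `φ`, the map
`(s, v) ↦ Ψ(f + s + ⟨v, ·⟩)(φ)` is (the restriction of) a polynomial of degree at most `d`
on `ℝ × ℝⁿ`. -/
def IsPolynomialDeg {n : ℕ} (d : ℕ) (Ψ : ConvFn n → RadonMeasure n) : Prop :=
  ∀ (f : ConvFn n) (φ : C_c(Eucl n, ℂ)), ∃ P : MvPolynomial (Fin (n + 1)) ℂ,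
    P.totalDegree ≤ d ∧ ∀ (s : ℝ) (v : Eucl n),
      (Ψ (addAffine f s v)).1 φ = MvPolynomial.eval (Fin.cons (s : ℂ) fun i => (v i : ℂ)) P

/-- `P_dLV(ℝⁿ)`: continuous local functionals, polynomial of degree at most `d`. -/
def MemPdLV {n : ℕ} (d : ℕ) (Ψ : ConvFn n → RadonMeasure n) : Prop :=
  IsLocalFunctional Ψ ∧ IsContinuousFunctional Ψ ∧ IsPolynomialDeg d Ψ

/-- Multiply a convex function by a nonnegative scalar `t ≥ 0`. -/
def smulConv {n : ℕ} (t : ℝ≥0) (f : ConvFn n) : ConvFn n :=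
  ⟨(t : ℝ) • f.1, by exact f.2.smul t.2⟩

/-- `Ψ` is homogeneous of degree `k`: `Ψ(t f) = t^k Ψ(f)` for `t ≥ 0`. -/
def IsHomogeneousDeg {n : ℕ} (k : ℕ) (Ψ : ConvFn n → RadonMeasure n) : Prop :=
  ∀ (f : ConvFn n) (t : ℝ≥0), Ψ (smulConv t f) = ((t : ℝ) : ℂ) ^ k • Ψ f

open MeasureTheory Matrix

/-- The gradient `∇f(x)` of `f : ℝⁿ → ℝ`, in coordinates. -/
def gradVec {n : ℕ} (f : Eucl n → ℝ) (x : Eucl n) : Fin n → ℝ :=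
  fun i => fderiv ℝ f x (EuclideanSpace.single i 1)

/-- The Hessian matrix `D²f(x)` of `f : ℝⁿ → ℝ`. -/
def hessMat {n : ℕ} (f : Eucl n → ℝ) (x : Eucl n) : Matrix (Fin n) (Fin n) ℝ :=
  Matrix.of fun i j =>
    fderiv ℝ (fun y => fderiv ℝ f y (EuclideanSpace.single j 1)) x (EuclideanSpace.single i 1)

/-- The space `Sym²(ℝⁿ)` of real symmetric `n × n` matrices. -/
abbrev SymMatrix (n : ℕ) := {A : Matrix (Fin n) (Fin n) ℝ // A.IsSymm}

/-- The Hessian matrix, symmetrized (for a `C²` function this is the Hessian itself, by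
symmetry of second derivatives). -/
def symHess {n : ℕ} (f : Eucl n → ℝ) (x : Eucl n) : SymMatrix n :=
  ⟨(2⁻¹ : ℝ) • (hessMat f x + (hessMat f x)ᵀ), by
    show _ = _
    rw [Matrix.transpose_smul, Matrix.transpose_add, Matrix.transpose_transpose, add_comm]⟩

/-- The affine map `x ↦ L x + b`. -/
def affOf {n : ℕ} (L : Eucl n →ₗ[ℝ] Eucl n) (b : Eucl n) : Eucl n →ᵃ[ℝ] Eucl n where
  toFun := fun x => L x + b
  linear := L
  map_vadd' := by
    intro p v
    simp [map_add, add_assoc]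

lemma convexOn_translate {n : ℕ} (f : ConvFn n) (x₀ : Eucl n) :
    ConvexOn ℝ Set.univ fun x => f.1 (x - x₀) := by
  have h := f.2.comp_affineMap (affOf (LinearMap.id) (-x₀))
  simp only [Set.preimage_univ] at h
  have heq : (⇑f.1 ∘ ⇑(affOf (LinearMap.id (R := ℝ)) (-x₀))) = fun x => f.1 (x - x₀) := by
    funext x
    simp [affOf, sub_eq_add_neg]
  rwa [heq] at h

/-- The translated convex function `f(· - x₀)`. -/
def translateConv {n : ℕ} (x₀ : Eucl n) (f : ConvFn n) : ConvFn n :=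
  ⟨⟨fun x => f.1 (x - x₀), (map_continuous f.1).comp (by continuity)⟩,
    convexOn_translate f x₀⟩

/-- The translated test function `φ(· - x₀)`. -/
def translateCc {n : ℕ} (x₀ : Eucl n) (φ : C_c(Eucl n, ℂ)) : C_c(Eucl n, ℂ) :=
  ⟨⟨fun x => φ (x - x₀), φ.continuous.comp (by continuity)⟩,
    φ.hasCompactSupport'.comp_homeomorph (Homeomorph.subRight x₀)⟩

/-- `Ψ` is translation invariant: `Ψ(f(· − x₀); x₀ + B) = Ψ(f; B)`, i.e. in terms of test
functions, `Ψ(f(· − x₀))(φ(· − x₀)) = Ψ(f)(φ)`. -/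
def IsTranslationInvariant {n : ℕ} (Ψ : ConvFn n → RadonMeasure n) : Prop :=
  ∀ (x₀ : Eucl n) (f : ConvFn n) (φ : C_c(Eucl n, ℂ)),
    (Ψ (translateConv x₀ f)).1 (translateCc x₀ φ) = (Ψ f).1 φ

/-- The space `Poly_d(A(n,ℝ)) ⊗ M_n`: the span of the polynomial functions
`(s,v,A) ↦ Q(s,v) · (k-minor of A)` on `ℝ × ℝⁿ × Sym²(ℝⁿ)` with `deg Q ≤ d`, `0 ≤ k ≤ n`. -/
def TransInvPolySpace (n d : ℕ) : Submodule ℂ (ℝ → (Fin n → ℝ) → SymMatrix n → ℂ) :=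
  Submodule.span ℂ
    {P | ∃ (Q : MvPolynomial (Fin (n + 1)) ℂ) (k : ℕ) (σ τ : Fin k ↪ Fin n),
      k ≤ n ∧ Q.totalDegree ≤ d ∧
      P = fun (s : ℝ) (v : Fin n → ℝ) (A : SymMatrix n) =>
        MvPolynomial.eval (Fin.cons (s : ℂ) fun i => (v i : ℂ)) Q
          * (((A.1.submatrix σ τ).det : ℝ) : ℂ)}

/-- The integral representation `Ψ(f; B) = ∫_B P(f(x), ∇f(x), D²f(x)) dx` for all bounded
Borel sets `B`, expressed by testing against all functions in `C_c(ℝⁿ, ℂ)`. -/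
def TransInvRepresentation {n : ℕ} (Ψ : ConvFn n → RadonMeasure n)
    (P : ℝ → (Fin n → ℝ) → SymMatrix n → ℂ) : Prop :=
  ∀ f : ConvFn n, ContDiff ℝ 2 ⇑f.1 → ∀ φ : C_c(Eucl n, ℂ),
    (Ψ f).1 φ = ∫ x, φ x * P (f.1 x) (gradVec (⇑f.1) x) (symHess (⇑f.1) x) ∂(volume)

section Helpers
open Filter Topology

lemma tendsto_conv {n : ℕ} {ι : Type*} {l : Filter ι} {g : ι → ConvFn n} {f : ConvFn n} :
    Tendsto g l (𝓝 f) ↔ ∀ R : ℝ, ∀ ε > 0, ∀ᶠ i in l, ∀ x : Eucl n, ‖x‖ ≤ R →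
      |(g i).1 x - f.1 x| < ε := by
  rw [tendsto_subtype_rng, ContinuousMap.tendsto_iff_forall_isCompact_tendstoUniformlyOn]
  constructor
  · intro h R ε hε
    have := Metric.tendstoUniformlyOn_iff.1 (h (Metric.closedBall 0 R) (isCompact_closedBall _ _)) ε hε
    filter_upwards [this] with i hi x hx
    have := hi x (by simpa using hx)
    rw [dist_comm, Real.dist_eq] at this
    exact this
  · intro h K hK
    rw [Metric.tendstoUniformlyOn_iff]
    intro ε hε
    obtain ⟨R, hR⟩ := hK.isBounded.exists_norm_le
    filter_upwards [h R ε hε] with i hi x hx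
    rw [dist_comm, Real.dist_eq]
    exact hi x (hR x hx)

lemma nhds_conv {n : ℕ} (f : ConvFn n) (R : ℝ) {ε : ℝ} (hε : 0 < ε) :
    ∀ᶠ g in 𝓝 f, ∀ x : Eucl n, ‖x‖ ≤ R → |g.1 x - f.1 x| < ε :=
  tendsto_conv.1 (tendsto_id : Tendsto id (𝓝 f) (𝓝 f)) R ε hε

lemma continuous_addAffine {n : ℕ} (s : ℝ) (v : Eucl n) :
    Continuous fun f : ConvFn n => addAffine f s v := by
  rw [continuous_iff_continuousAt]
  intro f
  refine tendsto_conv.2 fun R ε hε => ?_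
  filter_upwards [nhds_conv f R hε] with g hg x hx
  simpa [addAffine] using hg x hx

lemma continuous_translateConv {n : ℕ} (x₀ : Eucl n) :
    Continuous fun f : ConvFn n => translateConv x₀ f := by
  rw [continuous_iff_continuousAt]
  intro f
  refine tendsto_conv.2 fun R ε hε => ?_
  filter_upwards [nhds_conv f (R + ‖x₀‖) hε] with g hg x hx
  exact hg (x - x₀) ((norm_sub_le _ _).trans (by linarith))

/-! polynomials -/
def ev {n : ℕ} (z : ℝ × Eucl n) : MvPolynomial (Fin (n + 1)) ℂ →+* ℂ :=
  MvPolynomial.eval (Fin.cons (z.1 : ℂ) fun i => (z.2 i : ℂ))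

def evL (n : ℕ) : MvPolynomial (Fin (n + 1)) ℂ →ₗ[ℂ] (ℝ × Eucl n → ℂ) where
  toFun := fun Q z => ev z Q
  map_add' := by intro P Q; ext z; simp
  map_smul' := by intro c Q; ext z; simp [ev]

def PolyV (n d : ℕ) : Submodule ℂ (ℝ × Eucl n → ℂ) :=
  (MvPolynomial.restrictTotalDegree (Fin (n + 1)) ℂ d).map (evL n)

lemma mem_PolyV {n d : ℕ} {F : ℝ × Eucl n → ℂ} :
    F ∈ PolyV n d ↔ ∃ Q : MvPolynomial (Fin (n + 1)) ℂ, Q.totalDegree ≤ d ∧ ∀ z, F z = ev z Q := by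
  simp only [PolyV, Submodule.mem_map, MvPolynomial.mem_restrictTotalDegree]
  constructor
  · rintro ⟨Q, hQ, rfl⟩
    exact ⟨Q, hQ, fun z => rfl⟩
  · rintro ⟨Q, hQ, h⟩
    exact ⟨Q, hQ, by ext z; exact (h z).symm⟩

instance finite_restrict (m d : ℕ) :
    Module.Finite ℂ (MvPolynomial.restrictTotalDegree (Fin m) ℂ d) := by
  have hfin : {x : Fin m →₀ ℕ | (x.sum fun _ e => e) ≤ d}.Finite := by
    refine (Set.Finite.subset (Set.finite_Iic (Finsupp.equivFunOnFinite.symm fun _ => d)) ?_)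
    intro x hx i
    simp only [Set.mem_setOf_eq] at hx
    refine le_trans ?_ hx
    by_cases hi : i ∈ x.support
    · exact Finset.single_le_sum (f := fun j => x j) (fun _ _ => Nat.zero_le _) hi
    · simp only [Finsupp.mem_support_iff, not_not] at hi; simp [hi]
  have := hfin.to_subtype
  exact Module.Finite.of_basis (MvPolynomial.basisRestrictSupport ℂ
    {x : Fin m →₀ ℕ | (x.sum fun _ e => e) ≤ d})

instance finite_PolyV (n d : ℕ) : Module.Finite ℂ (PolyV n d) := by
  unfold PolyV; infer_instance

lemma ev_continuous {n : ℕ} (Q : MvPolynomial (Fin (n + 1)) ℂ) :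
    Continuous fun z : ℝ × Eucl n => ev z Q := by
  unfold ev
  refine (MvPolynomial.continuous_eval Q).comp ?_
  refine continuous_pi fun i => ?_
  refine Fin.cases ?_ (fun j => ?_) i
  · simp only [Fin.cons_zero]; fun_prop
  · simp only [Fin.cons_succ]
    exact Complex.continuous_ofReal.comp (by fun_prop)

lemma PolyV_continuous {n d : ℕ} {F : ℝ × Eucl n → ℂ} (hF : F ∈ PolyV n d) : Continuous F := by
  obtain ⟨Q, -, h⟩ := mem_PolyV.1 hF
  rw [show F = fun z => ev z Q from funext h]
  exact ev_continuous Q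

lemma interp_aux {Z : Type*} : ∀ (m : ℕ) (V : Submodule ℂ (Z → ℂ)) [Module.Finite ℂ V],
    Module.finrank ℂ V = m →
    ∃ (N : ℕ) (z : Fin N → Z) (b : Fin N → Z → ℂ), (∀ k, b k ∈ V) ∧
      ∀ F ∈ V, ∀ x, F x = ∑ k, F (z k) * b k x := by
  intro m
  induction m using Nat.strong_induction_on with
  | _ m ih =>
  intro V _ hV
  by_cases hbot : V = ⊥
  · subst hbot
    refine ⟨0, Fin.elim0, Fin.elim0, fun k => k.elim0, ?_⟩
    intro F hF x
    rw [(Submodule.mem_bot ℂ).1 hF]; simp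
  obtain ⟨F₁, hF₁, hne⟩ := (Submodule.ne_bot_iff V).1 hbot
  obtain ⟨z₀, hz₀⟩ : ∃ z, F₁ z ≠ 0 := by
    by_contra! h; exact hne (funext h)
  set F₀ : Z → ℂ := (F₁ z₀)⁻¹ • F₁ with hF₀
  have hF₀V : F₀ ∈ V := V.smul_mem _ hF₁
  have hF₀z : F₀ z₀ = 1 := by simp [hF₀, hz₀]
  let V' : Submodule ℂ (Z → ℂ) := V ⊓ LinearMap.ker (LinearMap.proj z₀ : (Z → ℂ) →ₗ[ℂ] ℂ)
  have hlt : V' < V := by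
    refine lt_of_le_of_ne inf_le_left fun h => ?_
    have : F₀ ∈ V' := h ▸ hF₀V
    have h2 := (Submodule.mem_inf.1 this).2
    simp only [LinearMap.mem_ker, LinearMap.proj_apply] at h2
    rw [hF₀z] at h2; exact one_ne_zero h2
  haveI : Module.Finite ℂ V' := Submodule.finiteDimensional_of_le hlt.le
  obtain ⟨N, z, b, hb, hint⟩ := ih _ (hV ▸ Submodule.finrank_lt_finrank_of_lt hlt) V' rfl
  refine ⟨N + 1, Fin.cons z₀ z, Fin.cons (F₀ - ∑ k, F₀ (z k) • b k) b, ?_, ?_⟩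
  · intro k
    refine Fin.cases ?_ (fun j => ?_) k
    · simp only [Fin.cons_zero]
      exact V.sub_mem hF₀V (V.sum_mem fun k _ => V.smul_mem _ (hb k).1)
    · simpa using (hb j).1
  · intro F hF x
    have hG : F - F z₀ • F₀ ∈ V' := by
      refine ⟨V.sub_mem hF (V.smul_mem _ hF₀V), ?_⟩
      simp [hF₀z]
    have := hint _ hG x
    simp only [Pi.sub_apply, Pi.smul_apply, smul_eq_mul, sub_mul, Finset.sum_sub_distrib] at this
    rw [Fin.sum_univ_succ]
    simp only [Fin.cons_zero, Fin.cons_succ, Pi.sub_apply, Finset.sum_apply, Pi.smul_apply,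
      smul_eq_mul, mul_sub, Finset.mul_sum]
    rw [sub_eq_iff_eq_add] at this
    rw [this]
    simp only [mul_assoc]
    ring

lemma interp (n d : ℕ) :
    ∃ (N : ℕ) (z : Fin N → ℝ × Eucl n) (b : Fin N → ℝ × Eucl n → ℂ), (∀ k, b k ∈ PolyV n d) ∧
      ∀ F ∈ PolyV n d, ∀ x, F x = ∑ k, F (z k) * b k x :=
  interp_aux _ (PolyV n d) rfl

def aA {n : ℕ} (f : ConvFn n) (z : ℝ × Eucl n) : ConvFn n := addAffine f z.1 z.2

lemma aA_apply {n : ℕ} (f : ConvFn n) (z : ℝ × Eucl n) (x : Eucl n) :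
    (aA f z).1 x = f.1 x + (z.1 + inner ℝ z.2 x) := rfl

lemma polyDeg_iff {n d : ℕ} (Ψ : ConvFn n → RadonMeasure n) :
    IsPolynomialDeg d Ψ ↔ ∀ f φ, (fun z => (Ψ (aA f z)).1 φ) ∈ PolyV n d := by
  simp only [IsPolynomialDeg, mem_PolyV]
  constructor
  · intro h f φ
    obtain ⟨P, hP, h⟩ := h f φ
    exact ⟨P, hP, fun z => h z.1 z.2⟩
  · intro h f φ
    obtain ⟨P, hP, h⟩ := h f φ
    exact ⟨P, hP, fun s v => h (s, v)⟩

/-! the functional on bounded continuous functions -/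
open scoped BoundedContinuousFunction

def cutCc {n : ℕ} (R : ℝ) : C_c(Eucl n, ℂ) :=
  ⟨⟨fun x => ((max 0 (min 1 (R + 1 - ‖x‖)) : ℝ) : ℂ), by fun_prop⟩, by
    refine HasCompactSupport.intro (isCompact_closedBall (0 : Eucl n) (R + 1)) fun x hx => ?_
    simp only [Metric.mem_closedBall, dist_zero_right, not_le] at hx
    simp only [Complex.ofReal_eq_zero]
    rw [max_eq_left]
    exact (min_le_right _ _).trans (by linarith)⟩

lemma cutCc_apply {n : ℕ} (R : ℝ) (x : Eucl n) :
    cutCc R x = ((max 0 (min 1 (R + 1 - ‖x‖)) : ℝ) : ℂ) := rfl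

lemma cutCc_norm {n : ℕ} (R : ℝ) (x : Eucl n) : ‖cutCc R x‖ ≤ 1 := by
  rw [cutCc_apply, Complex.norm_real, Real.norm_eq_abs, abs_of_nonneg (le_max_left _ _)]
  exact max_le zero_le_one (min_le_left _ _)

lemma cutCc_one {n : ℕ} {R : ℝ} {x : Eucl n} (hx : ‖x‖ ≤ R) : cutCc R x = 1 := by
  rw [cutCc_apply, min_eq_left (by linarith), max_eq_right zero_le_one]; simp

lemma cutCc_supp {n : ℕ} (R : ℝ) :
    tsupport (cutCc R : C_c(Eucl n, ℂ)) ⊆ Metric.closedBall 0 (R + 1) := by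
  refine closure_minimal ?_ Metric.isClosed_closedBall
  intro x hx
  by_contra h
  simp only [Metric.mem_closedBall, dist_zero_right, not_le] at h
  refine hx ?_
  rw [cutCc_apply, max_eq_left]
  · simp
  · exact (min_le_right _ _).trans (by linarith)

def mulCc {n : ℕ} (χ : C_c(Eucl n, ℂ)) (g : Eucl n →ᵇ ℂ) : C_c(Eucl n, ℂ) :=
  ⟨⟨fun x => χ x * g x, χ.continuous.mul g.continuous⟩, χ.hasCompactSupport'.mul_right⟩

lemma mulCc_apply {n : ℕ} (χ : C_c(Eucl n, ℂ)) (g : Eucl n →ᵇ ℂ) (x : Eucl n) :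
    mulCc χ g x = χ x * g x := rfl

lemma radon_bound {n : ℕ} (μ : RadonMeasure n) (K : Set (Eucl n)) (hK : IsCompact K) :
    ∃ C : ℝ, 0 ≤ C ∧ ∀ φ : C_c(Eucl n, ℂ), tsupport ⇑φ ⊆ K → ∀ a : ℝ, 0 ≤ a → (∀ x, ‖φ x‖ ≤ a) →
      ‖μ.1 φ‖ ≤ C * a := by
  obtain ⟨C, hC⟩ := μ.2 K hK
  refine ⟨max C 0, le_max_right _ _, fun φ hφ a ha hb => ?_⟩
  have key : ∀ b > 0, (∀ x, ‖φ x‖ ≤ b) → ‖μ.1 φ‖ ≤ max C 0 * b := by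
    intro b hb hx
    have h1 := hC ((b⁻¹ : ℂ) • φ) ?_ ?_
    · rw [map_smul, norm_smul] at h1
      have : ‖((b : ℂ))⁻¹‖ = b⁻¹ := by simp [abs_of_pos hb]
      rw [this, inv_mul_le_iff₀ hb] at h1
      calc _ ≤ b * C := h1
        _ ≤ max C 0 * b := by rw [mul_comm]; gcongr; exact le_max_left _ _
    · refine (closure_mono ?_).trans hφ
      intro x hx h0
      refine hx ?_
      simp [h0]
    · intro x
      have : ‖((b : ℂ))⁻¹‖ = b⁻¹ := by simp [abs_of_pos hb]
      simp only [CompactlySupportedContinuousMap.coe_smul, Pi.smul_apply, norm_smul, this]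
      rw [inv_mul_le_iff₀ hb]; simpa using hx x
  refine le_of_forall_pos_le_add fun ε hε => ?_
  have := key (a + ε / (max C 0 + 1)) (by positivity) fun x => (hb x).trans (by
    have : 0 < ε / (max C 0 + 1) := by positivity
    linarith)
  refine this.trans ?_
  rw [mul_add]
  gcongr
  rw [mul_div_assoc', div_le_iff₀ (by positivity)]
  nlinarith [le_max_right C 0]

def bcfFun {n : ℕ} (μ : RadonMeasure n) (χ : C_c(Eucl n, ℂ)) : (Eucl n →ᵇ ℂ) →L[ℂ] ℂ :=
  LinearMap.mkContinuousOfExistsBound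
    { toFun := fun g => μ.1 (mulCc χ g)
      map_add' := by
        intro f g
        rw [← map_add]; congr 1; ext x
        simp [mulCc_apply, mul_add]
      map_smul' := by
        intro c g
        rw [← map_smul]; congr 1; ext x
        simp [mulCc_apply]; ring }
    (by
      obtain ⟨C, hC0, hC⟩ := radon_bound μ (tsupport χ) χ.hasCompactSupport'
      obtain ⟨M, hM⟩ := χ.hasCompactSupport'.exists_bound_of_continuous χ.continuous
      have hM0 : 0 ≤ M := (norm_nonneg _).trans (hM 0)
      refine ⟨C * M, fun g => ?_⟩
      rw [mul_assoc]
      refine hC _ (closure_mono fun x hx h0 => hx ?_) _ (by positivity) fun x => ?_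
      · show χ x * g x = 0
        rw [show χ x = 0 from h0, zero_mul]
      · rw [mulCc_apply, norm_mul]
        exact mul_le_mul (hM x) (g.norm_coe_le_norm x) (norm_nonneg _) hM0)

lemma bcfFun_apply {n : ℕ} (μ : RadonMeasure n) (χ : C_c(Eucl n, ℂ)) (g : Eucl n →ᵇ ℂ) :
    bcfFun μ χ g = μ.1 (mulCc χ g) := rfl

def ccToBcf {n : ℕ} (φ : C_c(Eucl n, ℂ)) : Eucl n →ᵇ ℂ :=
  BoundedContinuousFunction.ofNormedAddCommGroup φ φ.continuous
    (φ.hasCompactSupport'.exists_bound_of_continuous φ.continuous).choose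
    (φ.hasCompactSupport'.exists_bound_of_continuous φ.continuous).choose_spec

lemma ccToBcf_apply {n : ℕ} (φ : C_c(Eucl n, ℂ)) (x : Eucl n) : ccToBcf φ x = φ x := rfl

lemma mulCc_cut {n : ℕ} {R : ℝ} (φ : C_c(Eucl n, ℂ)) (h : ∀ x, φ x ≠ 0 → ‖x‖ ≤ R) :
    mulCc (cutCc R) (ccToBcf φ) = φ := by
  ext x
  rw [mulCc_apply, ccToBcf_apply]
  by_cases hx : φ x = 0
  · simp [hx]
  · rw [cutCc_one (h x hx), one_mul]

/-- Banach-Steinhaus: uniform mass bound along a convergent sequence. -/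
lemma mass_seq {n : ℕ} {Ψ : ConvFn n → RadonMeasure n} (hc : IsContinuousFunctional Ψ)
    {g : ℕ → ConvFn n} {f : ConvFn n} (hg : Tendsto g atTop (𝓝 f)) (R : ℝ) :
    ∃ C : ℝ, ∀ m, ∀ φ : C_c(Eucl n, ℂ), (∀ x, φ x ≠ 0 → ‖x‖ ≤ R) → (∀ x, ‖φ x‖ ≤ 1) →
      ‖(Ψ (g m)).1 φ‖ ≤ C := by
  obtain ⟨C, hC⟩ := banach_steinhaus (g := fun m => bcfFun (Ψ (g m)) (cutCc R)) (fun x => by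
    have h1 := ((hc (mulCc (cutCc R) x)).tendsto f).comp hg
    obtain ⟨C, hC⟩ := h1.norm.bddAbove_range
    exact ⟨C, fun m => hC ⟨m, rfl⟩⟩)
  refine ⟨C, fun m φ hφ hb => ?_⟩
  have h1 := (bcfFun (Ψ (g m)) (cutCc R)).le_of_opNorm_le (hC m) (ccToBcf φ)
  rw [bcfFun_apply, mulCc_cut φ hφ] at h1
  refine h1.trans ?_
  have hC0 : 0 ≤ C := (norm_nonneg _).trans (hC m)
  have : ‖ccToBcf φ‖ ≤ 1 := (BoundedContinuousFunction.norm_le zero_le_one).2 hb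
  nlinarith

def c2 (n : ℕ) : Set (ConvFn n) := {f | ContDiff ℝ 2 ⇑f.1}

lemma grad_ineq {n : ℕ} {f : Eucl n → ℝ} (hf : ConvexOn ℝ Set.univ f) {x : Eucl n}
    {f' : Eucl n →L[ℝ] ℝ} (hd : HasFDerivAt f f' x) (y : Eucl n) : f x + f' (y - x) ≤ f y := by
  have h1 := hd.hasLineDerivAt (y - x)
  rw [hasLineDerivAt_iff_tendsto_slope_zero] at h1
  have h2 := h1.mono_left (nhdsWithin_mono 0 (fun t (ht : 0 < t) => ht.ne') : 𝓝[>] (0 : ℝ) ≤ _)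
  have h3 : f' (y - x) ≤ f y - f x := by
    refine le_of_tendsto h2 ?_
    filter_upwards [Ioc_mem_nhdsGT (zero_lt_one' ℝ)] with t ht
    have := hf.2 (Set.mem_univ x) (Set.mem_univ y) (by linarith [ht.2] : 0 ≤ 1 - t) ht.1.le (by ring)
    rw [show (1 - t) • x + t • y = x + t • (y - x) by module] at this
    simp only [smul_eq_mul] at this ⊢
    rw [inv_mul_le_iff₀ ht.1]
    linarith
  linarith

open scoped Convolution in
def bump {n : ℕ} (m : ℕ) : ContDiffBump (0 : Eucl n) :=
  ⟨1 / (2 * (m + 1)), 1 / (m + 1), by positivity, by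
    apply one_div_lt_one_div_of_lt <;> linarith [(Nat.cast_nonneg m : (0:ℝ) ≤ m)]⟩

def eta {n : ℕ} (m : ℕ) : Eucl n → ℝ := (bump m).normed volume

lemma eta_nonneg {n : ℕ} (m : ℕ) (x : Eucl n) : 0 ≤ eta m x := (bump m).nonneg_normed x

lemma eta_contDiff {n : ℕ} (m : ℕ) (k : ℕ∞) : ContDiff ℝ k (eta m : Eucl n → ℝ) :=
  (bump m).contDiff_normed

lemma eta_cont {n : ℕ} (m : ℕ) : Continuous (eta m : Eucl n → ℝ) := (bump m).continuous_normed

lemma eta_compact {n : ℕ} (m : ℕ) : HasCompactSupport (eta m : Eucl n → ℝ) :=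
  (bump m).hasCompactSupport_normed

lemma eta_integral {n : ℕ} (m : ℕ) : ∫ x : Eucl n, eta m x = 1 := (bump m).integral_normed

lemma eta_supp {n : ℕ} (m : ℕ) {x : Eucl n} (h : eta m x ≠ 0) : ‖x‖ < 1 / (m + 1) := by
  have : x ∈ Function.support ((bump m).normed volume : Eucl n → ℝ) := h
  rw [ContDiffBump.support_normed_eq] at this
  simpa [bump] using this

lemma eta_le (n : ℕ) : ∃ C : ℝ, 0 ≤ C ∧ ∀ (m : ℕ) (x : Eucl n), eta m x ≤ C * (m + 1) ^ n := by
  refine ⟨2 ^ n / (volume : Measure (Eucl n)).real (Metric.ball 0 1), by positivity,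
    fun m x => ?_⟩
  have := (bump (n := n) m).normed_le_div_measure_closedBall_rOut volume 2 (by
    simp only [bump]; field_simp; rfl) x
  refine this.trans (le_of_eq ?_)
  rw [Measure.addHaar_real_closedBall _ _ (by simp only [bump]; positivity)]
  simp [bump]
  field_simp

open scoped Convolution in
def moll {n : ℕ} {E : Type*} [NormedAddCommGroup E] [NormedSpace ℝ E] (m : ℕ) (g : Eucl n → E) :
    Eucl n → E := eta m ⋆[ContinuousLinearMap.lsmul ℝ ℝ, volume] g

lemma moll_apply {n : ℕ} {E : Type*} [NormedAddCommGroup E] [NormedSpace ℝ E] (m : ℕ)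
    (g : Eucl n → E) (x : Eucl n) : moll m g x = ∫ t, eta m t • g (x - t) := rfl

lemma moll_integrable {n : ℕ} {E : Type*} [NormedAddCommGroup E] [NormedSpace ℝ E] (m : ℕ)
    {g : Eucl n → E} (hg : Continuous g) (x : Eucl n) :
    Integrable (fun t => eta m t • g (x - t)) :=
  ((eta_cont m).smul (hg.comp (by fun_prop))).integrable_of_hasCompactSupport
    (eta_compact m).smul_right

lemma moll_contDiff {n : ℕ} {E : Type*} [NormedAddCommGroup E] [NormedSpace ℝ E]
    (m : ℕ) {g : Eucl n → E} (hg : Continuous g) (k : ℕ∞) : ContDiff ℝ k (moll m g) :=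
  (eta_compact m).contDiff_convolution_left _ (eta_contDiff m k) hg.locallyIntegrable

lemma moll_close {n : ℕ} {E : Type*} [NormedAddCommGroup E] [NormedSpace ℝ E] [CompleteSpace E]
    {g : Eucl n → E} (hg : Continuous g) (R : ℝ) {ε : ℝ} (hε : 0 < ε) :
    ∃ m0 : ℕ, ∀ m ≥ m0, ∀ x, ‖x‖ ≤ R → dist (moll m g x) (g x) ≤ ε := by
  have hu := (isCompact_closedBall (0 : Eucl n) (R + 1)).uniformContinuousOn_of_continuous
    hg.continuousOn
  rw [Metric.uniformContinuousOn_iff] at hu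
  obtain ⟨δ, hδ, hu⟩ := hu ε hε
  obtain ⟨m0, hm0⟩ := exists_nat_one_div_lt hδ
  refine ⟨m0, fun m hm x hx => ?_⟩
  refine ContDiffBump.dist_normed_convolution_le (φ := bump m) hg.aestronglyMeasurable ?_
  intro y hy
  have hy' : dist y x < 1 / ((m : ℝ) + 1) := by simpa [bump] using hy
  have h1 : 1 / ((m : ℝ) + 1) ≤ 1 / ((m0 : ℝ) + 1) := by
    apply one_div_le_one_div_of_le; positivity
    have : (m0 : ℝ) ≤ m := by exact_mod_cast hm
    linarith
  have h2 : 1 / ((m : ℝ) + 1) ≤ 1 := by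
    rw [div_le_one (by positivity)]; linarith [(Nat.cast_nonneg m : (0:ℝ) ≤ m)]
  refine (hu y ?_ x ?_ (by linarith)).le
  · rw [mem_closedBall_zero_iff]
    have : ‖y‖ ≤ ‖y - x‖ + ‖x‖ := by simpa using norm_add_le (y - x) x
    rw [dist_eq_norm] at hy'
    linarith
  · rw [mem_closedBall_zero_iff]; linarith

def mollC {n : ℕ} (m : ℕ) (f : ConvFn n) : ConvFn n :=
  ⟨⟨moll m f.1, (moll_contDiff m f.1.continuous 0).continuous⟩, by
    refine ⟨convex_univ, fun x _ y _ a b ha hb hab => ?_⟩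
    simp only [ContinuousMap.coe_mk, moll_apply, smul_eq_mul]
    rw [← integral_const_mul, ← integral_const_mul, ← integral_add]
    rotate_left
    · exact ((moll_integrable m f.1.continuous x).const_mul a)
    · exact ((moll_integrable m f.1.continuous y).const_mul b)
    refine integral_mono (moll_integrable m f.1.continuous _)
      (((moll_integrable m f.1.continuous x).const_mul a).add
        ((moll_integrable m f.1.continuous y).const_mul b)) fun t => ?_
    have h := f.2.2 (Set.mem_univ (x - t)) (Set.mem_univ (y - t)) ha hb hab
    rw [show a • (x - t) + b • (y - t) = a • x + b • y - t by
      rw [show b = 1 - a by linarith]; module] at h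
    have := mul_le_mul_of_nonneg_left h (eta_nonneg m t)
    simp only [smul_eq_mul] at this ⊢
    linarith⟩

lemma mollC_smooth {n : ℕ} (m : ℕ) (f : ConvFn n) : mollC m f ∈ c2 n := by
  have := moll_contDiff m f.1.continuous 2
  exact_mod_cast this

lemma mollC_tendsto {n : ℕ} (f : ConvFn n) : Tendsto (fun m => mollC m f) atTop (𝓝 f) := by
  refine tendsto_conv.2 fun R ε hε => ?_
  obtain ⟨m0, h⟩ := moll_close f.1.continuous R (half_pos hε)
  filter_upwards [eventually_ge_atTop m0] with m hm x hx
  have := h m hm x hx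
  rw [Real.dist_eq] at this
  exact this.trans_lt (by linarith)

lemma mollC_local {n : ℕ} (m : ℕ) (f g : ConvFn n) (x : Eucl n)
    (h : ∀ y, dist y x < 1 / (m + 1) → f.1 y = g.1 y) : (mollC m f).1 x = (mollC m g).1 x := by
  show moll m _ _ = moll m _ _
  rw [moll_apply, moll_apply]
  refine integral_congr_ae (ae_of_all _ fun t => ?_)
  by_cases ht : eta m t = 0
  · simp [ht]
  · simp only
    rw [h (x - t) (by simpa [dist_eq_norm] using eta_supp m ht)]

lemma c2_dense (n : ℕ) : Dense (c2 n) := fun f =>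
  mem_closure_of_tendsto (mollC_tendsto f) (Eventually.of_forall fun m => mollC_smooth m f)

lemma det_clm {n : ℕ} (A : Eucl n →L[ℝ] Eucl n) :
    A.det = (Matrix.of fun i j => (A (EuclideanSpace.single j 1)) i).det := by
  rw [ContinuousLinearMap.det, ← LinearMap.det_toMatrix (EuclideanSpace.basisFun (Fin n) ℝ).toBasis]
  congr 1

lemma fderiv_coord {n : ℕ} {G : Eucl n → Eucl n} {x : Eucl n} (h : DifferentiableAt ℝ G x)
    (v : Eucl n) (i : Fin n) : fderiv ℝ (fun y => G y i) x v = fderiv ℝ G x v i := by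
  have := ((EuclideanSpace.proj i : Eucl n →L[ℝ] ℝ).hasFDerivAt.comp x h.hasFDerivAt).fderiv
  exact congrArg (fun A : Eucl n →L[ℝ] ℝ => A v) this

lemma det_pos_of_inner {n : ℕ} (A : Eucl n →L[ℝ] Eucl n)
    (h : ∀ v, v ≠ 0 → 0 < inner ℝ (A v) v) : 0 < A.det := by
  let F : ℝ → ℝ := fun t => ((1 - t) • ContinuousLinearMap.id ℝ (Eucl n) + t • A).det
  have hF : Continuous F := ContinuousLinearMap.continuous_det.comp (by fun_prop)
  have hne : ∀ t ∈ Set.Icc (0:ℝ) 1, F t ≠ 0 := by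
    intro t ht
    have : IsUnit (((1 - t) • ContinuousLinearMap.id ℝ (Eucl n) + t • A : Eucl n →L[ℝ] Eucl n) :
        Eucl n →ₗ[ℝ] Eucl n) := by
      rw [LinearMap.isUnit_iff_ker_eq_bot, LinearMap.ker_eq_bot']
      intro v hv
      by_contra hv0
      have h1 := congrArg (fun w => inner ℝ w v) hv
      simp only [ContinuousLinearMap.coe_coe, _root_.add_apply, _root_.smul_apply,
        ContinuousLinearMap.id_apply, inner_add_left, real_inner_smul_left, inner_zero_left] at h1
      have h2 := h v hv0
      have h3 : 0 < inner ℝ v v := real_inner_self_pos.2 hv0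
      rcases eq_or_lt_of_le ht.1 with h0 | h0
      · subst h0; simp at h1; exact hv0 h1
      · nlinarith [mul_pos h0 h2, mul_nonneg (sub_nonneg.2 ht.2) h3.le]
    exact (LinearMap.isUnit_det _ this).ne_zero
  have h0 : F 0 = 1 := by simp [F, ContinuousLinearMap.det]
  have h1 : F 1 = A.det := by
    show ContinuousLinearMap.det _ = _
    congr 1; ext v; simp
  by_contra hcon
  have := intermediate_value_Icc' (zero_le_one' ℝ) hF.continuousOn
  obtain ⟨t, ht, ht'⟩ := this ⟨h1 ▸ not_lt.1 hcon, h0 ▸ zero_le_one⟩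
  exact hne t ht ht'

lemma det_interp (n : ℕ) (L : ℝ) : ∃ (s c : Fin (n + 1) → ℝ), (∀ k, L < s k ∧ 0 < s k) ∧
    ∀ M : Matrix (Fin n) (Fin n) ℝ, M.det = ∑ k, c k * (s k • (1 : Matrix _ _ ℝ) + M).det := by
  refine ⟨fun k => |L| + 1 + k, fun k => (Lagrange.basis Finset.univ
    (fun k : Fin (n + 1) => |L| + 1 + (k : ℝ)) k).eval 0, fun k => ?_, fun M => ?_⟩
  · have : (0:ℝ) ≤ k := Nat.cast_nonneg _
    constructor <;> linarith [le_abs_self L, abs_nonneg L]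
  · have := Lagrange.eq_interpolate (F := ℝ) (s := (Finset.univ : Finset (Fin (n + 1))))
      (v := fun k : Fin (n + 1) => |L| + 1 + (k : ℝ)) (f := (-M).charpoly)
      (fun a _ b _ hab => by simpa [Fin.ext_iff] using hab)
      (by rw [charpoly_degree_eq_dim]; simp; exact_mod_cast Nat.lt_succ_self n)
    have h2 := congrArg (Polynomial.eval 0) this
    rw [Matrix.eval_charpoly, Lagrange.interpolate_apply, Polynomial.eval_finsetSum] at h2
    simp only [Matrix.eval_charpoly, Polynomial.eval_mul, Polynomial.eval_C, map_zero,
      sub_neg_eq_add, zero_add] at h2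
    rw [h2]
    refine Finset.sum_congr rfl fun k _ => ?_
    rw [mul_comm, Matrix.scalar_apply, ← Matrix.smul_one_eq_diagonal]

def jac {n : ℕ} (u : Fin n → Eucl n → ℝ) (x : Eucl n) : Matrix (Fin n) (Fin n) ℝ :=
  Matrix.of fun i j => fderiv ℝ (u i) x (EuclideanSpace.single j 1)

lemma jac_cont {n : ℕ} {u : Fin n → Eucl n → ℝ} (hu : ∀ i, ContDiff ℝ 1 (u i)) :
    Continuous (jac u) := by
  refine continuous_matrix fun i j => ?_
  exact ((hu i).continuous_fderiv one_ne_zero).clm_apply continuous_const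

lemma nl_aux {n : ℕ} {G : Fin n → Eucl n → ℝ} (hG : ∀ i, ContDiff ℝ 1 (G i)) {R : ℝ} (hR : 0 < R)
    (hs : ∀ i x, R ≤ ‖x‖ → G i x = 0) : ∃ L, ∀ s, L < s → 0 < s →
    ∫ x in Metric.ball 0 R, (s • (1 : Matrix _ _ ℝ) + jac G x).det =
      s ^ n * (volume : Measure (Eucl n)).real (Metric.ball 0 R) := by
  let Gv : Eucl n → Eucl n := fun x => WithLp.toLp 2 fun i => G i x
  have hGv : ContDiff ℝ 1 Gv := contDiff_euclidean.2 hG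
  have hGc : HasCompactSupport Gv := HasCompactSupport.intro (isCompact_closedBall 0 R)
    fun x hx => by
      ext i
      exact hs i x (by simpa using (not_le.1 (by simpa using hx)).le)
  obtain ⟨L, hL⟩ := hGv.lipschitzWith_of_hasCompactSupport hGc one_ne_zero
  refine ⟨L, fun s hs1 hs0 => ?_⟩
  let F : Eucl n → Eucl n := fun x => s • x + Gv x
  have hd : ∀ x, HasFDerivAt F (s • ContinuousLinearMap.id ℝ (Eucl n) + fderiv ℝ Gv x) x :=
    fun x => ((hasFDerivAt_id x).const_smul s).add
      ((hGv.differentiable one_ne_zero) x).hasFDerivAt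
  have hinj : Function.Injective F := by
    intro x y hxy
    have h1 : s • (x - y) = Gv y - Gv x := by
      have : s • x + Gv x = s • y + Gv y := hxy
      rw [smul_sub, sub_eq_sub_iff_add_eq_add, this]; abel
    have h2 : s * ‖x - y‖ ≤ L * ‖x - y‖ := by
      calc s * ‖x - y‖ = ‖s • (x - y)‖ := by rw [norm_smul, Real.norm_of_nonneg hs0.le]
        _ = dist (Gv x) (Gv y) := by rw [h1, dist_eq_norm, norm_sub_rev]
        _ ≤ L * dist x y := hL.dist_le_mul x y
        _ = _ := by rw [dist_eq_norm]
    by_contra hne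
    have : 0 < ‖x - y‖ := norm_pos_iff.2 (sub_ne_zero.2 hne)
    nlinarith
  have hsurj : Function.Surjective F := by
    intro y
    have hc : ContractingWith (L / s.toNNReal) fun x => s⁻¹ • (y - Gv x) := by
      refine ⟨?_, LipschitzWith.of_dist_le_mul fun a b => ?_⟩
      · rw [div_lt_one (Real.toNNReal_pos.2 hs0)]
        exact NNReal.coe_lt_coe.1 (by rwa [Real.coe_toNNReal _ hs0.le])
      · rw [dist_smul₀, dist_sub_left, NNReal.coe_div, Real.coe_toNNReal _ hs0.le, norm_inv,
          Real.norm_of_nonneg hs0.le]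
        calc s⁻¹ * dist (Gv a) (Gv b) ≤ s⁻¹ * (L * dist a b) := by
              gcongr; exact hL.dist_le_mul a b
          _ = _ := by ring
    refine ⟨hc.fixedPoint _, ?_⟩
    have := hc.fixedPoint_isFixedPt
    unfold Function.IsFixedPt at this
    show s • hc.fixedPoint _ + Gv (hc.fixedPoint _) = y
    nth_rewrite 1 [← this]
    rw [smul_inv_smul₀ hs0.ne']; abel
  have hout : ∀ x, R ≤ ‖x‖ → F x = s • x := fun x hx => by
    have : Gv x = 0 := by ext i; exact hs i x hx
    simp [F, this]
  have himg : F '' Metric.ball 0 R = Metric.ball 0 (s * R) := by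
    have hcompl : F '' (Metric.ball 0 R)ᶜ = (Metric.ball 0 (s * R))ᶜ := by
      ext y
      simp only [Set.mem_image, Set.mem_compl_iff, mem_ball_zero_iff, not_lt]
      constructor
      · rintro ⟨x, hx, rfl⟩
        rw [hout x hx, norm_smul, Real.norm_of_nonneg hs0.le]; gcongr
      · intro hy
        have : R ≤ ‖s⁻¹ • y‖ := by
          rw [norm_smul, norm_inv, Real.norm_of_nonneg hs0.le, le_inv_mul_iff₀ hs0]; exact hy
        exact ⟨s⁻¹ • y, this, by rw [hout _ this, smul_inv_smul₀ hs0.ne']⟩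
    rw [← compl_inj_iff, ← hcompl, Set.image_compl_eq ⟨hinj, hsurj⟩]
  have key := integral_image_eq_integral_abs_det_fderiv_smul (μ := (volume : Measure (Eucl n)))
    (s := Metric.ball 0 R) measurableSet_ball (fun x _ => (hd x).hasFDerivWithinAt)
    hinj.injOn (fun _ => (1 : ℝ))
  rw [himg] at key
  simp only [smul_eq_mul, mul_one, integral_const, Measure.real, Measure.restrict_apply_univ] at key
  rw [Measure.addHaar_ball_of_pos _ _ (by positivity)] at key
  rw [Measure.real, Measure.addHaar_ball_of_pos _ _ hR]
  simp only [ENNReal.toReal_mul, finrank_euclideanSpace, Fintype.card_fin] at key ⊢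
  rw [ENNReal.toReal_ofReal (by positivity)] at key ⊢
  rw [← mul_assoc, ← mul_pow, key]
  refine integral_congr_ae (ae_of_all _ fun x => ?_)
  simp only
  have hpos : 0 < (s • ContinuousLinearMap.id ℝ (Eucl n) + fderiv ℝ Gv x).det := by
    refine det_pos_of_inner _ fun v hv => ?_
    simp only [_root_.add_apply, _root_.smul_apply, ContinuousLinearMap.id_apply, inner_add_left,
      real_inner_smul_left]
    have h1 : |inner ℝ (fderiv ℝ Gv x v) v| ≤ L * ‖v‖ * ‖v‖ := by
      refine (abs_real_inner_le_norm _ _).trans ?_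
      gcongr
      exact (fderiv ℝ Gv x).le_of_opNorm_le (norm_fderiv_le_of_lipschitz ℝ hL) v
    have h2 := (abs_le.1 h1).1
    rw [real_inner_self_eq_norm_sq]
    have : 0 < ‖v‖ := norm_pos_iff.2 hv
    nlinarith [mul_pos this this]
  rw [abs_of_pos hpos, det_clm]
  congr 1
  ext i j
  have h3 : (fderiv ℝ Gv x (EuclideanSpace.single j 1)) i
      = fderiv ℝ (G i) x (EuclideanSpace.single j 1) := by
    rw [← fderiv_coord ((hGv.differentiable one_ne_zero) x)]
  simp [jac, h3, Matrix.one_apply]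

/-- Integral of the Jacobian determinant of a compactly supported map. -/
lemma nl_zero {n : ℕ} (hn : n ≠ 0) {G : Fin n → Eucl n → ℝ} (hG : ∀ i, ContDiff ℝ 1 (G i)) {R : ℝ}
    (hR : 0 < R) (hs : ∀ i x, R ≤ ‖x‖ → G i x = 0) :
    ∫ x in Metric.ball 0 R, (jac G x).det = 0 := by
  obtain ⟨L, hL⟩ := nl_aux hG hR hs
  obtain ⟨s, c, hsc, hdet⟩ := det_interp n L
  have hI : ∀ k, IntegrableOn (fun x => (s k • (1 : Matrix _ _ ℝ) + jac G x).det)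
      (Metric.ball (0 : Eucl n) R) := fun k =>
    (((continuous_const.add (jac_cont hG)).matrix_det).continuousOn.integrableOn_compact
      (isCompact_closedBall 0 R)).mono_set Metric.ball_subset_closedBall
  simp_rw [fun x => hdet (jac G x)]
  rw [integral_finsetSum _ fun k _ => (hI k).const_mul _]
  simp_rw [integral_const_mul, fun k => hL (s k) (hsc k).1 (hsc k).2]
  have h0 := hdet 0
  have : NeZero n := ⟨hn⟩
  rw [Matrix.det_zero] at h0
  simp only [add_zero, Matrix.det_smul, Matrix.det_one, mul_one, Fintype.card_fin] at h0
  simp_rw [← mul_assoc]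
  rw [← Finset.sum_mul, ← h0, zero_mul]

def dvec {n : ℕ} (θ : Eucl n → ℝ) (x : Eucl n) : Fin n → ℝ :=
  fun j => fderiv ℝ θ x (EuclideanSpace.single j 1)

lemma jac_update {n : ℕ} (u : Fin n → Eucl n → ℝ) (i : Fin n) (θ : Eucl n → ℝ) (x : Eucl n) :
    jac (Function.update u i θ) x = (jac u x).updateRow i (dvec θ x) := by
  ext a b
  by_cases h : a = i
  · subst h; simp [jac, dvec]
  · simp [jac, h]

lemma update_contDiff {n : ℕ} {u : Fin n → Eucl n → ℝ} (hu : ∀ i, ContDiff ℝ 1 (u i))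
    {θ : Eucl n → ℝ} (hθ : ContDiff ℝ 1 θ) (i j : Fin n) :
    ContDiff ℝ 1 (Function.update u i θ j) := by
  by_cases h : j = i
  · subst h; simpa using hθ
  · simpa [h] using hu j

lemma dvec_zero {n : ℕ} {θ : Eucl n → ℝ} {R : ℝ} (hs : ∀ x, R ≤ ‖x‖ → θ x = 0) {x : Eucl n}
    (hx : R < ‖x‖) : dvec θ x = 0 := by
  have : θ =ᶠ[𝓝 x] fun _ => 0 := by
    filter_upwards [(isOpen_lt continuous_const continuous_norm).mem_nhds hx] with y hy
    exact hs y (le_of_lt hy)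
  ext j; simp [dvec, this.fderiv_eq]

lemma nl_one {n : ℕ} {u : Fin n → Eucl n → ℝ} (hu : ∀ i, ContDiff ℝ 1 (u i))
    {θ : Eucl n → ℝ} (hθ : ContDiff ℝ 1 θ) {R : ℝ} (hR : 0 < R) (hs : ∀ x, R ≤ ‖x‖ → θ x = 0)
    (i : Fin n) : ∫ x, (jac (Function.update u i θ) x).det = 0 := by
  let χ : ContDiffBump (0 : Eucl n) := ⟨R + 1, R + 2, by linarith, by linarith⟩
  have hχ : ∀ j, ContDiff ℝ 1 fun x => χ x * u j x := fun j => χ.contDiff.mul (hu j)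
  have hn : n ≠ 0 := by rintro rfl; exact i.elim0
  have h0 := nl_zero hn (G := Function.update (fun j x => χ x * u j x) i θ)
    (update_contDiff hχ hθ i) (R := R + 2) (by linarith) (by
      intro j x hx
      by_cases h : j = i
      · subst h; simpa using hs x (by linarith)
      · simp only [Function.update_of_ne h]
        rw [χ.zero_of_le_dist (by simpa using hx), zero_mul])
  rw [← h0]
  have hdet0 : ∀ (v : Fin n → Eucl n → ℝ) x, R < ‖x‖ → (jac (Function.update v i θ) x).det = 0 := by
    intro v x hx
    rw [jac_update, dvec_zero hs hx]
    exact Matrix.det_eq_zero_of_row_eq_zero i (by simp)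
  rw [← setIntegral_eq_integral_of_forall_compl_eq_zero (s := Metric.ball (0 : Eucl n) (R + 2))
    (fun x hx => hdet0 _ _ (by rw [mem_ball_zero_iff, not_lt] at hx; linarith))]
  refine integral_congr_ae (ae_of_all _ fun x => ?_)
  simp only
  rcases lt_or_ge R ‖x‖ with hx | hx
  · rw [hdet0 _ _ hx, hdet0 _ _ hx]
  · rw [jac_update, jac_update]
    congr 2
    ext a b
    simp only [jac, of_apply]
    congr 1
    refine Filter.EventuallyEq.fderiv_eq ?_
    have hx' : x ∈ Metric.ball (0 : Eucl n) (R + 1) := by simp; linarith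
    filter_upwards [Metric.isOpen_ball.mem_nhds hx'] with y hy
    rw [χ.one_of_mem_closedBall (Metric.ball_subset_closedBall hy), one_mul]

lemma nl_integrable {n : ℕ} {u : Fin n → Eucl n → ℝ} (hu : ∀ i, ContDiff ℝ 1 (u i))
    {ψ : Eucl n → ℝ} (hψ : Continuous ψ) {R : ℝ} (hs : ∀ x, R ≤ ‖x‖ → ψ x = 0) :
    Integrable fun x => ψ x * (jac u x).det :=
  (hψ.mul (jac_cont hu).matrix_det).integrable_of_hasCompactSupport
    (HasCompactSupport.intro (isCompact_closedBall 0 R) fun x hx => by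
      simp only [mem_closedBall_zero_iff, not_le] at hx; rw [Pi.mul_apply, hs x hx.le, zero_mul])

lemma nl_two {n : ℕ} {u : Fin n → Eucl n → ℝ} (hu : ∀ i, ContDiff ℝ 1 (u i))
    {ψ θ : Eucl n → ℝ} (hψ : ContDiff ℝ 1 ψ) (hθ : ContDiff ℝ 1 θ) {R : ℝ} (hR : 0 < R)
    (hs : ∀ x, R ≤ ‖x‖ → ψ x = 0) (i : Fin n) :
    ∫ x, ψ x * (jac (Function.update u i θ) x).det =
      - ∫ x, θ x * (jac (Function.update u i ψ) x).det := by
  have h0 := nl_one hu (hψ.mul hθ) hR (fun x hx => by simp [hs x hx]) i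
  have hd : ∀ x, dvec (ψ * θ) x = ψ x • dvec θ x + θ x • dvec ψ x := by
    intro x
    ext j
    simp only [dvec, Pi.add_apply, Pi.smul_apply, smul_eq_mul]
    rw [fderiv_mul (hψ.differentiable one_ne_zero x) (hθ.differentiable one_ne_zero x)]
    simp
  have hI : Integrable fun x => θ x * (jac (Function.update u i ψ) x).det := by
    refine (hθ.continuous.mul (jac_cont (update_contDiff hu hψ i)).matrix_det
      ).integrable_of_hasCompactSupport
      (HasCompactSupport.intro (isCompact_closedBall 0 R) fun x hx => ?_)
    simp only [mem_closedBall_zero_iff, not_le] at hx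
    rw [Pi.mul_apply, jac_update, dvec_zero hs hx]
    rw [Matrix.det_eq_zero_of_row_eq_zero i (by simp), mul_zero]
  rw [eq_neg_iff_add_eq_zero, ← integral_add
    (nl_integrable (update_contDiff hu hθ i) hψ.continuous hs) hI, ← h0]
  refine integral_congr_ae (ae_of_all _ fun x => ?_)
  simp only [jac_update]
  rw [show dvec (fun x => ψ x * θ x) x = _ from hd x, det_updateRow_add, det_updateRow_smul,
    det_updateRow_smul]

lemma nl_est {n : ℕ} (M R : ℝ) (hR : 0 < R) {ψ : Eucl n → ℝ} (hψ : ContDiff ℝ 1 ψ)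
    (hs : ∀ x, R ≤ ‖x‖ → ψ x = 0) : ∃ C, 0 ≤ C ∧ ∀ u w : Fin n → Eucl n → ℝ,
      (∀ i, ContDiff ℝ 1 (u i)) → (∀ i, ContDiff ℝ 1 (w i)) →
      (∀ i x, ‖fderiv ℝ (u i) x‖ ≤ M) → (∀ i x, ‖fderiv ℝ (w i) x‖ ≤ M) → ∀ ε, 0 ≤ ε →
      (∀ i x, ‖x‖ ≤ R → |u i x - w i x| ≤ ε) →
      |(∫ x, ψ x * (jac u x).det) - ∫ x, ψ x * (jac w x).det| ≤ C * ε := by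
  have hψc : HasCompactSupport ψ := HasCompactSupport.intro (isCompact_closedBall 0 R) fun x hx => by
      simp only [mem_closedBall_zero_iff, not_le] at hx; exact hs x hx.le
  obtain ⟨M1, hM1⟩ := (hψc.fderiv ℝ).exists_bound_of_continuous (hψ.continuous_fderiv one_ne_zero)
  set D : ℝ := (n.factorial : ℝ) * (max M M1) ^ n with hD
  have hM0 : 0 ≤ max M M1 := le_max_of_le_right ((norm_nonneg _).trans (hM1 0))
  set V := (volume : Measure (Eucl n)).real (Metric.closedBall 0 R)
  refine ⟨n * (D * V), by positivity, fun u w hu hw hu' hw' ε hε huw => ?_⟩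
  let h : ℕ → Fin n → Eucl n → ℝ := fun k i => if (i : ℕ) < k then w i else u i
  have hh : ∀ k i, ContDiff ℝ 1 (h k i) := fun k i => by
    simp only [h]; split_ifs; exacts [hw i, hu i]
  have hh' : ∀ k i x, ‖fderiv ℝ (h k i) x‖ ≤ M := fun k i x => by
    simp only [h]; split_ifs; exacts [hw' i x, hu' i x]
  let I : ℕ → ℝ := fun k => ∫ x, ψ x * (jac (h k) x).det
  have hI0 : I 0 = ∫ x, ψ x * (jac u x).det := by simp [I, h]
  have hIn : I n = ∫ x, ψ x * (jac w x).det := by simp [I, h]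
  rw [← hI0, ← hIn, ← Finset.sum_range_sub']
  have hstep : ∀ k ∈ Finset.range n, |I k - I (k + 1)| ≤ D * V * ε := by
    intro k hk
    rw [Finset.mem_range] at hk
    let i : Fin n := ⟨k, hk⟩
    have e1 : h k = Function.update (h k) i (u i) := by
      rw [eq_comm, Function.update_eq_self_iff]; simp [h, i]
    have e2 : h (k + 1) = Function.update (h k) i (w i) := by
      ext1 j
      by_cases hj : j = i
      · subst hj; simp [h, i]
      · rw [Function.update_of_ne hj]
        have : (j : ℕ) ≠ k := fun hc => hj (Fin.ext hc)
        simp only [h]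
        congr 1
        simp only [eq_iff_iff]; omega
    have hθ : ContDiff ℝ 1 fun x => u i x - w i x := (hu i).sub (hw i)
    have e3 : I k - I (k + 1) =
        ∫ x, ψ x * (jac (Function.update (h k) i fun x => u i x - w i x) x).det := by
      simp only [I]
      rw [← integral_sub (nl_integrable (hh k) hψ.continuous hs)
        (nl_integrable (hh (k + 1)) hψ.continuous hs)]
      refine integral_congr_ae (ae_of_all _ fun x => ?_)
      simp only
      rw [← mul_sub, e2]
      conv_lhs => rw [e1]
      rw [Function.update_idem, jac_update, jac_update, jac_update]
      have : dvec (u i) x = dvec (fun x => u i x - w i x) x + dvec (w i) x := by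
        ext j
        simp only [dvec, Pi.add_apply]
        rw [fderiv_fun_sub ((hu i).differentiable one_ne_zero x) ((hw i).differentiable one_ne_zero x)]
        simp
      rw [this, det_updateRow_add, add_sub_cancel_right]
    rw [e3, nl_two (hh k) hψ hθ hR hs i, abs_neg]
    rw [← setIntegral_eq_integral_of_forall_compl_eq_zero (s := Metric.closedBall (0 : Eucl n) R)
      (fun x hx => by
        rw [mem_closedBall_zero_iff, not_le] at hx
        rw [jac_update, dvec_zero hs hx, Matrix.det_eq_zero_of_row_eq_zero i (by simp), mul_zero])]
    have := norm_setIntegral_le_of_norm_le_const (μ := (volume : Measure (Eucl n)))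
      (s := Metric.closedBall (0 : Eucl n) R)
      (f := fun x => (u i x - w i x) * (jac (Function.update (h k) i ψ) x).det) (C := ε * D)
      measure_closedBall_lt_top (fun x hx => by
        rw [norm_mul]
        refine mul_le_mul (huw i x (by simpa using hx)) ?_ (norm_nonneg _) hε
        have hle := Matrix.det_le (A := jac (Function.update (h k) i ψ) x) (abv := AbsoluteValue.abs)
          (x := max M M1) (fun a b => by
            simp only [AbsoluteValue.abs_apply, jac, of_apply]
            have hb : ∀ L : Eucl n →L[ℝ] ℝ, |L (EuclideanSpace.single b 1)| ≤ ‖L‖ := fun L => by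
              simpa using L.le_opNorm (EuclideanSpace.single b 1)
            refine (hb _).trans ?_
            by_cases ha : a = i
            · subst ha; simpa using le_max_of_le_right (hM1 x)
            · rw [Function.update_of_ne ha]; exact (hh' k a x).trans (le_max_left _ _))
        simpa [hD] using hle)
    rw [Real.norm_eq_abs] at this
    exact this.trans (le_of_eq (by ring))
  calc _ ≤ ∑ k ∈ Finset.range n, |I k - I (k + 1)| := Finset.abs_sum_le_sum_abs _ _
    _ ≤ ∑ k ∈ Finset.range n, D * V * ε := Finset.sum_le_sum hstep
    _ = _ := by simp; ring

def gradE {n : ℕ} (f : Eucl n → ℝ) (x : Eucl n) : Eucl n := WithLp.toLp 2 (gradVec f x)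

lemma gradE_inner {n : ℕ} (f : Eucl n → ℝ) (x v : Eucl n) :
    inner ℝ (gradE f x) v = fderiv ℝ f x v := by
  have h : v = ∑ i, v i • EuclideanSpace.single i (1 : ℝ) := by
    conv_lhs => rw [← (EuclideanSpace.basisFun (Fin n) ℝ).sum_repr v]
    simp
  conv_rhs => rw [h, map_sum]
  simp [PiLp.inner_apply, gradE, gradVec]

lemma contDiff_gradc {n : ℕ} {f : Eucl n → ℝ} (hf : ContDiff ℝ 2 f) (i : Fin n) :
    ContDiff ℝ 1 fun y => fderiv ℝ f y (EuclideanSpace.single i 1) :=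
  (hf.fderiv_right (m := 1) (by norm_num)).clm_apply contDiff_const

lemma contDiff_gradE {n : ℕ} {f : Eucl n → ℝ} (hf : ContDiff ℝ 2 f) : ContDiff ℝ 1 (gradE f) :=
  contDiff_euclidean.2 (contDiff_gradc hf)

def Ym {n : ℕ} (f : Eucl n → ℝ) (x : Eucl n) : Eucl n := x + gradE f x

lemma gradE_ineq {n : ℕ} {f : ConvFn n} (hf : f ∈ c2 n) (x y : Eucl n) :
    f.1 x + inner ℝ (gradE f.1 x) (y - x) ≤ f.1 y := by
  rw [gradE_inner]
  have hf' : ContDiff ℝ 2 ⇑f.1 := hf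
  exact grad_ineq f.2 (hf'.differentiable two_ne_zero x).hasFDerivAt y

lemma gradE_mono {n : ℕ} {f : ConvFn n} (hf : f ∈ c2 n) (x y : Eucl n) :
    0 ≤ inner ℝ (gradE f.1 x - gradE f.1 y) (x - y) := by
  have h1 := gradE_ineq hf x y
  have h2 := gradE_ineq hf y x
  rw [← neg_sub x y, inner_neg_right] at h1
  rw [inner_sub_left]; linarith

lemma Ym_anti {n : ℕ} {f : ConvFn n} (hf : f ∈ c2 n) (x y : Eucl n) :
    ‖x - y‖ ≤ ‖Ym f.1 x - Ym f.1 y‖ := by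
  have h1 := gradE_mono hf x y
  have h2 : inner ℝ (Ym f.1 x - Ym f.1 y) (x - y) =
      ‖x - y‖ ^ 2 + inner ℝ (gradE f.1 x - gradE f.1 y) (x - y) := by
    rw [← real_inner_self_eq_norm_sq, ← inner_add_left]; congr 1; simp only [Ym]; abel
  have h3 := real_inner_le_norm (Ym f.1 x - Ym f.1 y) (x - y)
  by_contra hcon
  push Not at hcon
  have : 0 < ‖x - y‖ := (norm_nonneg _).trans_lt hcon
  nlinarith

lemma gradE_deriv_nonneg {n : ℕ} {f : ConvFn n} (hf : f ∈ c2 n) (x v : Eucl n) :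
    0 ≤ inner ℝ (fderiv ℝ (gradE f.1) x v) v := by
  have h1 := (((contDiff_gradE hf).differentiable one_ne_zero x).hasFDerivAt).hasLineDerivAt v
  rw [hasLineDerivAt_iff_tendsto_slope_zero] at h1
  have h2 := h1.mono_left (nhdsWithin_mono 0 (fun t (ht : 0 < t) => ht.ne') : 𝓝[>] (0 : ℝ) ≤ _)
  refine ge_of_tendsto (h2.inner (tendsto_const_nhds (x := v))) ?_
  filter_upwards [self_mem_nhdsWithin] with t ht
  have h3 := gradE_mono hf (x + t • v) x
  rw [add_sub_cancel_left, real_inner_smul_right] at h3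
  rw [real_inner_smul_left]
  have ht' : (0:ℝ) < t := ht
  exact mul_nonneg (inv_nonneg.2 ht'.le) (nonneg_of_mul_nonneg_right h3 ht')

lemma Ym_contDiff {n : ℕ} {f : ConvFn n} (hf : f ∈ c2 n) : ContDiff ℝ 1 (Ym f.1) :=
  contDiff_id.add (contDiff_gradE hf)

lemma Ym_det {n : ℕ} {f : ConvFn n} (hf : f ∈ c2 n) (x : Eucl n) :
    0 < (fderiv ℝ (Ym f.1) x).det := by
  refine det_pos_of_inner _ fun v hv => ?_
  have : fderiv ℝ (Ym f.1) x v = v + fderiv ℝ (gradE f.1) x v := by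
    have := ((hasFDerivAt_id x).add
      ((contDiff_gradE hf).differentiable one_ne_zero x).hasFDerivAt).fderiv
    exact congrArg (fun A : Eucl n →L[ℝ] Eucl n => A v) this
  rw [this, inner_add_left]
  have h3 : 0 < inner ℝ v v := real_inner_self_pos.2 hv
  linarith [gradE_deriv_nonneg hf x v]

lemma Ym_surj {n : ℕ} {f : ConvFn n} (hf : f ∈ c2 n) : Function.Surjective (Ym f.1) := by
  intro y
  have hf' : ContDiff ℝ 2 ⇑f.1 := hf
  have hfd := hf'.differentiable two_ne_zero
  let h : Eucl n → ℝ := fun x => f.1 x + (‖x‖ ^ 2 / 2 - inner ℝ y x)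
  have hc : Continuous h := by
    have := f.1.continuous
    fun_prop
  obtain ⟨x, hx⟩ := hc.exists_forall_le' 0 (by
    filter_upwards [(isCompact_closedBall (0 : Eucl n) (2 * ‖gradE f.1 0 - y‖)).compl_mem_cocompact]
      with x hx
    simp only [Set.mem_compl_iff, mem_closedBall_zero_iff, not_le] at hx
    have h1 := gradE_ineq hf 0 x
    have h2 := (abs_le.1 (abs_real_inner_le_norm (gradE f.1 0 - y) x)).1
    rw [inner_sub_left] at h2
    simp only [sub_zero] at h1
    simp only [h, norm_zero, inner_zero_right]
    have : 0 ≤ ‖x‖ := norm_nonneg x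
    nlinarith [norm_nonneg (gradE f.1 0 - y)])
  refine ⟨x, ?_⟩
  have hmin : IsLocalMin h x := Eventually.of_forall hx
  have hder : HasFDerivAt h (fderiv ℝ f.1 x + ((2⁻¹ : ℝ) • (2 • (innerSL ℝ) x) - innerSL ℝ y)) x := by
    refine (hfd x).hasFDerivAt.add (HasFDerivAt.sub ?_ (innerSL ℝ y).hasFDerivAt)
    have := (hasStrictFDerivAt_norm_sq x).hasFDerivAt.const_mul (2⁻¹ : ℝ)
    simp only [div_eq_inv_mul]
    exact this
  have h0 := hmin.hasFDerivAt_eq_zero hder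
  refine ext_inner_right ℝ fun v => ?_
  have h1 := congrArg (fun A : Eucl n →L[ℝ] ℝ => A v) h0
  simp at h1
  rw [Ym, inner_add_left, gradE_inner]
  linarith

lemma exists_X {n : ℕ} {f : ConvFn n} (hf : f ∈ c2 n) : ∃ X : Eucl n → Eucl n,
    (∀ x, X (Ym f.1 x) = x) ∧ (∀ y, Ym f.1 (X y) = y) ∧ ContDiff ℝ 1 X ∧ LipschitzWith 1 X := by
  have hinj : Function.Injective (Ym f.1) := fun x y h => by
    have := Ym_anti hf x y
    rw [h, sub_self, norm_zero] at this
    exact sub_eq_zero.1 (norm_eq_zero.1 (le_antisymm this (norm_nonneg _)))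
  let e := Equiv.ofBijective _ ⟨hinj, Ym_surj hf⟩
  have hl : LipschitzWith 1 e.symm := LipschitzWith.of_dist_le_mul fun a b => by
    have := Ym_anti hf (e.symm a) (e.symm b)
    rw [show Ym f.1 (e.symm a) = a from e.apply_symm_apply a,
      show Ym f.1 (e.symm b) = b from e.apply_symm_apply b] at this
    simpa [dist_eq_norm] using this
  let H : Eucl n ≃ₜ Eucl n := ⟨e, (Ym_contDiff hf).continuous, hl.continuous⟩
  refine ⟨e.symm, e.symm_apply_apply, e.apply_symm_apply, ?_, hl⟩
  refine H.contDiff_symm (f₀' := fun x =>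
    (fderiv ℝ (Ym f.1) x).toContinuousLinearEquivOfDetNeZero (Ym_det hf x).ne') (fun x => ?_)
    (Ym_contDiff hf)
  exact ((Ym_contDiff hf).differentiable one_ne_zero x).hasFDerivAt

open Classical in
def Xm {n : ℕ} (f : ConvFn n) : Eucl n → Eucl n := if hf : f ∈ c2 n then (exists_X hf).choose else 0

lemma Xm_spec {n : ℕ} {f : ConvFn n} (hf : f ∈ c2 n) :
    (∀ x, Xm f (Ym f.1 x) = x) ∧ (∀ y, Ym f.1 (Xm f y) = y) ∧ ContDiff ℝ 1 (Xm f) ∧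
      LipschitzWith 1 (Xm f) := by
  rw [Xm, dif_pos hf]; exact (exists_X hf).choose_spec

lemma Xm_grad {n : ℕ} {f : ConvFn n} (hf : f ∈ c2 n) (y : Eucl n) :
    gradE f.1 (Xm f y) = y - Xm f y := by
  have := (Xm_spec hf).2.1 y
  rw [Ym] at this
  rw [eq_sub_iff_add_eq, add_comm, this]

lemma Xm_close {n : ℕ} {f g : ConvFn n} (hf : f ∈ c2 n) (hg : g ∈ c2 n) (y : Eucl n) :
    ‖Xm f y - Xm g y‖ ^ 2 ≤ (f.1 (Xm g y) - g.1 (Xm g y)) - (f.1 (Xm f y) - g.1 (Xm f y)) := by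
  have h1 := gradE_ineq hf (Xm f y) (Xm g y)
  have h2 := gradE_ineq hg (Xm g y) (Xm f y)
  rw [Xm_grad hf] at h1
  rw [Xm_grad hg] at h2
  set a := Xm f y
  set b := Xm g y
  have h3 : inner ℝ (y - a) (b - a) + inner ℝ (y - b) (a - b) = ‖a - b‖ ^ 2 := by
    rw [← real_inner_self_eq_norm_sq, ← neg_sub a b, inner_neg_right, ← sub_eq_neg_add, ← inner_sub_left]
    congr 1; abel
  linarith

lemma minor_det {n k : ℕ} (A : Matrix (Fin n) (Fin n) ℝ) (σ τ : Fin k ↪ Fin n) (w : Fin n → Fin n)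
    (hw : ∀ b, w (τ b) = σ b) (p : Fin n → Prop) [DecidablePred p] (hp : ∀ i, p i ↔ ∃ b, τ b = i) :
    (Matrix.of fun i j => if p i then A (w i) j else (1 : Matrix (Fin n) (Fin n) ℝ) i j).det =
      (A.submatrix σ τ).det := by
  rw [Matrix.twoBlockTriangular_det _ p]
  · have h2 : (Matrix.toSquareBlockProp (Matrix.of fun i j => if p i then A (w i) j else
        (1 : Matrix (Fin n) (Fin n) ℝ) i j) fun i => ¬ p i) = 1 := by
      ext i j
      simp [Matrix.toSquareBlockProp, i.2, Matrix.one_apply, Subtype.ext_iff]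
    rw [h2, Matrix.det_one, mul_one]
    let e : Fin k ≃ {i // p i} := Equiv.ofBijective (fun b => ⟨τ b, (hp _).2 ⟨b, rfl⟩⟩)
      ⟨fun a b h => τ.injective (by simpa using h), fun ⟨i, hi⟩ => by
        obtain ⟨b, hb⟩ := (hp i).1 hi
        exact ⟨b, by simp [hb]⟩⟩
    rw [← Matrix.det_submatrix_equiv_self e]
    congr 1
    ext a b
    have : p (τ a) := (hp _).2 ⟨a, rfl⟩
    show (if p (τ a) then A (w (τ a)) (τ b) else _) = A (σ a) (τ b)
    rw [if_pos this, hw]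
  · intro i hi j hj
    simp only [of_apply, hi, if_false]
    exact Matrix.one_apply_ne (fun h => hi (h ▸ hj))

lemma hess_symm {n : ℕ} {f : Eucl n → ℝ} (hf : ContDiff ℝ 2 f) (x : Eucl n) :
    (hessMat f x)ᵀ = hessMat f x := by
  have hd : DifferentiableAt ℝ (fderiv ℝ f) x :=
    (hf.fderiv_right (m := 1) (by norm_num)).differentiable one_ne_zero x
  have h : ∀ i j, hessMat f x i j =
      fderiv ℝ (fderiv ℝ f) x (EuclideanSpace.single i 1) (EuclideanSpace.single j 1) := by
    intro i j
    rw [hessMat, of_apply, fderiv_clm_apply hd (differentiableAt_const _)]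
    simp
  have hs : IsSymmSndFDerivAt ℝ f x := hf.contDiffAt.isSymmSndFDerivAt (by simp)
  ext i j
  rw [transpose_apply, h, h]
  exact hs _ _

lemma symHess_eq {n : ℕ} {f : Eucl n → ℝ} (hf : ContDiff ℝ 2 f) (x : Eucl n) :
    (symHess f x).1 = hessMat f x := by
  simp only [symHess, hess_symm hf]
  rw [← two_smul ℝ (hessMat f x), smul_smul]; norm_num

open Classical in
def wmap {n k : ℕ} (σ τ : Fin k ↪ Fin n) (i : Fin n) : Fin n :=
  if h : ∃ b, τ b = i then σ h.choose else i

lemma wmap_tau {n k : ℕ} (σ τ : Fin k ↪ Fin n) (b : Fin k) : wmap σ τ (τ b) = σ b := by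
  have h : ∃ c, τ c = τ b := ⟨b, rfl⟩
  rw [wmap, dif_pos h, τ.injective h.choose_spec]

open Classical in
def uu {n k : ℕ} (σ τ : Fin k ↪ Fin n) (f : ConvFn n) (i : Fin n) (y : Eucl n) : ℝ :=
  if ∃ b, τ b = i then (y - Xm f y) (wmap σ τ i) else Xm f y i

section
variable {n k : ℕ} (σ τ : Fin k ↪ Fin n) {f : ConvFn n}

lemma uu_contDiff (hf : f ∈ c2 n) (i : Fin n) : ContDiff ℝ 1 (uu σ τ f i) := by
  have hX := (Xm_spec hf).2.2.1
  unfold uu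
  split_ifs
  · exact contDiff_euclidean.1 (contDiff_id.sub hX) _
  · exact contDiff_euclidean.1 hX _

lemma coord_le {n : ℕ} (v : Eucl n) (i : Fin n) : |v i| ≤ ‖v‖ := by
  simpa using PiLp.norm_apply_le v i

lemma uu_fderiv (hf : f ∈ c2 n) (i : Fin n) (y : Eucl n) : ‖fderiv ℝ (uu σ τ f i) y‖ ≤ 2 := by
  have hl := (Xm_spec hf).2.2.2
  refine norm_fderiv_le_of_lipschitz ℝ (C := 2) (LipschitzWith.of_dist_le_mul fun a b => ?_)
  have h1 : ‖Xm f a - Xm f b‖ ≤ ‖a - b‖ := by simpa [dist_eq_norm] using hl.dist_le_mul a b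
  rw [Real.dist_eq, dist_eq_norm]
  simp only [NNReal.coe_ofNat]
  unfold uu
  have h0 := norm_nonneg (a - b)
  split_ifs
  · rw [← PiLp.sub_apply]
    refine (coord_le _ _).trans ?_
    rw [show a - Xm f a - (b - Xm f b) = (a - b) - (Xm f a - Xm f b) by abel]
    linarith [norm_sub_le (a - b) (Xm f a - Xm f b)]
  · rw [← PiLp.sub_apply]
    linarith [coord_le (Xm f a - Xm f b) i]

lemma uu_close (f g : ConvFn n) (i : Fin n) (y : Eucl n) :
    |uu σ τ f i y - uu σ τ g i y| ≤ ‖Xm f y - Xm g y‖ := by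
  unfold uu
  split_ifs
  · rw [← PiLp.sub_apply, ← norm_neg]
    refine (coord_le _ _).trans (le_of_eq ?_)
    congr 1; abel
  · rw [← PiLp.sub_apply]; exact coord_le _ _

lemma uu_jac (hf : f ∈ c2 n) (x : Eucl n) :
    (jac (uu σ τ f) (Ym f.1 x)).det * (fderiv ℝ (Ym f.1) x).det =
      ((symHess f.1 x).1.submatrix σ τ).det := by
  classical
  have hf' : ContDiff ℝ 2 ⇑f.1 := hf
  have hY := (Ym_contDiff hf).differentiable one_ne_zero x
  rw [det_clm, ← det_mul, symHess_eq hf', ← hess_symm hf',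
    ← minor_det _ σ τ (wmap σ τ) (wmap_tau σ τ) (fun i => ∃ b, τ b = i) (fun i => Iff.rfl)]
  congr 1
  ext i j
  have h1 : (jac (uu σ τ f) (Ym f.1 x) * of fun i j =>
      (fderiv ℝ (Ym f.1) x (EuclideanSpace.single j 1)) i) i j =
      fderiv ℝ (fun x => uu σ τ f i (Ym f.1 x)) x (EuclideanSpace.single j 1) := by
    have hu := (uu_contDiff σ τ hf i).differentiable one_ne_zero (Ym f.1 x)
    have h2 := (hu.hasFDerivAt.comp x hY.hasFDerivAt).fderiv
    rw [show (fun x => uu σ τ f i (Ym f.1 x)) = uu σ τ f i ∘ Ym f.1 from rfl, h2, mul_apply]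
    simp only [ContinuousLinearMap.comp_apply, jac, of_apply]
    set v := fderiv ℝ (Ym f.1) x (EuclideanSpace.single j 1)
    have h : v = ∑ i, v i • EuclideanSpace.single i (1 : ℝ) := by
      conv_lhs => rw [← (EuclideanSpace.basisFun (Fin n) ℝ).sum_repr v]
      simp
    conv_rhs => rw [h, map_sum]
    simp [mul_comm]
  rw [h1, of_apply]
  have h2 : (fun x => uu σ τ f i (Ym f.1 x)) = fun x => if ∃ b, τ b = i then
      fderiv ℝ f.1 x (EuclideanSpace.single (wmap σ τ i) 1) else x i := by
    funext x
    unfold uu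
    rw [(Xm_spec hf).1]
    simp [Ym, gradE, gradVec]
  rw [h2]
  split_ifs with hp
  · rfl
  · rw [show (fun x : Eucl n => x i) = (EuclideanSpace.proj i : Eucl n →L[ℝ] ℝ) from rfl,
      ContinuousLinearMap.fderiv]
    simp [Matrix.one_apply]

lemma chvar (hf : f ∈ c2 n) (F : Eucl n → ℂ) :
    ∫ x, F x * (((symHess f.1 x).1.submatrix σ τ).det : ℂ) =
      ∫ y, F (Xm f y) * ((jac (uu σ τ f) y).det : ℂ) := by
  have h := integral_image_eq_integral_abs_det_fderiv_smul (volume : Measure (Eucl n))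
    (s := Set.univ) (f := Ym f.1) (f' := fun x => fderiv ℝ (Ym f.1) x) MeasurableSet.univ
    (fun x _ => (((Ym_contDiff hf).differentiable one_ne_zero x).hasFDerivAt).hasFDerivWithinAt)
    (Function.LeftInverse.injective (Xm_spec hf).1).injOn
    (fun y => F (Xm f y) * ((jac (uu σ τ f) y).det : ℂ))
  rw [Set.image_univ, (Ym_surj hf).range_eq] at h
  simp only [setIntegral_univ] at h
  rw [h]
  refine integral_congr_ae (ae_of_all _ fun x => ?_)
  simp only
  rw [← uu_jac σ τ hf x, (Xm_spec hf).1, abs_of_pos (Ym_det hf x), Complex.real_smul]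
  push_cast; ring
end

lemma supp_closedBall {n : ℕ} {E : Type*} [Zero E] {g : Eucl n → E} {R : ℝ}
    (h : ∀ x, R < ‖x‖ → g x = 0) : HasCompactSupport g :=
  HasCompactSupport.intro (isCompact_closedBall 0 R) fun x hx => by
    simp only [mem_closedBall_zero_iff, not_le] at hx; exact h x hx

lemma int_bound {n : ℕ} {g : Eucl n → ℂ} {R c : ℝ} (h : ∀ x, R < ‖x‖ → g x = 0)
    (hc : ∀ x, ‖x‖ ≤ R → ‖g x‖ ≤ c) :
    ‖∫ x, g x‖ ≤ c * (volume : Measure (Eucl n)).real (Metric.closedBall 0 R) := by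
  rw [← setIntegral_eq_integral_of_forall_compl_eq_zero (s := Metric.closedBall 0 R) fun x hx => by
    simp only [mem_closedBall_zero_iff, not_le] at hx; exact h x hx]
  exact norm_setIntegral_le_of_norm_le_const measure_closedBall_lt_top
    fun x hx => hc x (by simpa using hx)

lemma nl_estC {n : ℕ} (M R : ℝ) (hR : 0 < R) {ψ : Eucl n → ℂ} (hψ : ContDiff ℝ 1 ψ)
    (hs : ∀ x, R ≤ ‖x‖ → ψ x = 0) : ∃ C, 0 ≤ C ∧ ∀ u w : Fin n → Eucl n → ℝ,
      (∀ i, ContDiff ℝ 1 (u i)) → (∀ i, ContDiff ℝ 1 (w i)) →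
      (∀ i x, ‖fderiv ℝ (u i) x‖ ≤ M) → (∀ i x, ‖fderiv ℝ (w i) x‖ ≤ M) → ∀ ε, 0 ≤ ε →
      (∀ i x, ‖x‖ ≤ R → |u i x - w i x| ≤ ε) →
      ‖(∫ x, ψ x * ((jac u x).det : ℂ)) - ∫ x, ψ x * ((jac w x).det : ℂ)‖ ≤ C * ε := by
  have hre : ContDiff ℝ 1 fun x => (ψ x).re := Complex.reCLM.contDiff.comp hψ
  have him : ContDiff ℝ 1 fun x => (ψ x).im := Complex.imCLM.contDiff.comp hψ
  have hcr : HasCompactSupport fun x => (ψ x).re := supp_closedBall (R := R) fun x hx => by simp [hs x hx.le]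
  have hci : HasCompactSupport fun x => (ψ x).im := supp_closedBall (R := R) fun x hx => by simp [hs x hx.le]
  obtain ⟨C1, h1, hC1⟩ := nl_est M R hR hre fun x hx => by simp [hs x hx]
  obtain ⟨C2, h2, hC2⟩ := nl_est M R hR him fun x hx => by simp [hs x hx]
  have key : ∀ u : Fin n → Eucl n → ℝ, (∀ i, ContDiff ℝ 1 (u i)) →
      (∫ x, ψ x * ((jac u x).det : ℂ)) = ((∫ x, (ψ x).re * (jac u x).det : ℝ) : ℂ)
        + ((∫ x, (ψ x).im * (jac u x).det : ℝ) : ℂ) * Complex.I := by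
    intro u hu
    have hd := (jac_cont hu).matrix_det
    have i1 : Integrable fun x => (ψ x).re * (jac u x).det :=
      (hre.continuous.mul hd).integrable_of_hasCompactSupport hcr.mul_right
    have i2 : Integrable fun x => (ψ x).im * (jac u x).det :=
      (him.continuous.mul hd).integrable_of_hasCompactSupport hci.mul_right
    have j1 : Integrable fun x => (((ψ x).re * (jac u x).det : ℝ) : ℂ) := i1.ofReal
    have j2 : Integrable fun x => (((ψ x).im * (jac u x).det : ℝ) : ℂ) := i2.ofReal
    rw [← integral_complex_ofReal, ← integral_complex_ofReal, ← integral_mul_const,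
      ← integral_add j1 (j2.mul_const _)]
    refine integral_congr_ae (ae_of_all _ fun x => ?_)
    simp only
    conv_lhs => rw [← Complex.re_add_im (ψ x)]
    push_cast
    ring
  refine ⟨C1 + C2, by positivity, fun u w hu hw hu' hw' ε hε huw => ?_⟩
  have e1 := hC1 u w hu hw hu' hw' ε hε huw
  have e2 := hC2 u w hu hw hu' hw' ε hε huw
  rw [key u hu, key w hw]
  rw [show ∀ a b c d : ℂ, a + b * Complex.I - (c + d * Complex.I) = (a - c) + (b - d) * Complex.I by
    intros; ring, ← Complex.ofReal_sub, ← Complex.ofReal_sub]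
  refine (norm_add_le _ _).trans ?_
  rw [norm_mul, Complex.norm_I, mul_one, Complex.norm_real, Complex.norm_real]
  simp only [Real.norm_eq_abs]
  linarith

lemma local_bound {n : ℕ} (f0 : ConvFn n) (R : ℝ) : ∃ L, 0 ≤ L ∧ ∀ᶠ f in 𝓝 f0,
    f ∈ c2 n → ∀ x, ‖x‖ ≤ R → |f.1 x| ≤ L ∧ ‖gradE f.1 x‖ ≤ L := by
  obtain ⟨L0, hL0⟩ := (isCompact_closedBall (0 : Eucl n) (R + 1)).exists_bound_of_continuousOn
    f0.1.continuous.continuousOn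
  refine ⟨2 * (max L0 0 + 1), by positivity, ?_⟩
  filter_upwards [nhds_conv f0 (R + 1) one_pos] with f hf hc x hx
  have hb : ∀ y : Eucl n, ‖y‖ ≤ R + 1 → |f.1 y| ≤ max L0 0 + 1 := fun y hy => by
    have h1 := hf y hy
    have h2 := hL0 y (by simpa using hy)
    rw [Real.norm_eq_abs] at h2
    have h3 := abs_sub_abs_le_abs_sub (f.1 y) (f0.1 y)
    linarith [le_max_left L0 0]
  have hx1 := hb x (by linarith)
  refine ⟨by linarith [le_max_right L0 0], ?_⟩
  rcases eq_or_ne (gradE f.1 x) 0 with h0 | h0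
  · rw [h0, norm_zero]; positivity
  have hp := norm_pos_iff.2 h0
  have h1 := gradE_ineq hc x (x + (‖gradE f.1 x‖⁻¹) • gradE f.1 x)
  rw [add_sub_cancel_left, real_inner_smul_right, real_inner_self_eq_norm_sq] at h1
  have h2 := hb (x + (‖gradE f.1 x‖⁻¹) • gradE f.1 x) ((norm_add_le _ _).trans (by
    rw [norm_smul, norm_inv, norm_norm, inv_mul_cancel₀ hp.ne']; linarith))
  have h3 : ‖gradE f.1 x‖⁻¹ * ‖gradE f.1 x‖ ^ 2 = ‖gradE f.1 x‖ := by field_simp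
  rw [h3] at h1
  have := (abs_le.1 hx1).1
  have := (abs_le.1 h2).2
  linarith

lemma Xm_norm {n : ℕ} {f : ConvFn n} (hf : f ∈ c2 n) (y : Eucl n) :
    ‖Xm f y‖ ≤ ‖y‖ + ‖gradE f.1 0‖ := by
  have h := (Xm_spec hf).2.2.2.dist_le_mul y (Ym f.1 0)
  rw [(Xm_spec hf).1, dist_zero_right, dist_eq_norm] at h
  simp only [Ym, zero_add, NNReal.coe_one, one_mul] at h
  exact h.trans (norm_sub_le _ _)

/-- the transformed integrand -/
def psi {n : ℕ} (Q : MvPolynomial (Fin (n + 1)) ℂ) (φ : C_c(Eucl n, ℂ)) (f : ConvFn n)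
    (y : Eucl n) : ℂ := φ (Xm f y) * ev (f.1 (Xm f y), y - Xm f y) Q

lemma psi_cont {n : ℕ} (Q : MvPolynomial (Fin (n + 1)) ℂ) (φ : C_c(Eucl n, ℂ)) {f : ConvFn n}
    (hf : f ∈ c2 n) : Continuous (psi Q φ f) := by
  have hX := (Xm_spec hf).2.2.1.continuous
  exact (φ.continuous.comp hX).mul ((ev_continuous Q).comp
    ((f.1.continuous.comp hX).prodMk (continuous_id.sub hX)))

lemma psi_zero {n : ℕ} {Q : MvPolynomial (Fin (n + 1)) ℂ} {φ : C_c(Eucl n, ℂ)} {R L : ℝ}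
    (hφ : ∀ x, φ x ≠ 0 → ‖x‖ ≤ R) {f : ConvFn n} (hf : f ∈ c2 n)
    (hL : ∀ x, ‖x‖ ≤ R → ‖gradE f.1 x‖ ≤ L) {y : Eucl n} (hy : R + L < ‖y‖) : psi Q φ f y = 0 := by
  rw [psi]
  by_cases h : φ (Xm f y) = 0
  · rw [h, zero_mul]
  exfalso
  have h1 := hφ _ h
  have h2 := hL _ h1
  have h3 := (Xm_spec hf).2.1 y
  rw [Ym] at h3
  have := norm_add_le (Xm f y) (gradE f.1 (Xm f y))
  rw [h3] at this
  linarith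

lemma jac_det_le {n k : ℕ} (σ τ : Fin k ↪ Fin n) {f : ConvFn n} (hf : f ∈ c2 n) (y : Eucl n) :
    ‖((jac (uu σ τ f) y).det : ℂ)‖ ≤ (n.factorial : ℝ) * 2 ^ n := by
  rw [Complex.norm_real, Real.norm_eq_abs]
  have hle := Matrix.det_le (A := jac (uu σ τ f) y) (abv := AbsoluteValue.abs)
    (x := (2 : ℝ)) (fun a b => by
      simp only [AbsoluteValue.abs_apply, jac, of_apply]
      have := (fderiv ℝ (uu σ τ f a) y).le_opNorm (EuclideanSpace.single b 1)
      exact this.trans (by simpa using uu_fderiv σ τ hf a y))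
  simpa using hle

def TT {n k : ℕ} (Q : MvPolynomial (Fin (n + 1)) ℂ) (σ τ : Fin k ↪ Fin n) (f : ConvFn n)
    (φ : C_c(Eucl n, ℂ)) : ℂ :=
  ∫ x, φ x * (MvPolynomial.eval (Fin.cons (f.1 x : ℂ) fun i => (gradVec f.1 x i : ℂ)) Q
          * ((((symHess f.1 x).1.submatrix σ τ).det : ℝ) : ℂ))

lemma TT_eq {n k : ℕ} (Q : MvPolynomial (Fin (n + 1)) ℂ) (σ τ : Fin k ↪ Fin n) {f : ConvFn n}
    (hf : f ∈ c2 n) (φ : C_c(Eucl n, ℂ)) :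
    TT Q σ τ f φ = ∫ y, psi Q φ f y * ((jac (uu σ τ f) y).det : ℂ) := by
  have := chvar σ τ hf fun x => φ x * ev (f.1 x, gradE f.1 x) Q
  simp only [Xm_grad hf] at this
  simp only [TT, ← mul_assoc]
  exact this

lemma TT_mass {n k : ℕ} (Q : MvPolynomial (Fin (n + 1)) ℂ) (σ τ : Fin k ↪ Fin n) (f0 : ConvFn n)
    (R : ℝ) : ∃ C, ∀ᶠ f in 𝓝 f0, f ∈ c2 n → ∀ φ : C_c(Eucl n, ℂ), (∀ x, φ x ≠ 0 → ‖x‖ ≤ R) →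
      (∀ x, ‖φ x‖ ≤ 1) → ‖TT Q σ τ f φ‖ ≤ C := by
  obtain ⟨L, hL0, hL⟩ := local_bound f0 R
  obtain ⟨B, hB⟩ := (isCompact_closedBall (0 : ℝ × Eucl n) L).exists_bound_of_continuousOn
    (ev_continuous Q).continuousOn
  refine ⟨(max B 0 * ((n.factorial : ℝ) * 2 ^ n)) *
    (volume : Measure (Eucl n)).real (Metric.closedBall 0 (R + L)), ?_⟩
  filter_upwards [hL] with f hf hc φ hφ hφ1
  rw [TT_eq Q σ τ hc]
  refine int_bound (fun y hy => ?_) fun y hy => ?_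
  · rw [psi_zero hφ hc (fun x hx => (hf hc x hx).2) hy, zero_mul]
  · rw [norm_mul]
    refine mul_le_mul ?_ (jac_det_le σ τ hc y) (norm_nonneg _) (le_max_right _ _)
    rw [psi]
    by_cases h : φ (Xm f y) = 0
    · rw [h, zero_mul, norm_zero]; exact le_max_right _ _
    have h1 := hf hc _ (hφ _ h)
    rw [norm_mul, ← Xm_grad hc]
    have h2 := hB (f.1 (Xm f y), gradE f.1 (Xm f y)) (by
      rw [mem_closedBall_zero_iff, Prod.norm_def]; exact max_le h1.1 h1.2)
    calc _ ≤ 1 * max B 0 := mul_le_mul (hφ1 _) (h2.trans (le_max_left _ _)) (norm_nonneg _) zero_le_one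
      _ = _ := one_mul _

lemma cc_radius {n : ℕ} (φ : C_c(Eucl n, ℂ)) : ∃ R, 0 ≤ R ∧ ∀ x, φ x ≠ 0 → ‖x‖ ≤ R := by
  obtain ⟨R, hR⟩ := φ.hasCompactSupport'.isBounded.exists_norm_le
  exact ⟨max R 0, le_max_right _ _, fun x hx => (hR x (subset_tsupport _ hx)).trans (le_max_left _ _)⟩

lemma Xm_near {n : ℕ} (f0 : ConvFn n) (S : ℝ) {δ : ℝ} (hδ : 0 < δ) :
    ∃ N ∈ 𝓝 f0, ∀ f ∈ N, ∀ g ∈ N, f ∈ c2 n → g ∈ c2 n → ∀ y, ‖y‖ ≤ S → ‖Xm f y - Xm g y‖ ≤ δ := by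
  obtain ⟨L, hL0, hL⟩ := local_bound f0 0
  have h4 : 0 < δ ^ 2 / 4 := by positivity
  refine ⟨_, hL.and (nhds_conv f0 (S + L) h4), fun f hf g hg hfc hgc y hy => ?_⟩
  have hx : ∀ f : ConvFn n, f ∈ c2 n → (f ∈ c2 n → ∀ x, ‖x‖ ≤ 0 → |f.1 x| ≤ L ∧ ‖gradE f.1 x‖ ≤ L) →
      ‖Xm f y‖ ≤ S + L := fun f hfc h => by
    linarith [Xm_norm hfc y, (h hfc 0 (by simp)).2]
  have h1 := Xm_close hfc hgc y
  have a1 := abs_lt.1 (hf.2 _ (hx f hfc hf.1))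
  have a2 := abs_lt.1 (hf.2 _ (hx g hgc hg.1))
  have a3 := abs_lt.1 (hg.2 _ (hx f hfc hf.1))
  have a4 := abs_lt.1 (hg.2 _ (hx g hgc hg.1))
  exact le_of_sq_le_sq (by linarith) hδ.le

lemma psi_close {n : ℕ} (Q : MvPolynomial (Fin (n + 1)) ℂ) (φ : C_c(Eucl n, ℂ)) (f0 : ConvFn n) :
    ∃ S, 0 ≤ S ∧ (∀ᶠ f in 𝓝 f0, f ∈ c2 n → ∀ y, S < ‖y‖ → psi Q φ f y = 0) ∧
      ∀ η > 0, ∃ N ∈ 𝓝 f0, ∀ f ∈ N, ∀ g ∈ N, f ∈ c2 n → g ∈ c2 n →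
        ∀ y, ‖psi Q φ f y - psi Q φ g y‖ ≤ η := by
  obtain ⟨R, hR0, hR⟩ := cc_radius φ
  obtain ⟨L, hL0, hL⟩ := local_bound f0 R
  have hz : ∀ᶠ f in 𝓝 f0, f ∈ c2 n → ∀ y, R + L < ‖y‖ → psi Q φ f y = 0 := by
    filter_upwards [hL] with f hf hfc y hy
    exact psi_zero hR hfc (fun x hx => (hf hfc x hx).2) hy
  refine ⟨R + L, by positivity, hz, fun η hη => ?_⟩
  let Φ : Eucl n × Eucl n × ℝ → ℂ := fun p => φ p.2.1 * ev (f0.1 p.2.1 + p.2.2, p.1 - p.2.1) Q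
  have hΦ : Continuous Φ := by
    refine (φ.continuous.comp (by fun_prop)).mul ((ev_continuous Q).comp ?_)
    have := f0.1.continuous
    fun_prop
  have hu := ((isCompact_closedBall (0 : Eucl n) (R + L)).prod
    ((isCompact_closedBall (0 : Eucl n) (R + L + L)).prod
    (isCompact_closedBall (0 : ℝ) 1))).uniformContinuousOn_of_continuous hΦ.continuousOn
  rw [Metric.uniformContinuousOn_iff] at hu
  obtain ⟨δ, hδ, hu⟩ := hu η hη
  obtain ⟨N, hN, hN'⟩ := Xm_near f0 (R + L) (half_pos hδ)
  have hδ3 : 0 < min 1 (δ / 3) := by positivity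
  refine ⟨_, inter_mem hN ((hL.and hz).and (nhds_conv f0 (R + L + L) hδ3)), ?_⟩
  rintro f ⟨hf1, ⟨hf2, hf3⟩, hf4⟩ g ⟨hg1, ⟨hg2, hg3⟩, hg4⟩ hfc hgc y
  by_cases hy : R + L < ‖y‖
  · rw [hf3 hfc y hy, hg3 hgc y hy]; simpa using hη.le
  push Not at hy
  have hx : ∀ f : ConvFn n, f ∈ c2 n → (f ∈ c2 n → ∀ x, ‖x‖ ≤ R → |f.1 x| ≤ L ∧ ‖gradE f.1 x‖ ≤ L) →
      ‖Xm f y‖ ≤ R + L + L := fun f hfc h => by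
    linarith [Xm_norm hfc y, (h hfc 0 (by simpa using hR0)).2]
  have xf := hx f hfc hf2
  have xg := hx g hgc hg2
  have tf := hf4 _ xf
  have tg := hg4 _ xg
  have := hN' f hf1 g hg1 hfc hgc y hy
  have key := hu (y, Xm f y, f.1 (Xm f y) - f0.1 (Xm f y))
    (by simp only [Set.mem_prod, mem_closedBall_zero_iff]
        exact ⟨hy, xf, (tf.trans_le (min_le_left _ _)).le⟩)
    (y, Xm g y, g.1 (Xm g y) - f0.1 (Xm g y))
    (by simp only [Set.mem_prod, mem_closedBall_zero_iff]
        exact ⟨hy, xg, (tg.trans_le (min_le_left _ _)).le⟩)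
    (by
      rw [Prod.dist_eq, Prod.dist_eq]
      refine max_lt (by simpa using hδ) (max_lt ?_ ?_)
      · rw [dist_eq_norm]; linarith
      · have h1 := tf.trans_le (min_le_right _ _)
        have h2 := tg.trans_le (min_le_right _ _)
        rw [Real.dist_eq]
        refine (abs_sub _ _).trans_lt ?_
        linarith)
  rw [dist_eq_norm] at key
  simp only [Φ, add_sub_cancel] at key
  exact key.le

lemma TT_cauchy {n k : ℕ} (Q : MvPolynomial (Fin (n + 1)) ℂ) (σ τ : Fin k ↪ Fin n)
    (φ : C_c(Eucl n, ℂ)) (f0 : ConvFn n) {ε : ℝ} (hε : 0 < ε) :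
    ∃ N ∈ 𝓝 f0, ∀ f ∈ N, ∀ g ∈ N, f ∈ c2 n → g ∈ c2 n → ‖TT Q σ τ f φ - TT Q σ τ g φ‖ ≤ ε := by
  obtain ⟨S, hS0, hS, hcl⟩ := psi_close Q φ f0
  set D : ℝ := (n.factorial : ℝ) * 2 ^ n
  set V : ℝ := (volume : Measure (Eucl n)).real (Metric.closedBall 0 (S + 1))
  have hD : 0 ≤ D := by positivity
  have hV : 0 ≤ V := by positivity
  obtain ⟨η, hη, hη'⟩ : ∃ η > 0, 2 * η * D * V ≤ ε / 3 := by
    refine ⟨ε / 3 / (2 * D * V + 1), by positivity, ?_⟩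
    rw [show 2 * (ε / 3 / (2 * D * V + 1)) * D * V = (ε / 3) * (2 * D * V / (2 * D * V + 1)) by ring]
    have : 2 * D * V / (2 * D * V + 1) ≤ 1 := by rw [div_le_one (by positivity)]; linarith
    nlinarith
  obtain ⟨N1, hN1, hN1'⟩ := hcl η hη
  obtain ⟨h, ⟨hh1, hh2⟩, hhc⟩ := (mem_closure_iff_nhds.1 (c2_dense n f0)) _ (inter_mem hN1 hS)
  obtain ⟨m, hm⟩ := moll_close (psi_cont Q φ hhc) (S + 1) hη
  have hm := hm m le_rfl
  set ψ := moll m (psi Q φ h) with hψ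
  have hψ1 : ContDiff ℝ 1 ψ := by exact_mod_cast moll_contDiff m (psi_cont Q φ hhc) 1
  have hψ0 : ∀ x, S + 1 ≤ ‖x‖ → ψ x = 0 := by
    intro x hx
    rw [hψ, moll_apply]
    refine integral_eq_zero_of_ae (ae_of_all _ fun t => ?_)
    by_cases ht : eta m t = 0
    · simp [ht]
    · have h1 := eta_supp m ht
      have h2 : (1 : ℝ) / (m + 1) ≤ 1 := by rw [div_le_one (by positivity)]; simp
      have h3 : S < ‖x - t‖ := by linarith [norm_sub_norm_le x t]
      simp [hh2 hhc _ h3]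
  obtain ⟨C, hC0, hC⟩ := nl_estC 2 (S + 1) (by positivity) hψ1 hψ0
  obtain ⟨N2, hN2, hN2'⟩ := Xm_near f0 (S + 1) (show 0 < ε / 3 / (C + 1) by positivity)
  refine ⟨_, inter_mem (inter_mem hN1 hS) hN2, ?_⟩
  rintro f ⟨⟨hf1, hf2⟩, hf3⟩ g ⟨⟨hg1, hg2⟩, hg3⟩ hfc hgc
  have key : ∀ f ∈ N1, f ∈ c2 n → (∀ y, S < ‖y‖ → psi Q φ f y = 0) →
      ‖TT Q σ τ f φ - ∫ y, ψ y * ((jac (uu σ τ f) y).det : ℂ)‖ ≤ ε / 3 := by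
    intro f hf hfc hf0
    have hd : Continuous fun y => ((jac (uu σ τ f) y).det : ℂ) :=
      Complex.continuous_ofReal.comp (jac_cont (uu_contDiff σ τ hfc)).matrix_det
    rw [TT_eq Q σ τ hfc, ← integral_sub]
    · refine le_trans (int_bound (R := S + 1) (c := 2 * η * D) (fun y hy => ?_) fun y hy => ?_) hη'
      · rw [hf0 y (by linarith), hψ0 y hy.le]; simp
      · rw [← sub_mul, norm_mul]
        refine mul_le_mul ?_ (jac_det_le σ τ hfc y) (norm_nonneg _) (by positivity)
        have h1 := hN1' f hf h hh1 hfc hhc y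
        have h2 := hm y hy
        rw [dist_eq_norm, norm_sub_rev] at h2
        calc ‖psi Q φ f y - ψ y‖ = ‖(psi Q φ f y - psi Q φ h y) + (psi Q φ h y - ψ y)‖ := by
              congr 1; ring
          _ ≤ _ := norm_add_le _ _
          _ ≤ 2 * η := by linarith
    · exact ((psi_cont Q φ hfc).mul hd).integrable_of_hasCompactSupport
        (supp_closedBall (R := S) hf0).mul_right
    · exact (hψ1.continuous.mul hd).integrable_of_hasCompactSupport
        (supp_closedBall (R := S + 1) fun x hx => hψ0 x hx.le).mul_right
  have e1 := key f hf1 hfc (hf2 hfc)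
  have e2 := key g hg1 hgc (hg2 hgc)
  have e3 := hC (uu σ τ f) (uu σ τ g) (uu_contDiff σ τ hfc) (uu_contDiff σ τ hgc)
    (uu_fderiv σ τ hfc) (uu_fderiv σ τ hgc) (ε / 3 / (C + 1)) (by positivity)
    (fun i x hx => (uu_close σ τ f g i x).trans (hN2' f hf3 g hg3 hfc hgc x hx))
  have e4 : C * (ε / 3 / (C + 1)) ≤ ε / 3 := by
    rw [mul_div_assoc', div_le_iff₀ (by positivity)]; nlinarith
  set a := TT Q σ τ f φ
  set b := TT Q σ τ g φ
  set a' := ∫ y, ψ y * ((jac (uu σ τ f) y).det : ℂ)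
  set b' := ∫ y, ψ y * ((jac (uu σ τ g) y).det : ℂ)
  calc ‖a - b‖ = ‖(a - a') + (a' - b') - (b - b')‖ := by congr 1; ring
    _ ≤ ‖(a - a') + (a' - b')‖ + ‖b - b'‖ := norm_sub_le _ _
    _ ≤ ‖a - a'‖ + ‖a' - b'‖ + ‖b - b'‖ := by gcongr; exact norm_add_le _ _
    _ ≤ ε := by linarith

lemma poly_comp {n d : ℕ} {Q : MvPolynomial (Fin (n + 1)) ℂ} (hQ : Q.totalDegree ≤ d)
    {c : Fin (n + 1) → ℝ × Eucl n → ℂ} (hc : ∀ i, c i ∈ PolyV n 1) :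
    (fun z => MvPolynomial.eval (fun i => c i z) Q) ∈ PolyV n d := by
  choose C hC hC' using fun i => mem_PolyV.1 (hc i)
  refine mem_PolyV.2 ⟨∑ m ∈ Q.support, MvPolynomial.C (Q.coeff m) * ∏ i, C i ^ m i, ?_, fun z => ?_⟩
  · refine (MvPolynomial.totalDegree_finsetSum_le fun m hm => ?_)
    refine (MvPolynomial.totalDegree_mul _ _).trans ?_
    rw [MvPolynomial.totalDegree_C, zero_add]
    refine (MvPolynomial.totalDegree_finsetProd _ _).trans ?_
    refine le_trans (Finset.sum_le_sum fun i _ => (MvPolynomial.totalDegree_pow _ _).trans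
      (Nat.mul_le_mul_left _ (hC i))) ?_
    simp only [mul_one]
    refine le_trans (le_of_eq ?_) ((MvPolynomial.le_totalDegree hm).trans hQ)
    rw [Finsupp.sum_fintype _ _ (fun _ => rfl)]
  · rw [MvPolynomial.eval_eq', map_sum]
    refine Finset.sum_congr rfl fun m _ => ?_
    rw [map_mul, map_prod]
    simp only [map_pow, ← hC']
    simp [ev]

lemma polyV_const {n d : ℕ} (a : ℂ) : (fun _ => a : ℝ × Eucl n → ℂ) ∈ PolyV n d :=
  mem_PolyV.2 ⟨MvPolynomial.C a, by simp, fun z => by simp [ev]⟩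

lemma polyV_coord {n : ℕ} (i : Fin (n + 1)) :
    (fun z => (Fin.cons (z.1 : ℂ) fun i => (z.2 i : ℂ) : Fin (n + 1) → ℂ) i) ∈ PolyV n 1 :=
  mem_PolyV.2 ⟨MvPolynomial.X i, by simp, fun z => by simp [ev]⟩

lemma polyV_shift {n d : ℕ} {F : ℝ × Eucl n → ℂ} (hF : F ∈ PolyV n d) (z0 : ℝ × Eucl n)
    (x : Eucl n) :
    (fun z : ℝ × Eucl n => F (z0.1 + (z.1 + inner ℝ z.2 x), z0.2 + z.2)) ∈ PolyV n d := by
  obtain ⟨Q, hQ, h⟩ := mem_PolyV.1 hF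
  simp only [h]
  refine poly_comp hQ fun i => ?_
  refine Fin.cases ?_ (fun j => ?_) i
  · simp only [Fin.cons_zero]
    have h1 : (fun z : ℝ × Eucl n => ((z0.1 + (z.1 + inner ℝ z.2 x) : ℝ) : ℂ)) =
        (fun _ => (z0.1 : ℂ)) + ((fun z => (Fin.cons (z.1 : ℂ) fun i => (z.2 i : ℂ) :
          Fin (n + 1) → ℂ) 0) + ∑ j : Fin n, (x j : ℂ) • fun z : ℝ × Eucl n =>
          (Fin.cons (z.1 : ℂ) fun i => (z.2 i : ℂ) : Fin (n + 1) → ℂ) j.succ) := by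
      ext z
      simp [PiLp.inner_apply]
    rw [h1]
    exact Submodule.add_mem _ (polyV_const _) (Submodule.add_mem _ (polyV_coord _)
      (Submodule.sum_mem _ fun j _ => Submodule.smul_mem _ _ (polyV_coord _)))
  · simp only [Fin.cons_succ]
    have h1 : (fun z : ℝ × Eucl n => (((z0.2 + z.2) j : ℝ) : ℂ)) = (fun _ => (z0.2 j : ℂ)) +
        fun z : ℝ × Eucl n => (Fin.cons (z.1 : ℂ) fun i => (z.2 i : ℂ) : Fin (n + 1) → ℂ) j.succ := by
      ext z; simp
    rw [h1]
    exact Submodule.add_mem _ (polyV_const _) (polyV_coord _)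

section
variable {n d : ℕ} {P : ℝ → (Fin n → ℝ) → SymMatrix n → ℂ}

lemma P_polyV (hP : P ∈ TransInvPolySpace n d) (A : SymMatrix n) :
    (fun z : ℝ × Eucl n => P z.1 z.2 A) ∈ PolyV n d := by
  induction hP using Submodule.span_induction with
  | mem P h =>
    obtain ⟨Q, k, σ, τ, -, hQ, rfl⟩ := h
    simp only [mul_comm _ ((det _ : ℝ) : ℂ)]
    exact Submodule.smul_mem _ _ (mem_PolyV.2 ⟨Q, hQ, fun z => rfl⟩)
  | zero => exact Submodule.zero_mem _
  | add P P' _ _ h h' => exact Submodule.add_mem _ h h'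
  | smul c P _ h => exact Submodule.smul_mem _ c h

lemma hess_cont {f : Eucl n → ℝ} (hf : ContDiff ℝ 2 f) : Continuous fun x => (symHess f x).1 := by
  simp only [symHess_eq hf]
  refine continuous_matrix fun i j => ?_
  simp only [hessMat, of_apply]
  exact ((contDiff_gradc hf j).continuous_fderiv one_ne_zero).clm_apply continuous_const

lemma P_joint (hP : P ∈ TransInvPolySpace n d) :
    Continuous fun w : (ℝ × Eucl n) × SymMatrix n => P w.1.1 w.1.2 w.2 := by
  induction hP using Submodule.span_induction with
  | mem P h =>
    obtain ⟨Q, k, σ, τ, -, hQ, rfl⟩ := h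
    refine ((ev_continuous Q).comp continuous_fst).mul (Complex.continuous_ofReal.comp ?_)
    refine Continuous.matrix_det ?_
    exact (continuous_subtype_val.comp continuous_snd).matrix_submatrix _ _
  | zero => exact continuous_const
  | add P P' _ _ h h' => exact h.add h'
  | smul c P _ h => exact continuous_const.mul h

lemma P_cont (hP : P ∈ TransInvPolySpace n d) {f : Eucl n → ℝ} (hf : ContDiff ℝ 2 f) :
    Continuous fun x => P (f x) (gradVec f x) (symHess f x) := by
  have h : Continuous fun x => (((f x, gradE f x), symHess f x) : (ℝ × Eucl n) × SymMatrix n) :=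
    (hf.continuous.prodMk (contDiff_gradE hf).continuous).prodMk ((hess_cont hf).subtype_mk _)
  exact (P_joint hP).comp h

lemma P_integrable (hP : P ∈ TransInvPolySpace n d) {f : Eucl n → ℝ} (hf : ContDiff ℝ 2 f)
    (φ : C_c(Eucl n, ℂ)) : Integrable fun x => φ x * P (f x) (gradVec f x) (symHess f x) :=
  (φ.continuous.mul (P_cont hP hf)).integrable_of_hasCompactSupport φ.hasCompactSupport'.mul_right

lemma aA_c2 {f : ConvFn n} (hf : f ∈ c2 n) (z : ℝ × Eucl n) : aA f z ∈ c2 n := by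
  have hf' : ContDiff ℝ 2 ⇑f.1 := hf
  exact hf'.add (contDiff_const.add ((innerSL ℝ z.2).contDiff))

lemma fderiv_aA {f : ConvFn n} (hf : f ∈ c2 n) (z : ℝ × Eucl n) (x v : Eucl n) :
    fderiv ℝ (aA f z).1 x v = fderiv ℝ f.1 x v + inner ℝ z.2 v := by
  have hf' : ContDiff ℝ 2 ⇑f.1 := hf
  have h : HasFDerivAt (fun x => f.1 x + (z.1 + innerSL ℝ z.2 x)) (fderiv ℝ f.1 x + innerSL ℝ z.2) x :=
    (hf'.differentiable two_ne_zero x).hasFDerivAt.add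
      ((innerSL ℝ z.2).hasFDerivAt.const_add z.1)
  rw [show ⇑(aA f z).1 = fun x => f.1 x + (z.1 + innerSL ℝ z.2 x) from rfl, h.fderiv]
  simp

lemma gradVec_aA {f : ConvFn n} (hf : f ∈ c2 n) (z : ℝ × Eucl n) (x : Eucl n) :
    gradVec (aA f z).1 x = ⇑(gradE f.1 x + z.2) := by
  ext i
  rw [gradVec, fderiv_aA hf]
  simp [gradE, gradVec, EuclideanSpace.inner_single_right]

lemma symHess_congr {f g : Eucl n → ℝ} {x : Eucl n} (h : hessMat f x = hessMat g x) :
    symHess f x = symHess g x := by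
  simp only [symHess, h]

lemma hess_aA {f : ConvFn n} (hf : f ∈ c2 n) (z : ℝ × Eucl n) (x : Eucl n) :
    symHess (aA f z).1 x = symHess f.1 x := by
  refine symHess_congr ?_
  ext i j
  simp only [hessMat, of_apply, fderiv_aA hf]
  rw [fderiv_add_const]

lemma rep_props {Ψ : ConvFn n → RadonMeasure n} (hP : P ∈ TransInvPolySpace n d)
    (hc : IsContinuousFunctional Ψ) (hr : TransInvRepresentation Ψ P) :
    MemPdLV d Ψ ∧ IsTranslationInvariant Ψ := by
  refine ⟨⟨?_, hc, ?_⟩, ?_⟩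
  · intro f h U hU hfh φ hφ
    have h1 := ((hc φ).tendsto f).comp (mollC_tendsto f)
    have h2 := ((hc φ).tendsto h).comp (mollC_tendsto h)
    refine tendsto_nhds_unique (h1.congr' ?_) h2
    obtain ⟨δ, hδ, hδU⟩ := φ.hasCompactSupport'.isCompact.exists_thickening_subset_open hU hφ
    obtain ⟨m0, hm0⟩ := exists_nat_one_div_lt (half_pos hδ)
    filter_upwards [eventually_ge_atTop m0] with m hm
    simp only [Function.comp]
    rw [hr _ (mollC_smooth m f), hr _ (mollC_smooth m h)]
    refine integral_congr_ae (ae_of_all _ fun x => ?_)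
    simp only
    by_cases hx : φ x = 0
    · rw [hx, zero_mul, zero_mul]
    have hloc : ⇑(mollC m f).1 =ᶠ[𝓝 x] ⇑(mollC m h).1 := by
      filter_upwards [Metric.ball_mem_nhds x (half_pos hδ)] with w hw
      refine mollC_local m f h w fun y hy => hfh y (hδU ?_)
      refine Metric.mem_thickening_iff.2 ⟨x, subset_tsupport _ hx, ?_⟩
      have h3 : (1 : ℝ) / (m + 1) ≤ 1 / (m0 + 1) := by gcongr
      rw [Metric.mem_ball] at hw
      linarith [dist_triangle y w x]
    have h4 := hloc.fderiv (𝕜 := ℝ)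
    have h5 : gradVec (mollC m f).1 x = gradVec (mollC m h).1 x := by
      ext i; simp only [gradVec, h4.self_of_nhds]
    have h6 : symHess (mollC m f).1 x = symHess (mollC m h).1 x := by
      refine symHess_congr ?_
      ext i j
      simp only [hessMat, of_apply]
      rw [Filter.EventuallyEq.fderiv_eq]
      exact h4.mono fun y hy => by simp only [hy]
    rw [hloc.self_of_nhds, h5, h6]
  · rw [polyDeg_iff]
    intro f φ
    obtain ⟨N, z, b, hb, hint⟩ := interp n d
    have key : ∀ f : ConvFn n, ∀ w, (Ψ (aA f w)).1 φ = ∑ k, (Ψ (aA f (z k))).1 φ * b k w := by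
      intro f w
      have hcl : IsClosed {f : ConvFn n | (Ψ (aA f w)).1 φ = ∑ k, (Ψ (aA f (z k))).1 φ * b k w} :=
        isClosed_eq ((hc φ).comp (continuous_addAffine _ _)) (continuous_finsetSum _ fun k _ =>
          ((hc φ).comp (continuous_addAffine _ _)).mul continuous_const)
      refine hcl.closure_subset_iff.2 (fun f hf => ?_) (c2_dense n f)
      rw [Set.mem_ofPred_eq]
      simp only [hr _ (aA_c2 hf _), ← integral_mul_const]
      rw [← integral_finsetSum _ fun k _ => (P_integrable hP (aA_c2 hf _) φ).mul_const _]
      refine integral_congr_ae (ae_of_all _ fun x => ?_)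
      simp only [aA_apply, gradVec_aA hf, hess_aA hf]
      have := hint _ (polyV_shift (P_polyV hP (symHess f.1 x)) (f.1 x, gradE f.1 x) x) w
      simp only at this
      rw [this, Finset.mul_sum]
      exact Finset.sum_congr rfl fun k _ => by ring
    rw [show (fun w => (Ψ (aA f w)).1 φ) = ∑ k, (Ψ (aA f (z k))).1 φ • b k by
      ext w; rw [key f w]; simp]
    exact Submodule.sum_mem _ fun k _ => Submodule.smul_mem _ _ (hb k)
  · intro x₀ f φ
    have hcl : IsClosed {f : ConvFn n | (Ψ (translateConv x₀ f)).1 (translateCc x₀ φ) = (Ψ f).1 φ} :=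
      isClosed_eq ((hc _).comp (continuous_translateConv x₀)) (hc φ)
    refine hcl.closure_subset_iff.2 (fun f hf => ?_) (c2_dense n f)
    have hf' : ContDiff ℝ 2 ⇑f.1 := hf
    have ht : ContDiff ℝ 2 ⇑(translateConv x₀ f).1 := hf'.comp (contDiff_id.sub contDiff_const)
    rw [Set.mem_ofPred_eq, hr _ ht, hr _ hf]
    have h1 : ∀ (g : Eucl n → ℝ) x, fderiv ℝ (fun y => g (y - x₀)) x = fderiv ℝ g (x - x₀) :=
      fun g x => fderiv_comp_sub x₀
    have h2 : ⇑(translateConv x₀ f).1 = fun y => f.1 (y - x₀) := rfl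
    have h3 : ∀ x, gradVec (translateConv x₀ f).1 x = gradVec f.1 (x - x₀) := fun x => by
      ext i; simp only [gradVec, h2, h1]
    have h4 : ∀ x, symHess (translateConv x₀ f).1 x = symHess f.1 (x - x₀) := fun x => by
      simp only [symHess]
      have : hessMat (translateConv x₀ f).1 x = hessMat f.1 (x - x₀) := by
        ext i j
        simp only [hessMat, of_apply, h2, h1]
        rw [h1 (fun y => fderiv ℝ f.1 y (EuclideanSpace.single j 1)) x]
      simp only [this]
    simp only [h3, h4]
    exact integral_sub_right_eq_self
      (fun x => φ x * P (f.1 x) (gradVec f.1 x) (symHess f.1 x)) x₀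
end

section
variable {n k : ℕ} (Q : MvPolynomial (Fin (n + 1)) ℂ) (σ τ : Fin k ↪ Fin n)

instance c2_neBot (f : ConvFn n) : (𝓝[c2 n] f).NeBot := mem_closure_iff_nhdsWithin_neBot.1 (c2_dense n f)

lemma TT_lim (φ : C_c(Eucl n, ℂ)) (f : ConvFn n) :
    ∃ y, Tendsto (fun g => TT Q σ τ g φ) (𝓝[c2 n] f) (𝓝 y) := by
  refine cauchy_iff_exists_le_nhds.1 (Metric.cauchy_iff.2 ⟨inferInstance, fun ε hε => ?_⟩)
  obtain ⟨N, hN, h⟩ := TT_cauchy Q σ τ φ f (half_pos hε)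
  refine ⟨(fun g => TT Q σ τ g φ) '' (N ∩ c2 n), image_mem_map
    (inter_mem (mem_nhdsWithin_of_mem_nhds hN) self_mem_nhdsWithin), ?_⟩
  rintro _ ⟨a, ha, rfl⟩ _ ⟨b, hb, rfl⟩
  rw [dist_eq_norm]
  linarith [h a ha.1 b hb.1 ha.2 hb.2]

def TE (f : ConvFn n) (φ : C_c(Eucl n, ℂ)) : ℂ := extendFrom (c2 n) (fun g => TT Q σ τ g φ) f

lemma TE_tendsto (f : ConvFn n) (φ : C_c(Eucl n, ℂ)) :
    Tendsto (fun g => TT Q σ τ g φ) (𝓝[c2 n] f) (𝓝 (TE Q σ τ f φ)) :=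
  tendsto_extendFrom (TT_lim Q σ τ φ f)

lemma TE_eq {f : ConvFn n} (hf : f ∈ c2 n) (φ : C_c(Eucl n, ℂ)) : TE Q σ τ f φ = TT Q σ τ f φ :=
  (tendsto_nhds_unique ((TE_tendsto Q σ τ f φ).mono_left (pure_le_nhdsWithin hf))
    (tendsto_pure_nhds _ _))

lemma TT_cont (f : ConvFn n) (hf : f ∈ c2 n) : Continuous fun x =>
    MvPolynomial.eval (Fin.cons (f.1 x : ℂ) fun i => (gradVec f.1 x i : ℂ)) Q
          * ((((symHess f.1 x).1.submatrix σ τ).det : ℝ) : ℂ) :=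
  P_cont (d := Q.totalDegree) (P := fun s v A => MvPolynomial.eval (Fin.cons (s : ℂ) fun i => (v i : ℂ)) Q
          * (((A.1.submatrix σ τ).det : ℝ) : ℂ))
    (Submodule.subset_span ⟨Q, k, σ, τ, by simpa using Fintype.card_le_of_embedding σ, le_rfl, rfl⟩) hf

lemma TT_int (f : ConvFn n) (hf : f ∈ c2 n) (φ : C_c(Eucl n, ℂ)) : Integrable fun x =>
    φ x * (MvPolynomial.eval (Fin.cons (f.1 x : ℂ) fun i => (gradVec f.1 x i : ℂ)) Q
          * ((((symHess f.1 x).1.submatrix σ τ).det : ℝ) : ℂ)) :=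
  (φ.continuous.mul (TT_cont Q σ τ f hf)).integrable_of_hasCompactSupport
    φ.hasCompactSupport'.mul_right

def TR (f : ConvFn n) : RadonMeasure n :=
  ⟨{ toFun := TE Q σ τ f
     map_add' := fun φ ψ => by
      refine tendsto_nhds_unique (TE_tendsto Q σ τ f _)
        (((TE_tendsto Q σ τ f φ).add (TE_tendsto Q σ τ f ψ)).congr' ?_)
      filter_upwards [self_mem_nhdsWithin] with g hg
      rw [TT, TT, TT, ← integral_add (TT_int Q σ τ g hg φ) (TT_int Q σ τ g hg ψ)]
      simp [add_mul]
     map_smul' := fun c φ => by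
      refine tendsto_nhds_unique (TE_tendsto Q σ τ f _)
        (((TE_tendsto Q σ τ f φ).const_smul c).congr' ?_)
      filter_upwards [self_mem_nhdsWithin] with g hg
      rw [TT, TT, ← integral_smul]
      simp [mul_assoc] }, by
    intro A hA
    obtain ⟨R, hR⟩ := hA.isBounded.exists_norm_le
    obtain ⟨C, hC⟩ := TT_mass Q σ τ f R
    refine ⟨C, fun φ hφ h1 => ?_⟩
    refine le_of_tendsto (TE_tendsto Q σ τ f φ).norm ?_
    filter_upwards [mem_nhdsWithin_of_mem_nhds hC, self_mem_nhdsWithin] with g hg hgc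
    exact hg hgc φ (fun x hx => hR x (hφ (subset_tsupport _ hx))) h1⟩

end

lemma exists_rep {n d : ℕ} {P : ℝ → (Fin n → ℝ) → SymMatrix n → ℂ}
    (hP : P ∈ TransInvPolySpace n d) :
    ∃ Ψ : ConvFn n → RadonMeasure n, IsContinuousFunctional Ψ ∧ TransInvRepresentation Ψ P := by
  induction hP using Submodule.span_induction with
  | mem P h =>
    obtain ⟨Q, k, σ, τ, -, hQ, rfl⟩ := h
    exact ⟨TR Q σ τ, fun φ => continuous_extendFrom (c2_dense n) (TT_lim Q σ τ φ),
      fun f hf φ => TE_eq Q σ τ hf φ⟩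
  | zero => exact ⟨0, fun φ => continuous_const, fun f hf φ => by simp⟩
  | add P P' hP hP' h h' =>
    obtain ⟨Ψ, h1, h2⟩ := h
    obtain ⟨Ψ', h1', h2'⟩ := h'
    refine ⟨Ψ + Ψ', fun φ => (h1 φ).add (h1' φ), fun f hf φ => ?_⟩
    show (Ψ f).1 φ + (Ψ' f).1 φ = _
    rw [h2 f hf, h2' f hf, ← integral_add (P_integrable hP hf φ) (P_integrable hP' hf φ)]
    simp [mul_add]
  | smul c P hP h =>
    obtain ⟨Ψ, h1, h2⟩ := h
    refine ⟨c • Ψ, fun φ => continuous_const.mul (h1 φ), fun f hf φ => ?_⟩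
    show c * (Ψ f).1 φ = _
    rw [h2 f hf, ← integral_const_mul]
    refine integral_congr_ae (ae_of_all _ fun x => ?_)
    simp only [Pi.smul_apply, smul_eq_mul]; ring

lemma eq_of_c2 {n : ℕ} {Ψ Ψ' : ConvFn n → RadonMeasure n} (h : IsContinuousFunctional Ψ)
    (h' : IsContinuousFunctional Ψ') (he : ∀ f ∈ c2 n, ∀ φ, (Ψ f).1 φ = (Ψ' f).1 φ) : Ψ = Ψ' := by
  funext f
  refine Subtype.ext (LinearMap.ext fun φ => ?_)
  exact congrFun ((h φ).ext_on (c2_dense n) (h' φ) fun f hf => he f hf φ) f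

lemma converse {n d : ℕ} {P : ℝ → (Fin n → ℝ) → SymMatrix n → ℂ} (hP : P ∈ TransInvPolySpace n d) :
    ∃! Ψ' : ConvFn n → RadonMeasure n,
        (MemPdLV d Ψ' ∧ IsTranslationInvariant Ψ') ∧ TransInvRepresentation Ψ' P := by
  obtain ⟨Ψ, h1, h2⟩ := exists_rep hP
  refine ⟨Ψ, ⟨rep_props hP h1 h2, h2⟩, fun Ψ' h => ?_⟩
  exact eq_of_c2 h.1.1.2.1 h1 fun f hf φ => by rw [h.2 f hf, h2 f hf]

def etaCc {n : ℕ} (m : ℕ) (z : Eucl n) : C_c(Eucl n, ℂ) :=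
  ⟨⟨fun x => ((eta m (x - z) : ℝ) : ℂ), Complex.continuous_ofReal.comp ((eta_cont m).comp (by fun_prop))⟩,
    supp_closedBall (R := ‖z‖ + 1) fun x hx => by
      by_contra h
      have h1 := eta_supp m (x := x - z) (fun h0 => h (by simp [h0]))
      have h2 : (1 : ℝ) / (m + 1) ≤ 1 := by rw [div_le_one (by positivity)]; simp
      linarith [norm_sub_norm_le x z]⟩

lemma etaCc_apply {n : ℕ} (m : ℕ) (z x : Eucl n) : etaCc m z x = ((eta m (x - z) : ℝ) : ℂ) := rfl

lemma etaCc_supp {n : ℕ} (m : ℕ) (z x : Eucl n) (h : etaCc m z x ≠ 0) : ‖x - z‖ ≤ 1 / (m + 1) := by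
  refine (eta_supp m fun h0 => h ?_).le
  rw [etaCc_apply, h0]; simp

lemma etaCc_tr {n : ℕ} (m : ℕ) (z : Eucl n) : etaCc m z = translateCc z (etaCc m 0) := by
  ext x
  rw [etaCc_apply, show translateCc z (etaCc m 0) x = etaCc m 0 (x - z) from rfl, etaCc_apply, sub_zero]

lemma etaB_cont {n : ℕ} (m : ℕ) : Continuous fun z : Eucl n => ccToBcf (etaCc m z) := by
  have hu := (eta_compact (n := n) m).uniformContinuous_of_continuous (eta_cont m)
  rw [Metric.uniformContinuous_iff] at hu
  rw [Metric.continuous_iff]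
  intro z ε hε
  obtain ⟨δ, hδ, h⟩ := hu (ε / 2) (half_pos hε)
  refine ⟨δ, hδ, fun w hw => ?_⟩
  refine lt_of_le_of_lt ((BoundedContinuousFunction.dist_le (half_pos hε).le).2 fun x => ?_) (half_lt_self hε)
  rw [ccToBcf_apply, ccToBcf_apply, etaCc_apply, etaCc_apply, dist_eq_norm, ← Complex.ofReal_sub,
    Complex.norm_real, ← dist_eq_norm]
  exact (h (by rw [dist_sub_left]; exact hw)).le

lemma conv_lemma {n : ℕ} (μ : RadonMeasure n) (φ : C_c(Eucl n, ℂ)) :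
    Tendsto (fun m => ∫ z, φ z * μ.1 (etaCc m z)) atTop (𝓝 (μ.1 φ)) := by
  obtain ⟨R, hR0, hR⟩ := cc_radius φ
  set χ : C_c(Eucl n, ℂ) := cutCc (R + 1)
  let G : ℕ → Eucl n → (Eucl n →ᵇ ℂ) := fun m z => φ z • ccToBcf (etaCc m z)
  have hGi : ∀ m, Integrable (G m) := fun m =>
    (φ.continuous.smul (etaB_cont m)).integrable_of_hasCompactSupport φ.hasCompactSupport'.smul_right
  have h1 : ∀ m, ∫ z, φ z * μ.1 (etaCc m z) = bcfFun μ χ (∫ z, G m z) := by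
    intro m
    rw [← ContinuousLinearMap.integral_comp_comm _ (hGi m)]
    refine integral_congr_ae (ae_of_all _ fun z => ?_)
    simp only [G, map_smul, smul_eq_mul]
    by_cases hz : φ z = 0
    · rw [hz, zero_mul, zero_mul]
    rw [bcfFun_apply, mulCc_cut]
    intro x hx
    have h1 := etaCc_supp m z x hx
    have h2 : (1 : ℝ) / (m + 1) ≤ 1 := by rw [div_le_one (by positivity)]; simp
    linarith [norm_sub_norm_le x z, hR z hz]
  have h2 : ∀ m x, (∫ z, G m z) x = moll m φ x := by
    intro m x
    have := (BoundedContinuousFunction.evalCLM ℂ x).integral_comp_comm (hGi m)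
    rw [BoundedContinuousFunction.evalCLM_apply] at this
    rw [← this, moll_apply, ← integral_sub_left_eq_self _ volume x]
    refine integral_congr_ae (ae_of_all _ fun z => ?_)
    simp [G, ccToBcf_apply, etaCc_apply, mul_comm]
  have h3 : Tendsto (fun m => ∫ z, G m z) atTop (𝓝 (ccToBcf φ)) := by
    rw [Metric.tendsto_atTop]
    intro ε hε
    obtain ⟨m0, hm0⟩ := moll_close φ.continuous (R + 1) (half_pos hε)
    refine ⟨m0, fun m hm => lt_of_le_of_lt ((BoundedContinuousFunction.dist_le (half_pos hε).le).2
      fun x => ?_) (half_lt_self hε)⟩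
    rw [h2, ccToBcf_apply]
    by_cases hx : ‖x‖ ≤ R + 1
    · exact hm0 m hm x hx
    push Not at hx
    have e1 : φ x = 0 := by
      by_contra h; linarith [hR x h]
    have e2 : moll m φ x = 0 := by
      rw [moll_apply]
      refine integral_eq_zero_of_ae (ae_of_all _ fun t => ?_)
      by_cases ht : eta m t = 0
      · simp [ht]
      have h1 := eta_supp m ht
      have h2 : (1 : ℝ) / (m + 1) ≤ 1 := by rw [div_le_one (by positivity)]; simp
      have : φ (x - t) = 0 := by
        by_contra h; linarith [hR _ h, norm_sub_norm_le x t]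
      simp [this]
    rw [e1, e2, dist_self]; exact (half_pos hε).le
  have h4 := ((bcfFun μ χ).continuous.tendsto _).comp h3
  rw [bcfFun_apply, mulCc_cut φ (fun x hx => by linarith [hR x hx])] at h4
  refine h4.congr fun m => (h1 m).symm

lemma etaμ_cont {n : ℕ} (μ : RadonMeasure n) (m : ℕ) : Continuous fun z => μ.1 (etaCc m z) := by
  rw [continuous_iff_continuousAt]
  intro z
  have h := ((bcfFun μ (cutCc (‖z‖ + 2))).continuous.comp (etaB_cont m)).continuousAt (x := z)
  refine h.congr ?_
  filter_upwards [Metric.ball_mem_nhds z one_pos] with w hw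
  simp only [Function.comp]
  rw [bcfFun_apply, mulCc_cut]
  intro x hx
  have h1 := etaCc_supp m w x hx
  have h2 : (1 : ℝ) / (m + 1) ≤ 1 := by rw [div_le_one (by positivity)]; simp
  rw [mem_ball_iff_norm] at hw
  linarith [norm_sub_norm_le x w, norm_sub_norm_le w z]

lemma mass_near {n : ℕ} {Ψ : ConvFn n → RadonMeasure n} (hc : IsContinuousFunctional Ψ)
    (f : ConvFn n) (R : ℝ) : ∃ j : ℕ, ∀ g : ConvFn n,
      (∀ x, ‖x‖ ≤ j → |g.1 x - f.1 x| < 1 / (j + 1)) →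
      ∀ φ : C_c(Eucl n, ℂ), (∀ x, φ x ≠ 0 → ‖x‖ ≤ R) → (∀ x, ‖φ x‖ ≤ 1) → ‖(Ψ g).1 φ‖ ≤ j := by
  by_contra! hcon
  choose g hg φ hφ hφ1 hbig using hcon
  have hlim : Tendsto g atTop (𝓝 f) := by
    refine tendsto_conv.2 fun R ε hε => ?_
    obtain ⟨j0, hj0⟩ := exists_nat_one_div_lt hε
    obtain ⟨j1, hj1⟩ := exists_nat_ge R
    filter_upwards [eventually_ge_atTop (max j0 j1)] with j hj x hx
    have h1 : (j1 : ℝ) ≤ j := by exact_mod_cast (le_max_right _ _).trans hj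
    have h0 : (j0 : ℝ) ≤ j := by exact_mod_cast (le_max_left _ _).trans hj
    refine (hg j x (by linarith)).trans (lt_of_le_of_lt ?_ hj0)
    gcongr
  obtain ⟨C, hC⟩ := mass_seq hc hlim R
  obtain ⟨j, hj⟩ := exists_nat_ge C
  exact absurd (hC j _ (hφ j) (hφ1 j)) (by linarith [hbig j])

lemma exists_supC {n : ℕ} {ι : Type*} (s : Finset ι) (H : ι → ConvFn n) (f : ConvFn n) :
    ∃ G : ConvFn n, (∀ x, f.1 x ≤ G.1 x) ∧ (∀ i ∈ s, ∀ x, (H i).1 x ≤ G.1 x) ∧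
      ∀ x, G.1 x = f.1 x ∨ ∃ i ∈ s, G.1 x = (H i).1 x := by
  classical
  induction s using Finset.induction_on with
  | empty => exact ⟨f, fun x => le_rfl, by simp, fun x => Or.inl rfl⟩
  | insert a s _ ih =>
    obtain ⟨G, h1, h2, h3⟩ := ih
    refine ⟨⟨G.1 ⊔ (H a).1, by simpa using G.2.sup (H a).2⟩, fun x => ?_, ?_, fun x => ?_⟩
    · exact (h1 x).trans le_sup_left
    · intro i hi x
      rcases Finset.mem_insert.1 hi with rfl | hi
      · exact le_sup_right
      · exact (h2 i hi x).trans le_sup_left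
    · show G.1 x ⊔ (H a).1 x = _ ∨ _
      rcases le_total (G.1 x) ((H a).1 x) with h | h
      · exact Or.inr ⟨a, Finset.mem_insert_self _ _, by simpa using h⟩
      · rcases h3 x with h' | ⟨i, hi, h'⟩
        · left; rw [sup_eq_left.2 h, h']
        · right; exact ⟨i, Finset.mem_insert_of_mem hi, by simpa [h] using h'⟩

def sqC {n : ℕ} (c : ℝ≥0) : ConvFn n :=
  ⟨⟨fun x => (c : ℝ) * ‖x‖ ^ 2, by fun_prop⟩,
    ((convexOn_univ_norm.pow (fun x _ => norm_nonneg x) 2).smul c.2)⟩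

lemma sqC_apply {n : ℕ} (c : ℝ≥0) (x : Eucl n) : (sqC c).1 x = c * ‖x‖ ^ 2 := rfl

lemma eucl_sum {n : ℕ} (v : Eucl n) : v = ∑ i, v i • EuclideanSpace.single i (1 : ℝ) := by
  conv_lhs => rw [← (EuclideanSpace.basisFun (Fin n) ℝ).sum_repr v]
  simp

lemma eucl_le {n : ℕ} {v : Eucl n} {c : ℝ} (h : ∀ i, |v i| ≤ c) : ‖v‖ ≤ n * c := by
  rw [eucl_sum v]
  refine (norm_sum_le _ _).trans ((Finset.sum_le_sum fun i _ => ?_).trans (le_of_eq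
    (by rw [Finset.sum_const, Finset.card_univ, Fintype.card_fin, nsmul_eq_mul])))
  rw [norm_smul]; simpa using h i

def gridpt {n M : ℕ} (i : Fin n → Fin M) : Eucl n := WithLp.toLp 2 fun l => 4 * ((i l : ℕ) : ℝ) / M

lemma gridpt_norm {n M : ℕ} (i : Fin n → Fin M) : ‖gridpt i‖ ≤ n * 4 := by
  refine eucl_le fun l => ?_
  have h : ((i l : ℕ) : ℝ) ≤ M := by exact_mod_cast (i l).2.le
  have h0 : (0 : ℝ) < M := by exact_mod_cast (Nat.zero_le _).trans_lt (i l).2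
  simp only [gridpt]
  rw [abs_of_nonneg (by positivity), div_le_iff₀ h0]; linarith

lemma gridpt_sep {n M : ℕ} {i j : Fin n → Fin M} (h : i ≠ j) : 4 / (M : ℝ) ≤ ‖gridpt i - gridpt j‖ := by
  obtain ⟨l, hl⟩ := Function.ne_iff.1 h
  refine le_trans ?_ (coord_le _ l)
  have h0 : (0 : ℝ) < M := by exact_mod_cast (Nat.zero_le _).trans_lt (i l).2
  simp only [gridpt, PiLp.sub_apply]
  rw [← sub_div, abs_div, abs_of_pos h0, ← mul_sub, abs_mul, abs_of_pos (show (0:ℝ) < 4 by norm_num)]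
  have h1 : (1 : ℝ) ≤ |((i l : ℕ) : ℝ) - ((j l : ℕ) : ℝ)| := by
    have : ((i l : ℕ) : ℤ) - ((j l : ℕ) : ℤ) ≠ 0 := by
      have : (i l : ℕ) ≠ (j l : ℕ) := fun e => hl (Fin.ext e)
      omega
    exact_mod_cast Int.one_le_abs this
  gcongr
  linarith

lemma aA_add {n : ℕ} (f : ConvFn n) (z w : ℝ × Eucl n) : aA (aA f z) w = aA f (z + w) := by
  refine Subtype.ext (ContinuousMap.ext fun x => ?_)
  simp only [aA_apply, Prod.fst_add, Prod.snd_add, inner_add_left]; ring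

lemma phase_sum {n : ℕ} {ι : Type*} [Fintype ι] (μ : RadonMeasure n) (φ : ι → C_c(Eucl n, ℂ))
    (hd : ∀ x i j, φ i x ≠ 0 → φ j x ≠ 0 → i = j) (h1 : ∀ i x, ‖φ i x‖ ≤ 1) {R C : ℝ}
    (hR : ∀ i x, φ i x ≠ 0 → ‖x‖ ≤ R)
    (hC : ∀ φ : C_c(Eucl n, ℂ), (∀ x, φ x ≠ 0 → ‖x‖ ≤ R) → (∀ x, ‖φ x‖ ≤ 1) → ‖μ.1 φ‖ ≤ C) :
    ∑ i, ‖μ.1 (φ i)‖ ≤ C := by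
  classical
  have hθ : ∀ c : ℂ, ∃ θ : ℂ, ‖θ‖ = 1 ∧ θ * c = ‖c‖ := by
    intro c
    obtain ⟨θ, h, h'⟩ := RCLike.exists_norm_eq_mul_self c
    exact ⟨θ, h, h'.symm⟩
  choose θ hθ1 hθ using hθ
  have hval : ∀ x, (∑ i, θ (μ.1 (φ i)) • φ i) x = ∑ i, θ (μ.1 (φ i)) * φ i x := fun x => by
    simp [CompactlySupportedContinuousMap.sum_apply]
  have hcase : ∀ x, (∀ i, φ i x = 0) ∨ ∃ i, φ i x ≠ 0 ∧
      (∑ i, θ (μ.1 (φ i)) • φ i) x = θ (μ.1 (φ i)) * φ i x := by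
    intro x
    by_cases h : ∀ i, φ i x = 0
    · exact Or.inl h
    push Not at h
    obtain ⟨i, hi⟩ := h
    refine Or.inr ⟨i, hi, ?_⟩
    rw [hval, Finset.sum_eq_single i]
    · intro j _ hj
      by_contra h
      exact hj (hd x j i (fun h0 => h (by rw [h0, mul_zero])) hi)
    · simp
  have := hC (∑ i, θ (μ.1 (φ i)) • φ i) (fun x hx => by
    rcases hcase x with h | ⟨i, hi, -⟩
    · exact absurd (by rw [hval]; simp [h]) hx
    · exact hR i x hi) (fun x => by
    rcases hcase x with h | ⟨i, hi, he⟩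
    · rw [hval]; simp [h]
    · rw [he, norm_mul, hθ1, one_mul]; exact h1 i x)
  rw [map_sum] at this
  simp only [map_smul, smul_eq_mul, hθ] at this
  rw [← Complex.ofReal_sum, Complex.norm_real] at this
  exact (le_abs_self _).trans this

lemma lemM {n d : ℕ} {Ψ : ConvFn n → RadonMeasure n} (hΨ : MemPdLV d Ψ)
    (htr : IsTranslationInvariant Ψ) (K : ℝ≥0) (Z : ℝ) :
    ∃ (C : ℝ) (m0 : ℕ), 0 ≤ C ∧ ∀ m ≥ m0, ∀ f : ConvFn n, (∀ x, 0 ≤ f.1 x ∧ f.1 x ≤ K * ‖x‖ ^ 2) →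
      ∀ z : ℝ × Eucl n, ‖z‖ ≤ Z → ∀ φ : C_c(Eucl n, ℂ), (∀ x, φ x ≠ 0 → ‖x‖ ≤ 1 / (m + 1)) →
      (∀ x, ‖φ x‖ ≤ 1) → ‖(Ψ (aA f z)).1 φ‖ * (m + 1) ^ n ≤ C := by
  obtain ⟨hloc, hc, hpol⟩ := hΨ
  rw [polyDeg_iff] at hpol
  obtain ⟨N, zz, b, hb, hint⟩ := interp n d
  choose j hj using fun k => mass_near hc (aA (sqC (2 * K)) (zz k)) (n * 4 + 1)
  -- bound of the coefficients
  have hB : ∀ k, ∃ B, 0 ≤ B ∧ ∀ z : ℝ × Eucl n, ‖z‖ ≤ Z → ∀ x : Eucl n, ‖x‖ ≤ n * 4 →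
      ‖b k (z.1 + 2 * K * ‖x‖ ^ 2 - inner ℝ z.2 x, z.2 - (4 * K : ℝ) • x)‖ ≤ B := by
    intro k
    have hcont : Continuous fun p : (ℝ × Eucl n) × Eucl n =>
        b k (p.1.1 + 2 * K * ‖p.2‖ ^ 2 - inner ℝ p.1.2 p.2, p.1.2 - (4 * K : ℝ) • p.2) :=
      (PolyV_continuous (hb k)).comp (by fun_prop)
    obtain ⟨B, hB⟩ := ((isCompact_closedBall (0 : ℝ × Eucl n) Z).prod
      (isCompact_closedBall (0 : Eucl n) (n * 4))).exists_bound_of_continuousOn hcont.continuousOn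
    exact ⟨max B 0, le_max_right _ _, fun z hz x hx => (hB (z, x) ⟨by simpa using hz, by simpa using hx⟩).trans
      (le_max_left _ _)⟩
  choose B hB0 hB using hB
  obtain ⟨m0, hm0⟩ := exists_nat_gt (5 * (K : ℝ) * (∑ k, (j k : ℝ) + 1))
  refine ⟨∑ k, j k * B k, m0, Finset.sum_nonneg fun k _ => mul_nonneg (Nat.cast_nonneg _) (hB0 k),
    fun m hm f hf z hz φ hφ hφ1 => ?_⟩
  set a : ℝ := 1 / (m + 1) with ha
  have ha0 : 0 < a := by positivity
  have ha1 : a ≤ 1 := by rw [ha, div_le_one (by positivity)]; simp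
  have hK : (0 : ℝ) ≤ K := K.2
  let I := Fin n → Fin (m + 1)
  let x : I → Eucl n := gridpt
  let H : I → ConvFn n := fun i => aA (translateConv (x i) f) (-(2 * K * ‖x i‖ ^ 2), (4 * K : ℝ) • x i)
  have hH : ∀ i y, (H i).1 y = f.1 (y - x i) + 2 * K * ‖y‖ ^ 2 - 2 * K * ‖y - x i‖ ^ 2 := by
    intro i y
    have : ‖y - x i‖ ^ 2 = ‖y‖ ^ 2 - 2 * inner ℝ (x i) y + ‖x i‖ ^ 2 := by
      rw [norm_sub_sq_real, real_inner_comm]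
    rw [this, aA_apply]
    simp only [real_inner_smul_left]
    show f.1 (y - x i) + _ = _
    ring
  obtain ⟨G, hG1, hG2, hG3⟩ := exists_supC Finset.univ H (aA (sqC (2 * K)) (-(5 * K * a ^ 2), 0))
  have hG1' : ∀ y, 2 * K * ‖y‖ ^ 2 - 5 * K * a ^ 2 ≤ G.1 y := fun y => by
    refine le_trans (le_of_eq ?_) (hG1 y)
    rw [aA_apply, sqC_apply]; simp; ring
  have hG3' : ∀ y, G.1 y = 2 * K * ‖y‖ ^ 2 - 5 * K * a ^ 2 ∨ ∃ i, G.1 y = (H i).1 y := fun y => by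
    rcases hG3 y with h | ⟨i, -, h⟩
    · left; rw [h, aA_apply, sqC_apply]; simp; ring
    · exact Or.inr ⟨i, h⟩
  have hGle : ∀ y, G.1 y ≤ 2 * K * ‖y‖ ^ 2 := fun y => by
    rcases hG3' y with h | ⟨i, h⟩
    · rw [h]; nlinarith [sq_nonneg a]
    · rw [h, hH]
      have := (hf (y - x i)).2
      nlinarith [sq_nonneg ‖y - x i‖]
  have hGH : ∀ i y, ‖y - x i‖ < 3 / 2 * a → G.1 y = (H i).1 y := by
    intro i y hy
    refine le_antisymm ?_ (hG2 i (Finset.mem_univ _) y)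
    have h1 : 2 * K * ‖y‖ ^ 2 - 9 / 2 * K * a ^ 2 ≤ (H i).1 y := by
      rw [hH]
      have h2 : ‖y - x i‖ ^ 2 ≤ (3 / 2 * a) ^ 2 := by gcongr
      have := (hf (y - x i)).1
      nlinarith
    rcases hG3' y with h | ⟨l, h⟩
    · rw [h]; nlinarith [sq_nonneg a]
    · by_cases hil : l = i
      · rw [h, hil]
      have h2 : 4 * a ≤ ‖x l - x i‖ := by
        have := gridpt_sep hil
        push_cast at this
        rw [ha, mul_one_div]; exact this
      have h3 : 5 / 2 * a ≤ ‖y - x l‖ := by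
        have := norm_sub_le (y - x i) (y - x l)
        rw [sub_sub_sub_cancel_left] at this
        linarith
      have h4 : (5 / 2 * a) ^ 2 ≤ ‖y - x l‖ ^ 2 := by gcongr
      have h5 := (hf (y - x l)).2
      rw [h]
      refine le_trans ?_ h1
      rw [hH]
      nlinarith [sq_nonneg a]
  let φi : I → C_c(Eucl n, ℂ) := fun i => translateCc (x i) φ
  have hφi : ∀ i y, φi i y = φ (y - x i) := fun i y => rfl
  have hsupp : ∀ i, tsupport (φi i) ⊆ Metric.ball (x i) (3 / 2 * a) := by
    intro i
    refine (closure_minimal (t := Metric.closedBall (x i) a) (fun y hy => ?_)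
      Metric.isClosed_closedBall).trans (Metric.closedBall_subset_ball (by linarith))
    rw [mem_closedBall_iff_norm]
    exact hφ _ hy
  -- total mass for each node
  have hmass : ∀ k, ∑ i, ‖(Ψ (aA (H i) (zz k))).1 (φi i)‖ ≤ j k := by
    intro k
    have hGk : ∀ i, (Ψ (aA (H i) (zz k))).1 (φi i) = (Ψ (aA G (zz k))).1 (φi i) := by
      intro i
      refine hloc _ _ _ Metric.isOpen_ball (fun y hy => ?_) _ (hsupp i)
      have e := hGH i y (by rw [← dist_eq_norm]; exact hy)
      rw [aA_apply (H i) (zz k), aA_apply G (zz k), e]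
    simp only [hGk]
    refine phase_sum (R := n * 4 + 1) _ φi (fun y i l hi hl => ?_) (fun i y => hφ1 _) (fun i y hy => ?_) (hj k _ ?_)
    · by_contra hil
      have h2 : 4 * a ≤ ‖x i - x l‖ := by
        have := gridpt_sep hil
        push_cast at this
        rw [ha, mul_one_div]; exact this
      have h3 := hφ _ hi
      have h4 := hφ _ hl
      have := norm_sub_le (y - x l) (y - x i)
      rw [sub_sub_sub_cancel_left] at this
      linarith
    · have h3 := hφ _ hy
      have h4 : ‖x i‖ ≤ n * 4 := gridpt_norm i
      linarith [norm_sub_norm_le y (x i)]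
    · intro y _
      rw [aA_apply, aA_apply, add_sub_add_right_eq_sub, sqC_apply]
      have h1 := hG1' y
      have h2 := hGle y
      have h3 : 5 * K * a ^ 2 < 1 / ((j k : ℝ) + 1) := by
        rw [lt_div_iff₀ (by positivity)]
        have h5 : (j k : ℝ) ≤ ∑ k, (j k : ℝ) :=
          Finset.single_le_sum (f := fun k => (j k : ℝ)) (fun _ _ => Nat.cast_nonneg _) (Finset.mem_univ k)
        have h6 : (m0 : ℝ) ≤ m := by exact_mod_cast hm
        have h7 : a * (m + 1) = 1 := by rw [ha]; field_simp
        have h8 : 5 * (K : ℝ) * (j k + 1) ≤ 5 * K * (∑ k, (j k : ℝ) + 1) := by gcongr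
        have h9 : 5 * (K : ℝ) * (j k + 1) < m + 1 := by linarith
        calc 5 * K * a ^ 2 * (j k + 1) = (5 * K * (j k + 1)) * a * a := by ring
          _ ≤ (5 * K * (j k + 1)) * a * 1 := by gcongr
          _ < (m + 1) * a := by rw [mul_one]; gcongr
          _ = 1 := by linarith
      rw [abs_lt]
      push_cast
      constructor <;> nlinarith [sq_nonneg a]
  have hone : ∀ i, ‖(Ψ (aA f z)).1 φ‖ ≤ ∑ k, ‖(Ψ (aA (H i) (zz k))).1 (φi i)‖ * B k := by
    intro i
    rw [← htr (x i) (aA f z) φ]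
    have e : translateConv (x i) (aA f z) =
        aA (H i) (z.1 + 2 * K * ‖x i‖ ^ 2 - inner ℝ z.2 (x i), z.2 - (4 * K : ℝ) • x i) := by
      rw [aA_add]
      refine Subtype.ext (ContinuousMap.ext fun y => ?_)
      show f.1 (y - x i) + (z.1 + inner ℝ z.2 (y - x i)) = f.1 (y - x i) + _
      simp only [Prod.mk_add_mk, add_sub_cancel, inner_sub_right]
      ring
    rw [e, hint _ (hpol (H i) (translateCc (x i) φ))]
    refine (norm_sum_le _ _).trans (Finset.sum_le_sum fun k _ => ?_)
    rw [norm_mul]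
    exact mul_le_mul_of_nonneg_left (hB k z hz (x i) (gridpt_norm i)) (norm_nonneg _)
  have hcard : (Finset.univ : Finset I).card = (m + 1) ^ n := by simp [I]
  calc ‖(Ψ (aA f z)).1 φ‖ * (m + 1) ^ n = ∑ i : I, ‖(Ψ (aA f z)).1 φ‖ := by
        rw [Finset.sum_const, hcard, nsmul_eq_mul]; push_cast; ring
    _ ≤ ∑ i : I, ∑ k, ‖(Ψ (aA (H i) (zz k))).1 (φi i)‖ * B k := Finset.sum_le_sum fun i _ => hone i
    _ = ∑ k, (∑ i : I, ‖(Ψ (aA (H i) (zz k))).1 (φi i)‖) * B k := by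
        rw [Finset.sum_comm]; simp only [Finset.sum_mul]
    _ ≤ ∑ k, j k * B k := Finset.sum_le_sum fun k _ => mul_le_mul_of_nonneg_right (hmass k) (hB0 k)

def CK {n : ℕ} (K : ℝ≥0) (f : ConvFn n) : Prop :=
  ∀ x, ∃ w : Eucl n, ∀ h, 0 ≤ f.1 (x + h) - f.1 x - inner ℝ w h ∧
    f.1 (x + h) - f.1 x - inner ℝ w h ≤ K * ‖h‖ ^ 2

lemma conv_ext {n : ℕ} {f g : ConvFn n} (h : ∀ x, f.1 x = g.1 x) : f = g :=
  Subtype.ext (ContinuousMap.ext h)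

lemma tr_apply {n : ℕ} (f : ConvFn n) (x y : Eucl n) : (translateConv x f).1 y = f.1 (y - x) := rfl

lemma CK_decomp {n : ℕ} (f : ConvFn n) (x w : Eucl n) :
    f = translateConv x (aA (aA (translateConv (-x) f) (-f.1 x, -w)) (f.1 x, w)) := by
  refine conv_ext fun y => ?_
  simp only [tr_apply, aA_apply, inner_neg_left, sub_neg_eq_add, sub_add_cancel]
  ring

lemma lemM2 {n d : ℕ} {Ψ : ConvFn n → RadonMeasure n} (hΨ : MemPdLV d Ψ)
    (htr : IsTranslationInvariant Ψ) (K : ℝ≥0) (Z : ℝ) :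
    ∃ (C : ℝ) (m0 : ℕ), 0 ≤ C ∧ ∀ m ≥ m0, ∀ f : ConvFn n, (∀ x, 0 ≤ f.1 x ∧ f.1 x ≤ K * ‖x‖ ^ 2) →
      ∀ z : ℝ × Eucl n, ‖z‖ ≤ Z → ‖(Ψ (aA f z)).1 (etaCc m 0)‖ ≤ C := by
  obtain ⟨C, m0, hC, h⟩ := lemM hΨ htr K Z
  obtain ⟨D, hD, hη⟩ := eta_le n
  refine ⟨C * (D + 1), m0, by positivity, fun m hm f hf z hz => ?_⟩
  set s : ℝ := (D + 1) * (m + 1) ^ n with hs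
  have hs0 : 0 < s := by positivity
  have h1 := h m hm f hf z hz ((s⁻¹ : ℂ) • etaCc m 0) (fun x hx => by
    have := etaCc_supp m 0 x (fun h0 => hx (by simp [h0]))
    simpa using this) (fun x => by
    have e : ((s⁻¹ : ℂ) • etaCc m 0) x = ((s⁻¹ * eta m x : ℝ) : ℂ) := by
      simp [etaCc_apply]
    rw [e, Complex.norm_real, Real.norm_of_nonneg (mul_nonneg (inv_nonneg.2 hs0.le) (eta_nonneg m x)),
      inv_mul_le_iff₀ hs0, mul_one]
    refine (hη m x).trans ?_
    rw [hs]; gcongr; linarith)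
  rw [map_smul, smul_eq_mul, norm_mul, norm_inv, Complex.norm_real, Real.norm_of_nonneg hs0.le] at h1
  have h2 : s⁻¹ * (m + 1) ^ n = (D + 1)⁻¹ := by rw [hs]; field_simp
  have h3 : ‖(Ψ (aA f z)).1 (etaCc m 0)‖ * (D + 1)⁻¹ ≤ C := by
    rw [← h2]; linarith
  rwa [← div_eq_mul_inv, div_le_iff₀ (by positivity)] at h3

lemma dens_bound {n d : ℕ} {Ψ : ConvFn n → RadonMeasure n} (hΨ : MemPdLV d Ψ)
    (htr : IsTranslationInvariant Ψ) {K : ℝ≥0} {f : ConvFn n} (hf : CK K f) (R : ℝ) :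
    ∃ (C : ℝ) (m0 : ℕ), 0 ≤ C ∧ ∀ m ≥ m0, ∀ x, ‖x‖ ≤ R → ‖(Ψ f).1 (etaCc m x)‖ ≤ C := by
  obtain ⟨B, hB⟩ := (isCompact_closedBall (0 : Eucl n) (R + 1)).exists_bound_of_continuousOn
    (map_continuous f.1).continuousOn
  obtain ⟨C, m0, hC, h⟩ := lemM2 hΨ htr K (2 * B)
  refine ⟨C, m0, hC, fun m hm x hx => ?_⟩
  obtain ⟨w, hw⟩ := hf x
  rw [CK_decomp f x w, etaCc_tr, htr]
  have hBx : ‖f.1 x‖ ≤ B := hB x (by rw [mem_closedBall_zero_iff]; linarith)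
  refine h m hm _ (fun y => ?_) _ ?_
  · have := hw y
    simp only [tr_apply, aA_apply, inner_neg_left, sub_neg_eq_add]
    rw [add_comm y x]
    constructor <;> linarith
  · refine max_le (by simp only; linarith [norm_nonneg (f.1 x)]) ?_
    simp only
    by_cases hw0 : w = 0
    · rw [hw0, norm_zero]; linarith [norm_nonneg (f.1 x)]
    have hn : ‖w‖ ≠ 0 := norm_ne_zero_iff.2 hw0
    have h1 := (hw (‖w‖⁻¹ • w)).1
    rw [real_inner_smul_right, real_inner_self_eq_norm_sq] at h1
    have h2 : ‖w‖⁻¹ * ‖w‖ ^ 2 = ‖w‖ := by field_simp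
    have h3 : ‖‖w‖⁻¹ • w‖ = 1 := by rw [norm_smul, norm_inv, norm_norm, inv_mul_cancel₀ hn]
    have h4 := hB (x + ‖w‖⁻¹ • w) (by
      rw [mem_closedBall_zero_iff]; exact (norm_add_le _ _).trans (by rw [h3]; linarith))
    have h5 := (abs_le.1 (Real.norm_eq_abs _ ▸ h4)).2
    have h6 := (abs_le.1 (Real.norm_eq_abs _ ▸ hBx)).1
    linarith

lemma lemL {n d : ℕ} {Ψ : ConvFn n → RadonMeasure n} (hΨ : MemPdLV d Ψ)
    (htr : IsTranslationInvariant Ψ) {K : ℝ≥0} {f : ConvFn n} (hf : CK K f) {g : Eucl n → ℂ}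
    (hg : ∀ᵐ x, Tendsto (fun m => (Ψ f).1 (etaCc m x)) atTop (𝓝 (g x))) (φ : C_c(Eucl n, ℂ)) :
    (Ψ f).1 φ = ∫ x, φ x * g x := by
  obtain ⟨R, hR0, hR⟩ := cc_radius φ
  obtain ⟨C, m0, hC, hb⟩ := dens_bound hΨ htr hf R
  refine tendsto_nhds_unique (conv_lemma (Ψ f) φ) ?_
  refine tendsto_integral_filter_of_dominated_convergence (fun x => ‖φ x‖ * C) ?_ ?_ ?_ ?_
  · exact Eventually.of_forall fun m => (φ.continuous.mul (etaμ_cont _ m)).aestronglyMeasurable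
  · filter_upwards [eventually_ge_atTop m0] with m hm
    refine ae_of_all _ fun x => ?_
    rw [norm_mul]
    by_cases hx : φ x = 0
    · simp [hx]
    · exact mul_le_mul_of_nonneg_left (hb m hm x (hR x hx)) (norm_nonneg _)
  · exact ((φ.continuous.integrable_of_hasCompactSupport φ.hasCompactSupport').norm).mul_const _
  · filter_upwards [hg] with x hx
    exact hx.const_mul _

lemma loc_eta {n d : ℕ} {Ψ : ConvFn n → RadonMeasure n} (hΨ : MemPdLV d Ψ)
    (htr : IsTranslationInvariant Ψ) {f q : ConvFn n} {x : Eucl n}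
    (h : ∀ᶠ y in 𝓝 x, f.1 y = (translateConv x q).1 y) :
    ∀ᶠ m in atTop, (Ψ f).1 (etaCc m x) = (Ψ q).1 (etaCc m 0) := by
  obtain ⟨δ, hδ, hb⟩ := Metric.eventually_nhds_iff_ball.1 h
  filter_upwards [(tendsto_one_div_add_atTop_nhds_zero_nat (𝕜 := ℝ)).eventually (gt_mem_nhds hδ)] with m hm
  rw [← htr x q, ← etaCc_tr]
  refine hΨ.1 _ _ _ Metric.isOpen_ball hb _ ?_
  refine (closure_minimal (t := Metric.closedBall x (1 / (m + 1))) (fun y hy => ?_)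
    Metric.isClosed_closedBall).trans (Metric.closedBall_subset_ball hm)
  rw [mem_closedBall_iff_norm]
  exact etaCc_supp m x y hy

/-- the quadratic form -/
def qf {n : ℕ} (A : Matrix (Fin n) (Fin n) ℝ) (x : Eucl n) : ℝ := 2⁻¹ * (⇑x ⬝ᵥ A *ᵥ ⇑x)

def mv {n : ℕ} (A : Matrix (Fin n) (Fin n) ℝ) (x : Eucl n) : Eucl n := WithLp.toLp 2 (A *ᵥ ⇑x)

lemma inner_dot {n : ℕ} (x y : Eucl n) : inner ℝ x y = ⇑x ⬝ᵥ ⇑y := by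
  rw [PiLp.inner_apply, dotProduct]
  refine Finset.sum_congr rfl fun i _ => ?_
  simp [mul_comm]

lemma qf_add {n : ℕ} {A : Matrix (Fin n) (Fin n) ℝ} (hA : A.IsSymm) (x y : Eucl n) :
    qf A (x + y) = qf A x + inner ℝ (mv A x) y + qf A y := by
  have h : (⇑x ⬝ᵥ A *ᵥ ⇑y) = (A *ᵥ ⇑x) ⬝ᵥ ⇑y := by
    rw [dotProduct_mulVec, ← mulVec_transpose, hA.eq]
  rw [inner_dot]
  simp only [qf, mv, WithLp.ofLp_add, mulVec_add, dotProduct_add, add_dotProduct]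
  rw [h, dotProduct_comm (⇑y) (A *ᵥ ⇑x)]
  ring

lemma qf_smul {n : ℕ} (A : Matrix (Fin n) (Fin n) ℝ) (t : ℝ) (x : Eucl n) :
    qf A (t • x) = t ^ 2 * qf A x := by
  simp only [qf, WithLp.ofLp_smul, mulVec_smul, dotProduct_smul, smul_dotProduct, smul_eq_mul]
  ring

lemma qf_cont {n : ℕ} (A : Matrix (Fin n) (Fin n) ℝ) : Continuous (qf A) := by
  unfold qf dotProduct mulVec dotProduct
  fun_prop

lemma mv_cont {n : ℕ} (A : Matrix (Fin n) (Fin n) ℝ) : Continuous (mv A) := by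
  have : Continuous fun x : Eucl n => A *ᵥ ⇑x := by
    unfold mulVec dotProduct
    fun_prop
  exact (PiLp.continuous_toLp 2 _).comp this

lemma qf_nonneg {n : ℕ} {A : Matrix (Fin n) (Fin n) ℝ} (hA : A.PosSemidef) (x : Eucl n) : 0 ≤ qf A x := by
  have := hA.dotProduct_mulVec_nonneg ⇑x
  rw [star_trivial] at this
  unfold qf; positivity

lemma psd_symm {n : ℕ} {A : Matrix (Fin n) (Fin n) ℝ} (hA : A.PosSemidef) : A.IsSymm := by
  have := hA.isHermitian
  rwa [Matrix.IsHermitian, Matrix.conjTranspose_eq_transpose_of_trivial] at this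

lemma convex_of_sub {n : ℕ} {f : Eucl n → ℝ} (h : ∀ x, ∃ w : Eucl n, ∀ y, f x + inner ℝ w (y - x) ≤ f y) :
    ConvexOn ℝ Set.univ f := by
  refine ⟨convex_univ, fun x _ y _ a b ha hb hab => ?_⟩
  obtain ⟨w, hw⟩ := h (a • x + b • y)
  have h1 := mul_le_mul_of_nonneg_left (hw x) ha
  have h2 := mul_le_mul_of_nonneg_left (hw y) hb
  simp only [inner_sub_right, inner_add_right, real_inner_smul_right, smul_eq_mul] at *
  have e : b = 1 - a := by linarith
  subst e
  nlinarith

def qC {n : ℕ} (A : Matrix (Fin n) (Fin n) ℝ) (hA : A.PosSemidef) : ConvFn n :=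
  ⟨⟨qf A, qf_cont A⟩, convex_of_sub fun x => ⟨mv A x, fun y => by
    have := qf_add (psd_symm hA) x (y - x)
    rw [add_sub_cancel] at this
    show qf A x + _ ≤ qf A y
    linarith [qf_nonneg hA (y - x)]⟩⟩

lemma qC_apply {n : ℕ} (A : Matrix (Fin n) (Fin n) ℝ) (hA : A.PosSemidef) (x : Eucl n) :
    (qC A hA).1 x = qf A x := rfl

/-- jet of the quadratic at a point -/
def tau {n : ℕ} (A : Matrix (Fin n) (Fin n) ℝ) (z : ℝ × Eucl n) (x : Eucl n) : ℝ × Eucl n :=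
  (qf A x + (z.1 + inner ℝ z.2 x), mv A x + z.2)

lemma tau_cont {n : ℕ} (A : Matrix (Fin n) (Fin n) ℝ) (z : ℝ × Eucl n) : Continuous (tau A z) := by
  have := qf_cont A
  have := mv_cont A
  unfold tau
  fun_prop

lemma q_tau {n : ℕ} {A : Matrix (Fin n) (Fin n) ℝ} (hA : A.PosSemidef) (z : ℝ × Eucl n) (x : Eucl n) :
    aA (qC A hA) z = translateConv x (aA (qC A hA) (tau A z x)) := by
  refine conv_ext fun y => ?_
  simp only [tr_apply, aA_apply, qC_apply, tau]
  have := qf_add (psd_symm hA) x (y - x)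
  rw [add_sub_cancel] at this
  rw [this, inner_add_left]
  simp only [inner_sub_right]
  ring

lemma qf_le {n : ℕ} (A : Matrix (Fin n) (Fin n) ℝ) {c : ℝ≥0} (h : ∀ i j, |A i j| ≤ c) (x : Eucl n) :
    qf A x ≤ (n ^ 2 * c : ℝ≥0) * ‖x‖ ^ 2 := by
  have h1 : ∀ i j, x i * (A i j * x j) ≤ c * ‖x‖ ^ 2 := fun i j => by
    refine (le_abs_self _).trans ?_
    rw [abs_mul, abs_mul]
    calc |x i| * (|A i j| * |x j|) ≤ ‖x‖ * (c * ‖x‖) := by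
          gcongr
          · exact coord_le x i
          · exact h i j
          · exact coord_le x j
      _ = c * ‖x‖ ^ 2 := by ring
  have h2 : (⇑x ⬝ᵥ A *ᵥ ⇑x) ≤ n ^ 2 * (c * ‖x‖ ^ 2) := by
    simp only [dotProduct, mulVec, Finset.mul_sum]
    refine (Finset.sum_le_sum fun i _ => Finset.sum_le_sum fun j _ => h1 i j).trans (le_of_eq ?_)
    simp; ring
  have h3 : 0 ≤ (n : ℝ) ^ 2 * (c * ‖x‖ ^ 2) := by positivity
  unfold qf
  push_cast
  linarith

lemma qf_bound {n : ℕ} (A : Matrix (Fin n) (Fin n) ℝ) : ∃ K : ℝ≥0, ∀ h : Eucl n, qf A h ≤ K * ‖h‖ ^ 2 := by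
  obtain ⟨c, hc⟩ : ∃ c : ℝ≥0, ∀ i j, |A i j| ≤ c := by
    refine ⟨∑ i, ∑ j, ‖A i j‖₊, fun i j => ?_⟩
    have h1 : ‖A i j‖₊ ≤ ∑ i, ∑ j, ‖A i j‖₊ :=
      (Finset.single_le_sum (f := fun j => ‖A i j‖₊) (fun _ _ => zero_le) (Finset.mem_univ j)).trans
        (Finset.single_le_sum (f := fun i => ∑ j, ‖A i j‖₊) (fun _ _ => zero_le) (Finset.mem_univ i))
    exact_mod_cast h1
  exact ⟨n ^ 2 * c, qf_le A hc⟩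

lemma CK_q {n : ℕ} {A : Matrix (Fin n) (Fin n) ℝ} (hA : A.PosSemidef) : ∃ K, ∀ z, CK K (aA (qC A hA) z) := by
  obtain ⟨K, hK⟩ := qf_bound A
  refine ⟨K, fun z x => ⟨mv A x + z.2, fun h => ?_⟩⟩
  have e : (aA (qC A hA) z).1 (x + h) - (aA (qC A hA) z).1 x - inner ℝ (mv A x + z.2) h = qf A h := by
    simp only [aA_apply, qC_apply, qf_add (psd_symm hA), inner_add_left, inner_add_right]
    ring
  rw [e]
  exact ⟨qf_nonneg hA h, hK h⟩

lemma cc_uniq {n : ℕ} {u v : Eucl n → ℂ} (hu : Continuous u) (hv : Continuous v)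
    (h : ∀ φ : C_c(Eucl n, ℂ), ∫ x, φ x * u x = ∫ x, φ x * v x) : u = v := by
  refine (Continuous.ae_eq_iff_eq volume hu hv).1 ?_
  refine ae_eq_of_integral_contDiff_smul_eq hu.locallyIntegrable hv.locallyIntegrable fun g hg hgc => ?_
  have := h ⟨⟨fun x => (g x : ℂ), Complex.continuous_ofReal.comp hg.continuous⟩,
    hgc.comp_left (g := Complex.ofReal) (by simp)⟩
  simpa using this

lemma tau_zero {n : ℕ} (A : Matrix (Fin n) (Fin n) ℝ) (z : ℝ × Eucl n) : tau A z 0 = z := by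
  simp [tau, qf, mv]

lemma quad_eta {n : ℕ} {Ψ : ConvFn n → RadonMeasure n} (htr : IsTranslationInvariant Ψ)
    {A : Matrix (Fin n) (Fin n) ℝ} (hA : A.PosSemidef) (z : ℝ × Eucl n) (x : Eucl n) (m : ℕ) :
    (Ψ (aA (qC A hA) z)).1 (etaCc m x) = (Ψ (aA (qC A hA) (tau A z x))).1 (etaCc m 0) := by
  rw [q_tau hA z x, etaCc_tr, htr]

lemma quad_dens {n d : ℕ} {Ψ : ConvFn n → RadonMeasure n} (hΨ : MemPdLV d Ψ)
    (htr : IsTranslationInvariant Ψ) {A : Matrix (Fin n) (Fin n) ℝ} (hA : A.PosSemidef) :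
    ∃ F ∈ PolyV n d, ∀ z, Tendsto (fun m => (Ψ (aA (qC A hA) z)).1 (etaCc m 0)) atTop (𝓝 (F z)) := by
  obtain ⟨K, hK⟩ := CK_q hA
  obtain ⟨N, zz, b, hb, hint⟩ := interp n d
  have hpol := (polyDeg_iff Ψ).1 hΨ.2.2
  set p : ℕ → ℝ × Eucl n → ℂ := fun m z => (Ψ (aA (qC A hA) z)).1 (etaCc m 0) with hp
  have hpV : ∀ m, p m ∈ PolyV n d := fun m => hpol _ _
  have hex : ∀ g : Ultrafilter ℕ, (g : Filter ℕ) ≤ atTop → ∃ L : ℝ × Eucl n → ℂ,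
      ∀ z, Tendsto (fun m => p m z) g (𝓝 (L z)) := by
    intro g hg
    have : ∀ z, ∃ L : ℂ, Tendsto (fun m => p m z) g (𝓝 L) := fun z => by
      obtain ⟨C, m0, -, h⟩ := dens_bound hΨ htr (hK z) 0
      obtain ⟨L, -, hL⟩ := (isCompact_closedBall (0 : ℂ) C).ultrafilter_le_nhds (g.map fun m => p m z) (by
        rw [Filter.le_principal_iff]
        refine hg (mem_map.2 ?_)
        filter_upwards [eventually_ge_atTop m0] with m hm
        refine mem_closedBall_zero_iff.2 ?_
        exact h m hm 0 (by simp))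
      exact ⟨L, hL⟩
    choose L hL using this
    exact ⟨L, hL⟩
  have key : ∀ g : Ultrafilter ℕ, (g : Filter ℕ) ≤ atTop → ∀ L : ℝ × Eucl n → ℂ,
      (∀ z, Tendsto (fun m => p m z) g (𝓝 (L z))) → L ∈ PolyV n d ∧
      ∀ z (φ : C_c(Eucl n, ℂ)), ∫ x, φ x * L (tau A z x) = (Ψ (aA (qC A hA) z)).1 φ := by
    intro g hg L hL
    have hLs : L = ∑ k, L (zz k) • b k := by
      ext z
      refine tendsto_nhds_unique (hL z) ?_
      simp only [hint _ (hpV _) z, Finset.sum_apply, Pi.smul_apply, smul_eq_mul]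
      exact tendsto_finsetSum _ fun k _ => (hL (zz k)).mul_const _
    have hs : ∀ (c : Fin N → ℂ) (z : ℝ × Eucl n) (φ : C_c(Eucl n, ℂ)),
        ∫ x, φ x * (∑ k, c k * b k (tau A z x)) = ∑ k, c k * ∫ x, φ x * b k (tau A z x) := by
      intro c z φ
      simp only [Finset.mul_sum]
      rw [integral_finsetSum]
      · refine Finset.sum_congr rfl fun k _ => ?_
        rw [← integral_const_mul]
        refine integral_congr_ae (ae_of_all _ fun x => ?_)
        ring
      · intro k _
        exact (φ.continuous.mul (continuous_const.mul ((PolyV_continuous (hb k)).comp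
          (tau_cont A z)))).integrable_of_hasCompactSupport φ.hasCompactSupport'.mul_right
    refine ⟨hLs ▸ Submodule.sum_mem _ fun k _ => Submodule.smul_mem _ _ (hb k), fun z φ => ?_⟩
    refine tendsto_nhds_unique ?_ ((conv_lemma (Ψ (aA (qC A hA) z)) φ).mono_left hg)
    have e : ∀ m, ∫ x, φ x * (Ψ (aA (qC A hA) z)).1 (etaCc m x) =
        ∑ k, p m (zz k) * ∫ x, φ x * b k (tau A z x) := by
      intro m
      rw [← hs]
      refine integral_congr_ae (ae_of_all _ fun x => ?_)
      simp only
      rw [quad_eta htr hA, ← hint _ (hpV m)]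
    simp only [e]
    rw [hLs]
    simp only [Finset.sum_apply, Pi.smul_apply, smul_eq_mul]
    rw [hs]
    exact tendsto_finsetSum _ fun k _ => (hL (zz k)).mul_const _
  obtain ⟨F, hF⟩ := hex (Ultrafilter.of atTop) (Ultrafilter.of_le atTop)
  obtain ⟨hFV, hF2⟩ := key _ (Ultrafilter.of_le atTop) F hF
  refine ⟨F, hFV, fun z => tendsto_iff_ultrafilter _ _ _ |>.2 fun g hg => ?_⟩
  obtain ⟨L, hL⟩ := hex g hg
  obtain ⟨hLV, hL2⟩ := key g hg L hL
  have : (fun x => F (tau A z x)) = fun x => L (tau A z x) :=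
    cc_uniq ((PolyV_continuous hFV).comp (tau_cont A z)) ((PolyV_continuous hLV).comp (tau_cont A z))
      fun φ => by rw [hF2 z φ, hL2 z φ]
  have := congrFun this 0
  simp only [tau_zero] at this
  rw [this]
  exact hL z

lemma quad_count {a : ℝ} (ha : a ≠ 0) (b c : ℝ) : {t : ℝ | a + b * t + c * t ^ 2 = 0}.Countable := by
  set p : Polynomial ℝ := Polynomial.C a + Polynomial.C b * Polynomial.X + Polynomial.C c * Polynomial.X ^ 2
  have he : ∀ t, p.eval t = a + b * t + c * t ^ 2 := fun t => by simp [p]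
  have hp : p ≠ 0 := fun h => ha (by simpa [h] using (he 0).symm)
  refine (p.roots.toFinset.finite_toSet.subset fun t ht => ?_).countable
  have ht' : a + b * t + c * t ^ 2 = 0 := ht
  simp [hp, Polynomial.IsRoot, he, ht']

lemma null_zero {n : ℕ} {h : Eucl n → ℝ} (hc : Continuous h) (x1 : Eucl n)
    (hf : ∀ v, {t : ℝ | h (x1 + t • v) = 0}.Countable) : ∀ᵐ x, h x ≠ 0 := by
  let S : Set (Eucl n × ℝ) := {p | h (x1 + p.2 • p.1) = 0}
  have hS : MeasurableSet S := (isClosed_eq (by fun_prop) continuous_const).measurableSet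
  have h0 : (volume.prod volume) S = 0 := by
    rw [Measure.measure_prod_null hS]
    exact ae_of_all _ fun x => (hf x).measure_zero volume
  rw [Measure.prod_apply_symm hS, lintegral_eq_zero_iff (measurable_measure_prodMk_right hS)] at h0
  have h1 : ∀ᵐ t : ℝ, t ≠ 0 := by simp [ae_iff]
  obtain ⟨t, ht, ht0⟩ := (h0.and h1).exists
  have e : ((fun x => (x, t)) ⁻¹' S) = (t • ·) ⁻¹' ((x1 + ·) ⁻¹' {x | h x = 0}) := rfl
  replace ht : volume ((fun x => (x, t)) ⁻¹' S) = 0 := ht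
  rw [e, Measure.addHaar_preimage_smul _ ht0, measure_preimage_add] at ht
  rw [ae_iff]
  simp only [ne_eq, not_not]
  have h3 : ENNReal.ofReal |(t ^ Module.finrank ℝ (Eucl n))⁻¹| ≠ 0 := by
    rw [ne_eq, ENNReal.ofReal_eq_zero, not_le]
    positivity
  exact (mul_eq_zero.1 ht).resolve_left h3

lemma ae_inner_ne {n : ℕ} {ξ : Eucl n} (hξ : ξ ≠ 0) (r : ℝ) : ∀ᵐ x, inner ℝ ξ x ≠ r := by
  have hn : inner ℝ ξ ξ ≠ 0 := by simpa using hξ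
  have := null_zero (h := fun x => inner ℝ ξ x - r) (by fun_prop) (((r + 1) / inner ℝ ξ ξ) • ξ) (fun v => by
    convert quad_count (one_ne_zero) (inner ℝ ξ v) 0 using 3 with t
    rw [inner_add_right, real_inner_smul_right, real_inner_smul_right, div_mul_cancel₀ _ hn]
    ring_nf)
  filter_upwards [this] with x hx h
  exact hx (by rw [h, sub_self])

lemma ridge {W : ℝ → ℝ} (hW : Continuous W) (hm : Monotone W) (hL : ∀ s t, |W s - W t| ≤ |s - t|) (t u : ℝ) :
    0 ≤ (∫ s in (0 : ℝ)..(t + u), W s) - (∫ s in (0 : ℝ)..t, W s) - W t * u ∧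
    (∫ s in (0 : ℝ)..(t + u), W s) - (∫ s in (0 : ℝ)..t, W s) - W t * u ≤ u ^ 2 := by
  have e : (∫ s in (0 : ℝ)..(t + u), W s) - (∫ s in (0 : ℝ)..t, W s) - W t * u =
      ∫ s in t..(t + u), (W s - W t) := by
    rw [intervalIntegral.integral_interval_sub_left (hW.intervalIntegrable _ _) (hW.intervalIntegrable _ _),
      intervalIntegral.integral_sub (hW.intervalIntegrable _ _) (by simp), intervalIntegral.integral_const]
    simp; ring
  rw [e]
  constructor
  · rcases le_total 0 u with hu | hu
    · exact intervalIntegral.integral_nonneg (by linarith) fun s hs => sub_nonneg.2 (hm hs.1)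
    · rw [intervalIntegral.integral_symm, ← intervalIntegral.integral_neg]
      exact intervalIntegral.integral_nonneg (by linarith) fun s hs => by
        have := hm hs.2; linarith
  · refine (le_abs_self _).trans ?_
    have := intervalIntegral.norm_integral_le_of_norm_le_const (a := t) (b := t + u) (C := |u|)
      (f := fun s => W s - W t) (fun s hs => by
        rw [Real.norm_eq_abs]
        refine (hL s t).trans ?_
        have h1 := Set.uIoc_subset_uIcc hs
        have := Set.abs_sub_left_of_mem_uIcc h1
        rwa [add_sub_cancel_left] at this)
    rw [Real.norm_eq_abs, add_sub_cancel_left, abs_mul_abs_self] at this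
    linarith

lemma ridge_loc {W : ℝ → ℝ} (hW : Continuous W) {t c δ : ℝ} (h : ∀ s, |s - t| < δ → W s = W t + c * (s - t))
    {u : ℝ} (hu : |u| < δ) :
    (∫ s in (0 : ℝ)..(t + u), W s) = (∫ s in (0 : ℝ)..t, W s) + W t * u + c / 2 * u ^ 2 := by
  have e : (∫ s in (0 : ℝ)..(t + u), W s) - (∫ s in (0 : ℝ)..t, W s) = ∫ s in t..(t + u), W s :=
    intervalIntegral.integral_interval_sub_left (hW.intervalIntegrable _ _) (hW.intervalIntegrable _ _)
  have e2 : ∫ s in t..(t + u), W s = ∫ s in t..(t + u), (W t + c * (s - t)) := by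
    refine intervalIntegral.integral_congr fun s hs => h s (lt_of_le_of_lt ?_ hu)
    have := Set.abs_sub_left_of_mem_uIcc hs
    rwa [add_sub_cancel_left] at this
  rw [e2, intervalIntegral.integral_add (by simp) (by
    exact (Continuous.intervalIntegrable (by fun_prop) _ _)), intervalIntegral.integral_const_mul,
    intervalIntegral.integral_sub (by simp) (by simp)] at e
  simp at e
  linarith

def DD (t : ℝ) : ℝ := |t - round t|

lemma DD_lip (s t : ℝ) : |DD s - DD t| ≤ |s - t| := by
  have h : ∀ s t, DD s ≤ DD t + |s - t| := fun s t => by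
    refine (round_le s (round t)).trans ?_
    have := abs_add_le (s - t) (t - round t)
    rw [sub_add_sub_cancel] at this
    unfold DD; linarith
  rw [abs_le]
  have h1 := h s t
  have h2 := h t s
  rw [abs_sub_comm] at h2
  constructor <;> linarith

lemma DD_eq {s : ℝ} {k : ℤ} (h : |s - k| ≤ 1 / 2) : DD s = |s - k| := by
  refine le_antisymm (round_le s k) ?_
  by_cases hk : round s = k
  · rw [← hk]; exact le_rfl
  have h1 : (1 : ℝ) ≤ |(round s : ℝ) - k| := by
    exact_mod_cast Int.one_le_abs (sub_ne_zero.2 hk)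
  have := abs_add_le ((round s : ℝ) - s) (s - k)
  rw [sub_add_sub_cancel, abs_sub_comm (round s : ℝ) s] at this
  unfold DD; linarith

lemma DD_loc {t : ℝ} (ht : ∀ k : ℤ, 2 * t ≠ k) : ∃ c : ℝ, (c = 1 ∨ c = -1) ∧ ∃ δ > 0, ∀ s, |s - t| < δ →
    DD s = DD t + c * (s - t) := by
  set k := round t
  have h1 : |t - k| ≤ 1 / 2 := abs_sub_round t
  have h0 : t - k ≠ 0 := fun h => ht (2 * k) (by push_cast; linarith)
  have ha : t - k ≠ 1 / 2 := fun h => ht (2 * k + 1) (by push_cast; linarith)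
  have hb : t - k ≠ -(1 / 2) := fun h => ht (2 * k - 1) (by push_cast; linarith)
  rw [abs_le] at h1
  have h2 := lt_of_le_of_ne h1.1 hb.symm
  have h3 := lt_of_le_of_ne h1.2 ha
  rcases lt_or_gt_of_ne h0 with h | h
  · refine ⟨-1, Or.inr rfl, min (-(t - k)) (t - k + 1 / 2), lt_min (by linarith) (by linarith), fun s hs => ?_⟩
    obtain ⟨h4, h5⟩ := lt_min_iff.1 hs
    rw [abs_lt] at h4 h5
    have hs0 : s - k < 0 := by linarith
    rw [DD_eq (k := k) (by rw [abs_of_neg hs0]; linarith), DD_eq (k := k) (abs_le.2 h1), abs_of_neg hs0,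
      abs_of_neg h]
    ring
  · refine ⟨1, Or.inl rfl, min (t - k) (1 / 2 - (t - k)), lt_min (by linarith) (by linarith), fun s hs => ?_⟩
    obtain ⟨h4, h5⟩ := lt_min_iff.1 hs
    rw [abs_lt] at h4 h5
    have hs0 : 0 < s - k := by linarith
    rw [DD_eq (k := k) (by rw [abs_of_pos hs0]; linarith), DD_eq (k := k) (abs_le.2 h1), abs_of_pos hs0,
      abs_of_pos h]
    ring

/-- the oscillating slope -/
def WW (σ : ℝ) (m : ℕ) (t : ℝ) : ℝ := (t + σ * (DD ((m + 1) * t) / (m + 1))) / 2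

lemma WW_diff {σ : ℝ} (hσ : |σ| = 1) (m : ℕ) (s t : ℝ) :
    |WW σ m s - WW σ m t - (s - t) / 2| ≤ |s - t| / 2 := by
  have e : WW σ m s - WW σ m t - (s - t) / 2 =
      σ * ((DD ((m + 1) * s) - DD ((m + 1) * t)) / (m + 1)) / 2 := by unfold WW; ring
  have hm : (0 : ℝ) < m + 1 := by positivity
  rw [e, abs_div, abs_mul, hσ, abs_div, abs_of_pos hm, one_mul, abs_two]
  have := DD_lip ((m + 1) * s) ((m + 1) * t)
  rw [← mul_sub, abs_mul, abs_of_pos hm] at this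
  have : |DD ((m + 1) * s) - DD ((m + 1) * t)| / (m + 1) ≤ |s - t| := by
    rw [div_le_iff₀ hm]; linarith
  linarith

lemma WW_lip {σ : ℝ} (hσ : |σ| = 1) (m : ℕ) (s t : ℝ) : |WW σ m s - WW σ m t| ≤ |s - t| := by
  have h := WW_diff hσ m s t
  rw [abs_le] at h ⊢
  rcases abs_cases (s - t) with ⟨h1, h2⟩ | ⟨h1, h2⟩ <;> rw [h1] at h ⊢ <;> constructor <;> linarith

lemma WW_mono {σ : ℝ} (hσ : |σ| = 1) (m : ℕ) : Monotone (WW σ m) := by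
  intro t s hst
  have h := WW_diff hσ m s t
  rw [abs_of_nonneg (sub_nonneg.2 hst), abs_le] at h
  linarith

lemma WW_cont {σ : ℝ} (hσ : |σ| = 1) (m : ℕ) : Continuous (WW σ m) :=
  (LipschitzWith.of_dist_le_mul (K := 1) fun s t => by
    simpa [Real.dist_eq] using WW_lip hσ m s t).continuous

lemma WW_near {σ : ℝ} (hσ : |σ| = 1) (m : ℕ) (t : ℝ) : |WW σ m t - t / 2| ≤ 1 / (m + 1) := by
  have e : WW σ m t - t / 2 = σ * (DD ((m + 1) * t) / (m + 1)) / 2 := by unfold WW; ring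
  have hm : (0 : ℝ) < m + 1 := by positivity
  have h1 : |DD ((m + 1) * t)| ≤ 1 / 2 := by
    unfold DD; rw [abs_abs]; exact abs_sub_round _
  rw [e, abs_div, abs_mul, hσ, one_mul, abs_div, abs_of_pos hm, abs_two, div_div, div_le_div_iff₀ (by positivity) hm]
  nlinarith

lemma WW_loc (m : ℕ) {t : ℝ} (ht : ∀ k : ℤ, 2 * ((m + 1) * t) ≠ k) : ∃ c : ℝ, (c = 1 ∨ c = 0) ∧ ∃ δ > 0,
    ∀ s, |s - t| < δ → WW 1 m s = WW 1 m t + c * (s - t) ∧ WW (-1) m s = WW (-1) m t + (1 - c) * (s - t) := by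
  obtain ⟨c, hc, δ, hδ, h⟩ := DD_loc ht
  have hm : (0 : ℝ) < m + 1 := by positivity
  refine ⟨(1 + c) / 2, by rcases hc with rfl | rfl <;> norm_num, δ / (m + 1), by positivity, fun s hs => ?_⟩
  have := h ((m + 1) * s) (by
    rw [← mul_sub, abs_mul, abs_of_pos hm]
    rw [lt_div_iff₀ hm] at hs; linarith)
  unfold WW
  rw [this]
  constructor <;> field_simp <;> ring

def Dens {n : ℕ} (d : ℕ) (Ψ : ConvFn n → RadonMeasure n) {A : Matrix (Fin n) (Fin n) ℝ} (hA : A.PosSemidef)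
    (F : ℝ × Eucl n → ℂ) : Prop :=
  F ∈ PolyV n d ∧ ∀ z, Tendsto (fun m => (Ψ (aA (qC A hA) z)).1 (etaCc m 0)) atTop (𝓝 (F z))

lemma quad_rep {n d : ℕ} {Ψ : ConvFn n → RadonMeasure n} (hΨ : MemPdLV d Ψ)
    (htr : IsTranslationInvariant Ψ) {A : Matrix (Fin n) (Fin n) ℝ} (hA : A.PosSemidef) {F : ℝ × Eucl n → ℂ}
    (hF : Dens d Ψ hA F) (z : ℝ × Eucl n) (φ : C_c(Eucl n, ℂ)) :
    (Ψ (aA (qC A hA) z)).1 φ = ∫ x, φ x * F (tau A z x) := by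
  obtain ⟨K, hK⟩ := CK_q hA
  refine lemL hΨ htr (hK z) (ae_of_all _ fun x => ?_) φ
  exact (hF.2 _).congr fun m => (quad_eta htr hA z x m).symm

lemma qf_vec {n : ℕ} (A : Matrix (Fin n) (Fin n) ℝ) (c : ℝ) (ξ x : Eucl n) :
    qf (A + c • vecMulVec ⇑ξ ⇑ξ) x = qf A x + c / 2 * inner ℝ ξ x ^ 2 := by
  rw [inner_dot]
  simp only [qf, add_mulVec, smul_mulVec, vecMulVec_mulVec, dotProduct_add, dotProduct_smul,
    smul_eq_mul, op_smul_eq_smul]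
  rw [dotProduct_comm ⇑x ⇑ξ]
  ring

lemma mv_vec {n : ℕ} (A : Matrix (Fin n) (Fin n) ℝ) (c : ℝ) (ξ x : Eucl n) :
    mv (A + c • vecMulVec ⇑ξ ⇑ξ) x = mv A x + (c * inner ℝ ξ x) • ξ := by
  rw [inner_dot]
  ext i
  simp only [mv, add_mulVec, smul_mulVec, vecMulVec_mulVec, op_smul_eq_smul, PiLp.add_apply,
    PiLp.smul_apply, Pi.add_apply, Pi.smul_apply, smul_eq_mul]
  ring

def HH (σ : ℝ) (m : ℕ) (t : ℝ) : ℝ := ∫ s in (0 : ℝ)..t, WW σ m s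

lemma HH_near {σ : ℝ} (hσ : |σ| = 1) (m : ℕ) (t : ℝ) : |HH σ m t - t ^ 2 / 4| ≤ 1 / (m + 1) * |t| := by
  have e : HH σ m t - t ^ 2 / 4 = ∫ s in (0 : ℝ)..t, (WW σ m s - s / 2) := by
    rw [intervalIntegral.integral_sub ((WW_cont hσ m).intervalIntegrable _ _) (by
      exact (Continuous.intervalIntegrable (by fun_prop) _ _)), intervalIntegral.integral_div]
    simp [HH]; ring
  have := intervalIntegral.norm_integral_le_of_norm_le_const (a := 0) (b := t) (C := 1 / ((m : ℝ) + 1))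
      (f := fun s => WW σ m s - s / 2) (fun s hs => WW_near hσ m s)
  rw [sub_zero] at this
  rwa [e, ← Real.norm_eq_abs]

lemma HH_cont {σ : ℝ} (hσ : |σ| = 1) (m : ℕ) : Continuous (HH σ m) :=
  intervalIntegral.continuous_primitive (fun a b => (WW_cont hσ m).intervalIntegrable a b) 0

lemma lam_step {n : ℕ} {A : Matrix (Fin n) (Fin n) ℝ} (hA : A.IsSymm) (ξ : Eucl n) (σ : ℝ) (m : ℕ)
    (x h : Eucl n) :
    (qf A (x + h) + HH σ m (inner ℝ ξ (x + h))) - (qf A x + HH σ m (inner ℝ ξ x)) -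
      inner ℝ (mv A x + WW σ m (inner ℝ ξ x) • ξ) h = qf A h + (HH σ m (inner ℝ ξ x + inner ℝ ξ h) -
        HH σ m (inner ℝ ξ x) - WW σ m (inner ℝ ξ x) * inner ℝ ξ h) := by
  rw [qf_add hA, inner_add_left, inner_add_right, real_inner_smul_left]
  ring

def lamC {n : ℕ} {A : Matrix (Fin n) (Fin n) ℝ} (hA : A.PosSemidef) (ξ : Eucl n) {σ : ℝ} (hσ : |σ| = 1)
    (m : ℕ) : ConvFn n :=
  ⟨⟨fun x => qf A x + HH σ m (inner ℝ ξ x), (qf_cont A).add ((HH_cont hσ m).comp (by fun_prop))⟩,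
    convex_of_sub fun x => ⟨mv A x + WW σ m (inner ℝ ξ x) • ξ, fun y => by
      have h1 := lam_step (psd_symm hA) ξ σ m x (y - x)
      rw [add_sub_cancel] at h1
      have h2 := (ridge (WW_cont hσ m) (WW_mono hσ m) (WW_lip hσ m) (inner ℝ ξ x) (inner ℝ ξ (y - x))).1
      have h3 := qf_nonneg hA (y - x)
      show qf A x + HH σ m (inner ℝ ξ x) + _ ≤ qf A y + HH σ m (inner ℝ ξ y)
      unfold HH at *
      linarith⟩⟩

lemma lamC_apply {n : ℕ} {A : Matrix (Fin n) (Fin n) ℝ} (hA : A.PosSemidef) (ξ : Eucl n) {σ : ℝ} (hσ : |σ| = 1)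
    (m : ℕ) (x : Eucl n) : (lamC hA ξ hσ m).1 x = qf A x + HH σ m (inner ℝ ξ x) := rfl

lemma CK_aA {n : ℕ} {K : ℝ≥0} {f : ConvFn n} (h : CK K f) (z : ℝ × Eucl n) : CK K (aA f z) := by
  intro x
  obtain ⟨w, hw⟩ := h x
  refine ⟨w + z.2, fun y => ?_⟩
  have := hw y
  simp only [aA_apply, inner_add_left, inner_add_right]
  constructor <;> linarith

lemma CK_lam {n : ℕ} {A : Matrix (Fin n) (Fin n) ℝ} (hA : A.PosSemidef) (ξ : Eucl n) {σ : ℝ} (hσ : |σ| = 1)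
    (m : ℕ) : ∃ K, CK K (lamC hA ξ hσ m) := by
  obtain ⟨K, hK⟩ := qf_bound A
  refine ⟨K + ‖ξ‖₊ ^ 2, fun x => ⟨mv A x + WW σ m (inner ℝ ξ x) • ξ, fun h => ?_⟩⟩
  rw [lamC_apply, lamC_apply, lam_step (psd_symm hA)]
  have h2 := ridge (WW_cont hσ m) (WW_mono hσ m) (WW_lip hσ m) (inner ℝ ξ x) (inner ℝ ξ h)
  have h3 := qf_nonneg hA h
  have h4 := hK h
  have h5 : inner ℝ ξ h ^ 2 ≤ ‖ξ‖ ^ 2 * ‖h‖ ^ 2 := by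
    rw [← mul_pow]; exact sq_le_sq' (by have := (abs_le.1 (abs_real_inner_le_norm ξ h)).1; linarith)
      (real_inner_le_norm _ _)
  unfold HH
  push_cast
  constructor
  · linarith
  · linarith

/-- jet of the laminate -/
def jet {n : ℕ} (A : Matrix (Fin n) (Fin n) ℝ) (ξ : Eucl n) (σ : ℝ) (m : ℕ) (z : ℝ × Eucl n) (x : Eucl n) :
    ℝ × Eucl n :=
  (qf A x + HH σ m (inner ℝ ξ x) + (z.1 + inner ℝ z.2 x), mv A x + WW σ m (inner ℝ ξ x) • ξ + z.2)

lemma jet_near {n : ℕ} (A : Matrix (Fin n) (Fin n) ℝ) (ξ : Eucl n) {σ : ℝ} (hσ : |σ| = 1) (m : ℕ)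
    (z : ℝ × Eucl n) (x : Eucl n) :
    ‖jet A ξ σ m z x - tau (A + (1 / 2 : ℝ) • vecMulVec ⇑ξ ⇑ξ) z x‖ ≤ 1 / (m + 1) * (‖ξ‖ * ‖x‖ + ‖ξ‖) := by
  have hm : (0 : ℝ) ≤ 1 / (m + 1) := by positivity
  refine max_le ?_ ?_
  · have h1 := HH_near hσ m (inner ℝ ξ x)
    simp only [jet, tau, qf_vec, Prod.fst_sub]
    rw [Real.norm_eq_abs]
    have e : qf A x + HH σ m (inner ℝ ξ x) + (z.1 + inner ℝ z.2 x) -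
      (qf A x + 1 / 2 / 2 * inner ℝ ξ x ^ 2 + (z.1 + inner ℝ z.2 x)) = HH σ m (inner ℝ ξ x) - inner ℝ ξ x ^ 2 / 4 := by
      ring
    rw [e]
    refine h1.trans (mul_le_mul_of_nonneg_left ?_ hm)
    linarith [abs_real_inner_le_norm ξ x, norm_nonneg ξ]
  · simp only [jet, tau, mv_vec, Prod.snd_sub]
    have e : mv A x + WW σ m (inner ℝ ξ x) • ξ + z.2 - (mv A x + (1 / 2 * inner ℝ ξ x) • ξ + z.2) =
        (WW σ m (inner ℝ ξ x) - inner ℝ ξ x / 2) • ξ := by module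
    rw [e, norm_smul, Real.norm_eq_abs]
    have := WW_near hσ m (inner ℝ ξ x)
    have h0 := norm_nonneg ξ
    calc _ ≤ 1 / ((m : ℝ) + 1) * ‖ξ‖ := by gcongr
      _ ≤ _ := by gcongr; have : 0 ≤ ‖ξ‖ * ‖x‖ := by positivity
                  linarith

lemma lam_eta {n d : ℕ} {Ψ : ConvFn n → RadonMeasure n} (hΨ : MemPdLV d Ψ)
    (htr : IsTranslationInvariant Ψ) {A B : Matrix (Fin n) (Fin n) ℝ} (hA : A.PosSemidef) (hB : B.PosSemidef)
    {F : ℝ × Eucl n → ℂ} (hF : Dens d Ψ hB F) (ξ : Eucl n) {σ : ℝ} (hσ : |σ| = 1) (m : ℕ) (z : ℝ × Eucl n)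
    (x : Eucl n) {c δ : ℝ} (hδ : 0 < δ) (hc : ∀ s, |s - inner ℝ ξ x| < δ →
      WW σ m s = WW σ m (inner ℝ ξ x) + c * (s - inner ℝ ξ x)) (hBA : B = A + c • vecMulVec ⇑ξ ⇑ξ) :
    Tendsto (fun k => (Ψ (aA (lamC hA ξ hσ m) z)).1 (etaCc k x)) atTop (𝓝 (F (jet A ξ σ m z x))) := by
  refine (hF.2 (jet A ξ σ m z x)).congr' (EventuallyEq.symm ?_)
  refine loc_eta hΨ htr ?_
  have h1 : ∀ᶠ y in 𝓝 x, |inner ℝ ξ (y - x)| < δ := by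
    have : Continuous fun y => |inner ℝ ξ (y - x)| := by fun_prop
    exact this.continuousAt.eventually (gt_mem_nhds (by simpa using hδ))
  filter_upwards [h1] with y hy
  have h2 := ridge_loc (WW_cont hσ m) hc hy
  have h3 := lam_step (psd_symm hA) ξ σ m x (y - x)
  rw [add_sub_cancel] at h3
  simp only [tr_apply, aA_apply, qC_apply, lamC_apply, hBA, qf_vec, jet]
  rw [inner_add_left _ z.2, inner_sub_right z.2]
  unfold HH at *
  linarith

lemma jet_bound {n : ℕ} (A : Matrix (Fin n) (Fin n) ℝ) (ξ : Eucl n) (z : ℝ × Eucl n) {F : ℝ × Eucl n → ℂ}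
    (hF : Continuous F) (R : ℝ) : ∃ B : ℝ, 0 ≤ B ∧ ∀ {σ : ℝ}, |σ| = 1 → ∀ m x, ‖x‖ ≤ R →
      ‖F (jet A ξ σ m z x)‖ ≤ B := by
  set C := A + (1 / 2 : ℝ) • vecMulVec ⇑ξ ⇑ξ
  obtain ⟨T, hT⟩ := (isCompact_closedBall (0 : Eucl n) R).exists_bound_of_continuousOn
    (tau_cont C z).continuousOn
  obtain ⟨B, hB⟩ := (isCompact_closedBall (0 : ℝ × Eucl n) (T + (‖ξ‖ * R + ‖ξ‖))).exists_bound_of_continuousOn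
    hF.continuousOn
  refine ⟨max B 0, le_max_right _ _, fun {σ} hσ m x hx => (hB _ ?_).trans (le_max_left _ _)⟩
  rw [mem_closedBall_zero_iff]
  have h1 := jet_near A ξ hσ m z x
  have h2 := hT x (mem_closedBall_zero_iff.2 hx)
  have h3 : (1 : ℝ) / (m + 1) ≤ 1 := by rw [div_le_one (by positivity)]; simp
  have h4 : 1 / ((m : ℝ) + 1) * (‖ξ‖ * ‖x‖ + ‖ξ‖) ≤ 1 * (‖ξ‖ * R + ‖ξ‖) := by gcongr
  have h5 := norm_add_le (jet A ξ σ m z x - tau C z x) (tau C z x)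
  rw [sub_add_cancel] at h5
  linarith

lemma jet_tendsto {n : ℕ} (A : Matrix (Fin n) (Fin n) ℝ) (ξ : Eucl n) (z : ℝ × Eucl n) {σ : ℝ} (hσ : |σ| = 1)
    (x : Eucl n) : Tendsto (fun m => jet A ξ σ m z x) atTop
      (𝓝 (tau (A + (1 / 2 : ℝ) • vecMulVec ⇑ξ ⇑ξ) z x)) := by
  rw [tendsto_iff_norm_sub_tendsto_zero]
  refine squeeze_zero (fun _ => norm_nonneg _) (fun m => jet_near A ξ hσ m z x) ?_
  simpa using (tendsto_one_div_add_atTop_nhds_zero_nat (𝕜 := ℝ)).mul_const (‖ξ‖ * ‖x‖ + ‖ξ‖)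

lemma lam_tendsto {n : ℕ} {A : Matrix (Fin n) (Fin n) ℝ} (hA : A.PosSemidef) (ξ : Eucl n) {σ : ℝ} (hσ : |σ| = 1)
    (hC : (A + (1 / 2 : ℝ) • vecMulVec ⇑ξ ⇑ξ).PosSemidef) (z : ℝ × Eucl n) :
    Tendsto (fun m => aA (lamC hA ξ hσ m) z) atTop (𝓝 (aA (qC _ hC) z)) := by
  refine tendsto_conv.2 fun R ε hε => ?_
  have := (tendsto_one_div_add_atTop_nhds_zero_nat (𝕜 := ℝ)).mul_const (‖ξ‖ * R + ‖ξ‖)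
  rw [zero_mul] at this
  filter_upwards [this.eventually (gt_mem_nhds hε)] with m hm x hx
  refine lt_of_le_of_lt ?_ hm
  have h1 := (le_max_left _ _).trans (jet_near A ξ hσ m z x)
  refine h1.trans ?_
  gcongr

lemma laminate {n d : ℕ} {Ψ : ConvFn n → RadonMeasure n} (hΨ : MemPdLV d Ψ)
    (htr : IsTranslationInvariant Ψ) {A : Matrix (Fin n) (Fin n) ℝ} {ξ : Eucl n} (hξ : ξ ≠ 0) (hA : A.PosSemidef)
    (hB : (A + (1 : ℝ) • vecMulVec ⇑ξ ⇑ξ).PosSemidef) (hC : (A + (1 / 2 : ℝ) • vecMulVec ⇑ξ ⇑ξ).PosSemidef)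
    {FA FB FC : ℝ × Eucl n → ℂ} (hFA : Dens d Ψ hA FA) (hFB : Dens d Ψ hB FB) (hFC : Dens d Ψ hC FC)
    (z : ℝ × Eucl n) : FA z + FB z = 2 * FC z := by
  have cA := PolyV_continuous hFA.1
  have cB := PolyV_continuous hFB.1
  have cC := PolyV_continuous hFC.1
  set C := A + (1 / 2 : ℝ) • vecMulVec ⇑ξ ⇑ξ with hCdef
  have s1 : |(1 : ℝ)| = 1 := abs_one
  have s2 : |(-1 : ℝ)| = 1 := by simp
  let L1 : ℕ → Eucl n → ℕ → ℂ := fun m x k => (Ψ (aA (lamC hA ξ s1 m) z)).1 (etaCc k x)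
  let L2 : ℕ → Eucl n → ℕ → ℂ := fun m x k => (Ψ (aA (lamC hA ξ s2 m) z)).1 (etaCc k x)
  have hae : ∀ᵐ x : Eucl n, ∀ (m : ℕ) (k : ℤ), 2 * ((m + 1) * inner ℝ ξ x) ≠ k := by
    rw [ae_all_iff]; intro m
    rw [ae_all_iff]; intro k
    filter_upwards [ae_inner_ne hξ ((k : ℝ) / (2 * (m + 1)))] with x hx h
    refine hx ?_
    rw [eq_div_iff (by positivity), ← h]; ring
  have hg : ∀ᵐ x : Eucl n, ∀ m, ∃ g : ℂ × ℂ, Tendsto (L1 m x) atTop (𝓝 g.1) ∧ Tendsto (L2 m x) atTop (𝓝 g.2) ∧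
      (g = (FA (jet A ξ 1 m z x), FB (jet A ξ (-1) m z x)) ∨
        g = (FB (jet A ξ 1 m z x), FA (jet A ξ (-1) m z x))) := by
    filter_upwards [hae] with x hx m
    obtain ⟨c, hc, δ, hδ, h⟩ := WW_loc m (hx m)
    rcases hc with rfl | rfl
    · refine ⟨(FB (jet A ξ 1 m z x), FA (jet A ξ (-1) m z x)), ?_, ?_, Or.inr rfl⟩
      · exact lam_eta hΨ htr hA hB hFB ξ s1 m z x hδ (fun s hs => (h s hs).1) rfl
      · exact lam_eta hΨ htr hA hA hFA ξ s2 m z x hδ (fun s hs => (h s hs).2) (by simp)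
    · refine ⟨(FA (jet A ξ 1 m z x), FB (jet A ξ (-1) m z x)), ?_, ?_, Or.inl rfl⟩
      · exact lam_eta hΨ htr hA hA hFA ξ s1 m z x hδ (fun s hs => (h s hs).1) (by simp)
      · exact lam_eta hΨ htr hA hB hFB ξ s2 m z x hδ (fun s hs => (h s hs).2) (by simp)
  have hg' : ∀ x : Eucl n, ∃ g : ℕ → ℂ × ℂ, (∀ m, ∃ g : ℂ × ℂ, Tendsto (L1 m x) atTop (𝓝 g.1) ∧
      Tendsto (L2 m x) atTop (𝓝 g.2) ∧ (g = (FA (jet A ξ 1 m z x), FB (jet A ξ (-1) m z x)) ∨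
        g = (FB (jet A ξ 1 m z x), FA (jet A ξ (-1) m z x)))) → ∀ m, Tendsto (L1 m x) atTop (𝓝 (g m).1) ∧
      Tendsto (L2 m x) atTop (𝓝 (g m).2) ∧ (g m = (FA (jet A ξ 1 m z x), FB (jet A ξ (-1) m z x)) ∨
        g m = (FB (jet A ξ 1 m z x), FA (jet A ξ (-1) m z x))) := by
    intro x
    by_cases h : ∀ m, ∃ g : ℂ × ℂ, Tendsto (L1 m x) atTop (𝓝 g.1) ∧
      Tendsto (L2 m x) atTop (𝓝 g.2) ∧ (g = (FA (jet A ξ 1 m z x), FB (jet A ξ (-1) m z x)) ∨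
        g = (FB (jet A ξ 1 m z x), FA (jet A ξ (-1) m z x)))
    · choose g hg using h
      exact ⟨g, fun _ => hg⟩
    · exact ⟨0, fun h' => absurd h' h⟩
  choose g hgg using hg'
  have G : ∀ᵐ x : Eucl n, ∀ m, Tendsto (L1 m x) atTop (𝓝 (g x m).1) ∧ Tendsto (L2 m x) atTop (𝓝 (g x m).2) ∧
      (g x m = (FA (jet A ξ 1 m z x), FB (jet A ξ (-1) m z x)) ∨
        g x m = (FB (jet A ξ 1 m z x), FA (jet A ξ (-1) m z x))) := by
    filter_upwards [hg] with x hx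
    exact hgg x hx
  have m1 : ∀ m, AEStronglyMeasurable (fun x => (g x m).1) volume := fun m =>
    aestronglyMeasurable_of_tendsto_ae atTop (f := fun k x => L1 m x k)
      (fun k => (etaμ_cont _ k).aestronglyMeasurable) (G.mono fun x hx => (hx m).1)
  have m2 : ∀ m, AEStronglyMeasurable (fun x => (g x m).2) volume := fun m =>
    aestronglyMeasurable_of_tendsto_ae atTop (f := fun k x => L2 m x k)
      (fun k => (etaμ_cont _ k).aestronglyMeasurable) (G.mono fun x hx => (hx m).2.1)
  suffices h : (fun x => FA (tau C z x) + FB (tau C z x)) = fun x => 2 * FC (tau C z x) by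
    have := congrFun h 0
    simpa only [tau_zero] using this
  refine cc_uniq (by have := tau_cont C z; fun_prop) (by have := tau_cont C z; fun_prop) fun φ => ?_
  obtain ⟨R, hR0, hR⟩ := cc_radius φ
  obtain ⟨BA, hBA0, hBA⟩ := jet_bound A ξ z cA R
  obtain ⟨BB, hBB0, hBB⟩ := jet_bound A ξ z cB R
  have hφi := φ.continuous.integrable_of_hasCompactSupport (μ := volume) φ.hasCompactSupport'
  have bd : ∀ᵐ x, ∀ m, ‖φ x * (g x m).1‖ ≤ ‖φ x‖ * (BA + BB) ∧ ‖φ x * (g x m).2‖ ≤ ‖φ x‖ * (BA + BB) := by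
    filter_upwards [G] with x hx m
    by_cases h0 : φ x = 0
    · simp [h0]
    have hxR := hR x h0
    rw [norm_mul, norm_mul]
    rcases (hx m).2.2 with h | h <;> rw [h] <;>
      constructor <;> refine mul_le_mul_of_nonneg_left ?_ (norm_nonneg _)
    · linarith [hBA s1 m x hxR]
    · linarith [hBB s2 m x hxR]
    · linarith [hBB s1 m x hxR]
    · linarith [hBA s2 m x hxR]
  have hsum : ∀ m, (Ψ (aA (lamC hA ξ s1 m) z)).1 φ + (Ψ (aA (lamC hA ξ s2 m) z)).1 φ =
      ∫ x, (φ x * (g x m).1 + φ x * (g x m).2) := by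
    intro m
    obtain ⟨K1, hK1⟩ := CK_lam hA ξ s1 m
    obtain ⟨K2, hK2⟩ := CK_lam hA ξ s2 m
    rw [lemL hΨ htr (CK_aA hK1 z) (G.mono fun x hx => (hx m).1) φ,
      lemL hΨ htr (CK_aA hK2 z) (G.mono fun x hx => (hx m).2.1) φ, integral_add]
    · exact (hφi.norm.mul_const (BA + BB)).mono' (φ.continuous.aestronglyMeasurable.mul (m1 m))
        (bd.mono fun x hx => (hx m).1)
    · exact (hφi.norm.mul_const (BA + BB)).mono' (φ.continuous.aestronglyMeasurable.mul (m2 m))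
        (bd.mono fun x hx => (hx m).2)
  have lim1 : Tendsto (fun m => ∫ x, (φ x * (g x m).1 + φ x * (g x m).2)) atTop
      (𝓝 (∫ x, φ x * (FA (tau C z x) + FB (tau C z x)))) := by
    refine tendsto_integral_of_dominated_convergence (fun x => ‖φ x‖ * (BA + BB) + ‖φ x‖ * (BA + BB)) ?_ ?_ ?_ ?_
    · exact fun m => (φ.continuous.aestronglyMeasurable.mul (m1 m)).add
        (φ.continuous.aestronglyMeasurable.mul (m2 m))
    · exact (hφi.norm.mul_const (BA + BB)).add (hφi.norm.mul_const (BA + BB))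
    · exact fun m => bd.mono fun x hx => (norm_add_le _ _).trans (add_le_add (hx m).1 (hx m).2)
    · filter_upwards [G] with x hx
      have t1 := jet_tendsto A ξ z s1 x
      have t2 := jet_tendsto A ξ z s2 x
      have a1 := (cA.tendsto _).comp t1
      have a2 := (cA.tendsto _).comp t2
      have b1 := (cB.tendsto _).comp t1
      have b2 := (cB.tendsto _).comp t2
      rw [Metric.tendsto_atTop]
      intro ε hε
      have e1 := Metric.tendsto_atTop.1 ((a1.add b2).const_mul (φ x)) ε hε
      have e2 := Metric.tendsto_atTop.1 ((a2.add b1).const_mul (φ x)) ε hε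
      obtain ⟨N1, h1⟩ := e1
      obtain ⟨N2, h2⟩ := e2
      refine ⟨max N1 N2, fun m hm => ?_⟩
      rw [← mul_add]
      rcases (hx m).2.2 with h | h <;> rw [h]
      · exact h1 m ((le_max_left _ _).trans hm)
      · rw [add_comm (Prod.fst _)]
        exact h2 m ((le_max_right _ _).trans hm)
  have lim2 : Tendsto (fun m => (Ψ (aA (lamC hA ξ s1 m) z)).1 φ + (Ψ (aA (lamC hA ξ s2 m) z)).1 φ) atTop
      (𝓝 ((Ψ (aA (qC C hC) z)).1 φ + (Ψ (aA (qC C hC) z)).1 φ)) :=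
    (((hΨ.2.1 φ).tendsto _).comp (lam_tendsto hA ξ s1 hC z)).add
      (((hΨ.2.1 φ).tendsto _).comp (lam_tendsto hA ξ s2 hC z))
  simp only [hsum] at lim2
  rw [tendsto_nhds_unique lim1 lim2, quad_rep hΨ htr hC hFC z φ, ← two_mul, ← integral_const_mul]
  refine integral_congr_ae (ae_of_all _ fun x => ?_)
  simp only; ring

lemma jensen {p : ℝ → ℂ} {C : ℝ} (hm : ∀ t u, 0 ≤ t → 0 ≤ u → p t + p (t + u) = 2 * p (t + u / 2))
    (hC : ∀ t, 0 ≤ t → t ≤ 1 → ‖p t‖ ≤ C) {t : ℝ} (ht : 0 ≤ t) : p t = p 0 + t * (p 1 - p 0) := by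
  have h2 : ∀ u, 0 ≤ u → p 0 + p (2 * u) = 2 * p u := fun u hu => by
    have := hm 0 (2 * u) le_rfl (by positivity)
    rwa [zero_add, zero_add, mul_div_cancel_left₀ _ two_ne_zero] at this
  set g : ℝ → ℂ := fun t => p t - p 0 - t * (p 1 - p 0) with hg
  have hadd' : ∀ t u, 0 ≤ t → 0 ≤ u → g t + g (t + u) = g (t + (t + u)) := fun t u ht hu => by
    have e1 := hm t u ht hu
    have e2 := h2 (t + u / 2) (by positivity)
    rw [show 2 * (t + u / 2) = t + (t + u) by ring] at e2
    simp only [hg]; push_cast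
    linear_combination e1 - e2
  have hadd : ∀ a b, 0 ≤ a → 0 ≤ b → g a + g b = g (a + b) := fun a b ha hb => by
    rcases le_total a b with h | h
    · have := hadd' a (b - a) ha (by linarith)
      rwa [add_sub_cancel] at this
    · have := hadd' b (a - b) hb (by linarith)
      rw [add_sub_cancel] at this
      rw [add_comm, this, add_comm]
  have g1 : g 1 = 0 := by simp [hg]
  have hN : ∀ (N : ℕ) (t : ℝ), 0 ≤ t → g (N * t) = N * g t := fun N t ht => by
    induction N with
    | zero => simp [hg]
    | succ k ih =>
      rw [show ((k + 1 : ℕ) : ℝ) * t = k * t + t by push_cast; ring, ← hadd _ _ (by positivity) ht, ih]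
      push_cast; ring
  have hb1 : ∀ t, 0 ≤ t → t ≤ 1 → ‖g t‖ ≤ 4 * C := fun t h0 h1 => by
    have c0 := hC 0 le_rfl zero_le_one
    have c1 := hC 1 zero_le_one le_rfl
    have ct := hC t h0 h1
    have e : ‖(t : ℂ) * (p 1 - p 0)‖ ≤ 1 * (C + C) := by
      rw [norm_mul]
      refine mul_le_mul ?_ ((norm_sub_le _ _).trans (add_le_add c1 c0)) (norm_nonneg _) zero_le_one
      rwa [Complex.norm_real, Real.norm_of_nonneg h0]
    calc ‖g t‖ ≤ ‖p t - p 0‖ + ‖(t : ℂ) * (p 1 - p 0)‖ := norm_sub_le _ _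
      _ ≤ (C + C) + 1 * (C + C) := add_le_add ((norm_sub_le _ _).trans (add_le_add ct c0)) e
      _ = 4 * C := by ring
  have hb : ∀ t, 0 ≤ t → ‖g t‖ ≤ 4 * C := fun t h0 => by
    have e := hadd (⌊t⌋₊ * 1) (t - ⌊t⌋₊) (by positivity) (sub_nonneg.2 (Nat.floor_le h0))
    rw [hN _ _ zero_le_one, g1, mul_zero, zero_add, mul_one, add_sub_cancel] at e
    rw [← e]
    exact hb1 _ (sub_nonneg.2 (Nat.floor_le h0)) (by linarith [Nat.lt_floor_add_one t])
  have hz : g t = 0 := by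
    by_contra h
    obtain ⟨N, hN'⟩ := exists_nat_gt (4 * C / ‖g t‖)
    rw [div_lt_iff₀ (norm_pos_iff.2 h)] at hN'
    have := hb (N * t) (by positivity)
    rw [hN N t ht, norm_mul, Complex.norm_natCast] at this
    linarith
  simp only [hg] at hz
  linear_combination hz

lemma psd_vec {n : ℕ} {A : Matrix (Fin n) (Fin n) ℝ} (hA : A.PosSemidef) (ξ : Fin n → ℝ) {t : ℝ} (ht : 0 ≤ t) :
    (A + t • vecMulVec ξ ξ).PosSemidef :=
  hA.add ((by simpa using posSemidef_vecMulVec_self_star ξ : (vecMulVec ξ ξ).PosSemidef).smul ht)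

open Classical in
def GG {n : ℕ} (Ψ : ConvFn n → RadonMeasure n) (z : ℝ × Eucl n) (A : Matrix (Fin n) (Fin n) ℝ) : ℂ :=
  if h : A.PosSemidef then limUnder atTop (fun m => (Ψ (aA (qC A h) z)).1 (etaCc m 0)) else 0

lemma GG_dens {n d : ℕ} {Ψ : ConvFn n → RadonMeasure n} (hΨ : MemPdLV d Ψ)
    (htr : IsTranslationInvariant Ψ) {A : Matrix (Fin n) (Fin n) ℝ} (hA : A.PosSemidef) :
    Dens d Ψ hA (fun z => GG Ψ z A) := by
  obtain ⟨F, hF, h⟩ := quad_dens hΨ htr hA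
  have : (fun z => GG Ψ z A) = F := by
    funext z
    simp only [GG, dif_pos hA]
    exact (h z).limUnder_eq
  rw [this]
  exact ⟨hF, h⟩

/-- Rank-one affinity. -/
def R1A {n : ℕ} (G : Matrix (Fin n) (Fin n) ℝ → ℂ) : Prop :=
  ∀ A : Matrix (Fin n) (Fin n) ℝ, A.PosSemidef → ∀ (ξ : Fin n → ℝ) (t : ℝ), 0 ≤ t →
    G (A + t • vecMulVec ξ ξ) = G A + t * (G (A + vecMulVec ξ ξ) - G A)

lemma GG_R1A {n d : ℕ} {Ψ : ConvFn n → RadonMeasure n} (hΨ : MemPdLV d Ψ)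
    (htr : IsTranslationInvariant Ψ) (z : ℝ × Eucl n) : R1A (GG Ψ z) := by
  intro A hA ξ t ht
  set c : ℝ≥0 := ∑ i, ∑ j, (‖A i j‖₊ + ‖ξ i * ξ j‖₊) with hc
  obtain ⟨C, m0, -, hb⟩ := lemM2 hΨ htr (n ^ 2 * c) ‖z‖
  have key := jensen (p := fun t => GG Ψ z (A + t • vecMulVec ξ ξ)) (C := C) ?_ ?_ ht
  · simpa using key
  · intro t u ht hu
    rcases eq_or_ne (WithLp.toLp 2 ξ : Eucl n) 0 with h0 | h0
    · have : ξ = 0 := by simpa using h0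
      subst this
      simp; ring
    rcases hu.eq_or_lt with rfl | hu
    · simp; ring
    have hξ : √u • (WithLp.toLp 2 ξ : Eucl n) ≠ 0 := smul_ne_zero (Real.sqrt_pos.2 hu).ne' h0
    have ev : vecMulVec ⇑(√u • (WithLp.toLp 2 ξ : Eucl n)) ⇑(√u • (WithLp.toLp 2 ξ : Eucl n)) =
        u • vecMulVec ξ ξ := by
      ext i j
      simp only [vecMulVec_apply, PiLp.smul_apply, smul_eq_mul, Matrix.smul_apply]
      linear_combination ξ i * ξ j * Real.mul_self_sqrt hu.le
    have hA' := psd_vec hA ξ ht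
    have e1 : A + t • vecMulVec ξ ξ + (1 : ℝ) • (u • vecMulVec ξ ξ) = A + (t + u) • vecMulVec ξ ξ := by
      rw [one_smul, add_smul, add_assoc]
    have e2 : A + t • vecMulVec ξ ξ + (1 / 2 : ℝ) • (u • vecMulVec ξ ξ) = A + (t + u / 2) • vecMulVec ξ ξ := by
      rw [smul_smul, add_smul, add_assoc]; congr 3; ring
    have := laminate hΨ htr hξ hA' (psd_vec hA' _ zero_le_one) (psd_vec hA' _ (by norm_num))
      (GG_dens hΨ htr _) (GG_dens hΨ htr _) (GG_dens hΨ htr _) z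
    rwa [ev, e1, e2] at this
  · intro t h0 h1
    have hA' := psd_vec hA ξ h0
    refine le_of_tendsto ((GG_dens hΨ htr hA').2 z).norm ?_
    filter_upwards [eventually_ge_atTop m0] with m hm
    refine hb m hm _ (fun x => ⟨?_, ?_⟩) z le_rfl
    · rw [qC_apply]; exact qf_nonneg hA' x
    · rw [qC_apply]
      refine qf_le _ (fun i j => ?_) x
      have e : ‖A i j‖₊ + ‖ξ i * ξ j‖₊ ≤ c :=
        (Finset.single_le_sum (f := fun j => ‖A i j‖₊ + ‖ξ i * ξ j‖₊) (fun _ _ => zero_le) (Finset.mem_univ j)).trans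
          (Finset.single_le_sum (f := fun i => ∑ j, (‖A i j‖₊ + ‖ξ i * ξ j‖₊)) (fun _ _ => zero_le)
            (Finset.mem_univ i))
      have e' : |A i j| + |ξ i * ξ j| ≤ c := by exact_mod_cast e
      refine le_trans ?_ e'
      simp only [Matrix.add_apply, Matrix.smul_apply, vecMulVec_apply, smul_eq_mul]
      refine (abs_add_le _ _).trans (add_le_add le_rfl ?_)
      rw [abs_mul, abs_of_nonneg h0]
      exact mul_le_of_le_one_left (abs_nonneg _) h1

lemma polar {E R : Type*} [AddCommGroup E] [Module ℝ E] [CommRing R] [Algebra ℝ R]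
    (B : E →ₗ[ℝ] E →ₗ[ℝ] R) (hs : ∀ x y, B x y = B y x) (hq : ∀ x, B x x * B x x = 0) (x y z : E) :
    B y x * B x z = (-(1 / 2) : ℝ) • (B x x * B y z) := by
  have h4 : ∀ r : R, (4 : R) * r = 0 → r = 0 := fun r hr => by
    have : ((1 / 4 : ℝ) * 4) • r = 0 := by
      rw [mul_smul, show (4 : ℝ) • r = 4 * r by rw [Algebra.smul_def, map_ofNat], hr, smul_zero]
    simpa using this
  have h1 : ∀ x y, B x y * B x y * 2 + B x x * B y y = 0 := fun x y => h4 _ (by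
    have e1 := hq (x + y)
    have e2 := hq (x - y)
    simp only [map_add, map_sub, LinearMap.add_apply, LinearMap.sub_apply, hs y x] at e1 e2
    linear_combination e1 + e2 - 2 * hq x - 2 * hq y)
  have e := h1 x (y + z)
  simp only [map_add, LinearMap.add_apply, hs z y] at e
  have h2 : 2 * (B y x * B x z) + B x x * B y z = 0 := h4 _ (by
    rw [hs y x]; linear_combination 2 * e - 2 * h1 x y - 2 * h1 x z)
  have h3 : B y x * B x z = (1 / 2 : ℝ) • (2 * (B y x * B x z)) := by
    rw [show (2 : R) * (B y x * B x z) = (2 : ℝ) • (B y x * B x z) by rw [Algebra.smul_def, map_ofNat], smul_smul]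
    norm_num
  rw [h3, eq_neg_of_add_eq_zero_left h2, smul_neg, neg_smul]

lemma perm_id {E R : Type*} [AddCommGroup E] [Module ℝ E] [CommRing R] [Algebra ℝ R]
    (B : E →ₗ[ℝ] E →ₗ[ℝ] R) (hs : ∀ x y, B x y = B y x) (hq : ∀ x, B x x * B x x = 0) {k : ℕ} :
    ∀ (N : ℕ) (σ : Equiv.Perm (Fin k)), σ.support.card ≤ N → ∃ r : ℝ, 0 < r ∧ ∀ ξ : Fin k → E,
      (Equiv.Perm.sign σ : ℤ) • ∏ l, B (ξ l) (ξ (σ l)) = r • ∏ l, B (ξ l) (ξ l) := by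
  intro N
  induction N with
  | zero =>
    intro σ h
    have : σ = 1 := by simpa using h
    subst this
    exact ⟨1, one_pos, fun ξ => by simp⟩
  | succ N ih =>
    intro σ h
    by_cases h1 : σ = 1
    · subst h1
      exact ⟨1, one_pos, fun ξ => by simp⟩
    obtain ⟨l, hl⟩ : ∃ l, σ l ≠ l := by
      by_contra hh; push Not at hh; exact h1 (Equiv.ext hh)
    obtain ⟨r, hr, hh⟩ := ih (Equiv.swap l (σ l) * σ)
      (Nat.le_of_lt_succ ((Equiv.Perm.card_support_swap_mul hl).trans_le h))
    refine ⟨r * (1 / 2), by positivity, fun ξ => ?_⟩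
    set τ := Equiv.swap l (σ l) * σ with hτ
    obtain ⟨m, hm⟩ := σ.surjective l
    have hml : m ≠ l := fun h => hl (by rw [← h]; exact hm.trans h.symm)
    have split : ∀ f : Fin k → R, ∏ i, f i = f l * (f m * ∏ i ∈ (Finset.univ.erase l).erase m, f i) := fun f => by
      rw [Finset.mul_prod_erase _ _ (by simp [hml]), Finset.mul_prod_erase _ _ (by simp)]
    have t1 : τ l = l := by simp [hτ]
    have t2 : τ m = σ l := by simp [hτ, hm]
    have t3 : ∀ i ∈ (Finset.univ.erase l).erase m, B (ξ i) (ξ (σ i)) = B (ξ i) (ξ (τ i)) := fun i hi => by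
      simp only [Finset.mem_erase, Finset.mem_univ, and_true] at hi
      rw [hτ, Equiv.Perm.mul_apply, Equiv.swap_apply_of_ne_of_ne]
      · exact fun h => hi.1 (σ.injective (h.trans hm.symm))
      · exact fun h => hi.2 (σ.injective h)
    have hsg : (Equiv.Perm.sign τ : ℤ) = -(Equiv.Perm.sign σ : ℤ) := by
      rw [hτ, Equiv.Perm.sign_mul, Equiv.Perm.sign_swap hl.symm]; simp
    have key : ∏ i, B (ξ i) (ξ (σ i)) = (-(1 / 2) : ℝ) • ∏ i, B (ξ i) (ξ (τ i)) := by
      rw [split, split (fun i => B (ξ i) (ξ (τ i))), t1, t2, Finset.prod_congr rfl t3, hm, ← mul_assoc,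
        ← mul_assoc, ← smul_mul_assoc, ← polar B hs hq, mul_comm (B (ξ m) _)]
    rw [key, mul_comm r, mul_smul, ← hh ξ, hsg, neg_smul, neg_smul, smul_neg, smul_neg, smul_comm]

lemma minor_id {R : Type*} [CommRing R] [Algebra ℝ R] {n : ℕ}
    (B : (Fin n → ℝ) →ₗ[ℝ] (Fin n → ℝ) →ₗ[ℝ] R) (hs : ∀ x y, B x y = B y x) (hq : ∀ x, B x x * B x x = 0)
    (X : Fin n × Fin n → R) (hB : ∀ x y, B x y = ∑ p : Fin n × Fin n, (x p.1 * y p.2) • X p) (k : ℕ) :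
    ∃ c : ℝ, 0 < c ∧ ∀ ξ : Fin n → Fin n → ℝ,
      ∑ p : Fin k → Fin n × Fin n, ((∑ a, vecMulVec (ξ a) (ξ a)).submatrix (fun l => (p l).1) (fun l => (p l).2)).det
        • ∏ l, X (p l) = c • (∑ a, B (ξ a) (ξ a)) ^ k := by
  choose r hr h using fun σ : Equiv.Perm (Fin k) => perm_id B hs hq _ σ le_rfl
  refine ⟨∑ σ, r σ, Finset.sum_pos (fun σ _ => hr σ) ⟨1, Finset.mem_univ _⟩, fun ξ => ?_⟩
  rw [Fintype.sum_pow, Finset.sum_smul]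
  have e : ∀ p : Fin k → Fin n × Fin n,
      ((∑ a, vecMulVec (ξ a) (ξ a)).submatrix (fun l => (p l).1) (fun l => (p l).2)).det • ∏ l, X (p l) =
      ∑ σ : Equiv.Perm (Fin k), ∑ a : Fin k → Fin n, (Equiv.Perm.sign σ : ℤ) •
        ∏ l, (ξ (a (σ.symm l)) (p l).1 * ξ (a l) (p l).2) • X (p l) := by
    intro p
    rw [det_apply, Finset.sum_smul]
    refine Finset.sum_congr rfl fun σ _ => ?_
    have e0 : ∀ i ∈ Finset.univ, (∑ a, vecMulVec (ξ a) (ξ a)).submatrix (fun l => (p l).1) (fun l => (p l).2) (σ i) i =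
        ∑ a, ξ a (p (σ i)).1 * ξ a (p i).2 := fun i _ => by
      rw [submatrix_apply, Matrix.sum_apply]; rfl
    rw [Finset.prod_congr rfl e0, Finset.prod_univ_sum, Fintype.piFinset_univ, Units.smul_def, smul_assoc, Finset.sum_smul, Finset.smul_sum]
    refine Finset.sum_congr rfl fun a _ => ?_
    congr 1
    rw [Finset.prod_smul]
    congr 1
    rw [Finset.prod_mul_distrib, Finset.prod_mul_distrib]
    congr 1
    rw [← Equiv.prod_comp σ (fun l => ξ (a (σ.symm l)) (p l).1)]
    simp
  simp only [e]
  rw [Finset.sum_comm]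
  refine Finset.sum_congr rfl fun σ _ => ?_
  rw [Finset.sum_comm, Finset.smul_sum]
  refine Finset.sum_congr rfl fun a _ => ?_
  rw [← h σ (fun l => ξ (a l)), ← Finset.smul_sum]
  congr 1
  rw [← Equiv.prod_comp σ.symm]
  simp only [Equiv.apply_symm_apply, hB]
  rw [Finset.prod_univ_sum, Fintype.piFinset_univ]

lemma exp_eq_one {R : Type*} [CommRing R] [Algebra ℚ R] {w : R} (hw : IsNilpotent w)
    (h : IsNilpotent.exp w = 1) : w = 0 := by
  obtain ⟨N, hN⟩ := hw
  rw [IsNilpotent.exp_eq_sum (k := N + 2) (by rw [pow_add, hN, zero_mul]), Finset.sum_range_succ',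
    Finset.sum_range_succ'] at h
  set q : R := ∑ i ∈ Finset.range N, ((i + 1 + 1).factorial : ℚ)⁻¹ • w ^ i with hq
  have e : ∑ i ∈ Finset.range N, ((i + 1 + 1).factorial : ℚ)⁻¹ • w ^ (i + 1 + 1) = w * w * q := by
    rw [hq, Finset.mul_sum]
    refine Finset.sum_congr rfl fun i _ => ?_
    rw [mul_smul_comm, pow_succ, pow_succ]; congr 1; ring
  rw [e] at h
  simp only [zero_add, Nat.factorial_one, Nat.factorial_zero, Nat.cast_one, inv_one, one_smul, pow_one,
    pow_zero] at h
  have h2 : w * (1 + w * q) = 0 := by linear_combination h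
  have hu : IsUnit (1 + w * q) := IsNilpotent.isUnit_one_add ((Commute.all w q).isNilpotent_mul_right ⟨N, hN⟩)
  exact (hu.mul_left_eq_zero).1 h2

section
set_option linter.unusedSectionVars false
variable {R : Type*} [CommRing R] [Algebra ℝ R] [Algebra ℚ R] {n : ℕ} {e : Matrix (Fin n) (Fin n) ℝ → R}

lemma exp_sq {x : R} (h : x * x = 0) : IsNilpotent.exp x = 1 + x := by
  rw [IsNilpotent.exp_eq_sum (k := 2) (by rw [pow_two, h]), Finset.sum_range_succ, Finset.sum_range_one]
  simp

lemma sum_psd {ι : Type*} (s : Finset ι) (ξ : ι → Fin n → ℝ) (c : ι → ℝ) (hc : ∀ a, 0 ≤ c a) :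
    (∑ a ∈ s, c a • vecMulVec (ξ a) (ξ a)).PosSemidef := by
  classical
  induction s using Finset.induction_on with
  | empty => simpa using PosSemidef.zero
  | insert a s ha ih => rw [Finset.sum_insert ha, add_comm]; exact psd_vec ih _ (hc a)

lemma alg_u (ha : ∀ A B : Matrix (Fin n) (Fin n) ℝ, A.PosSemidef → B.PosSemidef → e (A + B) = e A * e B)
    (h1 : ∀ (ξ : Fin n → ℝ) (t : ℝ), 0 ≤ t → e (t • vecMulVec ξ ξ) = 1 + t • (e (vecMulVec ξ ξ) - 1))
    (ξ : Fin n → ℝ) : (e (vecMulVec ξ ξ) - 1) * (e (vecMulVec ξ ξ) - 1) = 0 := by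
  have hp : (vecMulVec ξ ξ).PosSemidef := by simpa using posSemidef_vecMulVec_self_star ξ
  have e1 := ha _ _ hp hp
  have e2 := h1 ξ 2 zero_le_two
  rw [two_smul, e1, two_smul] at e2
  linear_combination e2

lemma alg_sum (h0 : e 0 = 1)
    (ha : ∀ A B : Matrix (Fin n) (Fin n) ℝ, A.PosSemidef → B.PosSemidef → e (A + B) = e A * e B)
    (h1 : ∀ (ξ : Fin n → ℝ) (t : ℝ), 0 ≤ t → e (t • vecMulVec ξ ξ) = 1 + t • (e (vecMulVec ξ ξ) - 1))
    {ι : Type*} (s : Finset ι) (ξ : ι → Fin n → ℝ) (c : ι → ℝ) (hc : ∀ a, 0 ≤ c a) :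
    IsNilpotent (∑ a ∈ s, c a • (e (vecMulVec (ξ a) (ξ a)) - 1)) ∧
    e (∑ a ∈ s, c a • vecMulVec (ξ a) (ξ a)) = IsNilpotent.exp (∑ a ∈ s, c a • (e (vecMulVec (ξ a) (ξ a)) - 1)) := by
  classical
  have hu := alg_u ha h1
  have hz : ∀ a, (c a • (e (vecMulVec (ξ a) (ξ a)) - 1)) * (c a • (e (vecMulVec (ξ a) (ξ a)) - 1)) = 0 := fun a => by
    rw [smul_mul_smul_comm, hu, smul_zero]
  have hn : ∀ a, IsNilpotent (c a • (e (vecMulVec (ξ a) (ξ a)) - 1)) := fun a => ⟨2, by rw [pow_two, hz]⟩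
  refine ⟨isNilpotent_sum fun a _ => hn a, ?_⟩
  induction s using Finset.induction_on with
  | empty => simp [h0, IsNilpotent.exp_zero]
  | insert a s has ih =>
    rw [Finset.sum_insert has, Finset.sum_insert has, IsNilpotent.exp_add_of_commute (Commute.all _ _) (hn a)
      (isNilpotent_sum fun a _ => hn a), ← ih, exp_sq (hz a), ha _ _ _ (sum_psd s ξ c hc), h1 _ _ (hc a)]
    simpa using psd_vec PosSemidef.zero (ξ a) (hc a)

lemma alg_rel (h0 : e 0 = 1)
    (ha : ∀ A B : Matrix (Fin n) (Fin n) ℝ, A.PosSemidef → B.PosSemidef → e (A + B) = e A * e B)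
    (h1 : ∀ (ξ : Fin n → ℝ) (t : ℝ), 0 ≤ t → e (t • vecMulVec ξ ξ) = 1 + t • (e (vecMulVec ξ ξ) - 1))
    (f : (Fin n → ℝ) →₀ ℝ) (hf : Finsupp.linearCombination ℝ (fun ξ => vecMulVec ξ ξ) f = 0) :
    Finsupp.linearCombination ℝ (fun ξ => e (vecMulVec ξ ξ) - 1) f = 0 := by
  rw [Finsupp.linearCombination_apply, Finsupp.sum] at hf ⊢
  obtain ⟨n1, e1⟩ := alg_sum h0 ha h1 f.support id (fun a => max (f a) 0) (fun a => le_max_right _ _)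
  obtain ⟨n2, e2⟩ := alg_sum h0 ha h1 f.support id (fun a => max (-f a) 0) (fun a => le_max_right _ _)
  have hd : ∀ a, f a = max (f a) 0 - max (-f a) 0 := fun a => by
    rcases le_total (f a) 0 with h | h
    · rw [max_eq_right h, max_eq_left (by linarith)]; ring
    · rw [max_eq_left h, max_eq_right (by linarith)]; ring
  have hV : ∑ a ∈ f.support, max (f a) 0 • vecMulVec a a = ∑ a ∈ f.support, max (-f a) 0 • vecMulVec a a := by
    rw [← sub_eq_zero, ← Finset.sum_sub_distrib, ← hf]
    exact Finset.sum_congr rfl fun a _ => by rw [← sub_smul, ← hd]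
  have hU : ∑ a ∈ f.support, f a • (e (vecMulVec a a) - 1) = ∑ a ∈ f.support, max (f a) 0 • (e (vecMulVec a a) - 1) +
      -∑ a ∈ f.support, max (-f a) 0 • (e (vecMulVec a a) - 1) := by
    rw [← sub_eq_add_neg, ← Finset.sum_sub_distrib]
    exact Finset.sum_congr rfl fun a _ => by rw [← sub_smul, ← hd]
  simp only [id] at n1 e1 n2 e2
  rw [hU]
  refine exp_eq_one ((Commute.all _ _).isNilpotent_add n1 n2.neg) ?_
  rw [IsNilpotent.exp_add_of_commute (Commute.all _ _) n1 n2.neg, ← e1, hV, e2, IsNilpotent.exp_mul_exp_neg_self n2]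

open scoped MatrixOrder in
lemma psd_sum {n : ℕ} {A : Matrix (Fin n) (Fin n) ℝ} (hA : A.PosSemidef) :
    ∃ M : Fin n → Fin n → ℝ, A = ∑ a, vecMulVec (M a) (M a) := by
  obtain ⟨M, rfl⟩ := CStarAlgebra.nonneg_iff_eq_star_mul_self.mp hA.nonneg
  refine ⟨fun a i => M a i, ?_⟩
  ext i j
  simp [Matrix.mul_apply, Matrix.sum_apply, vecMulVec_apply, star_eq_conjTranspose]

lemma alg_main (h0 : e 0 = 1)
    (ha : ∀ A B : Matrix (Fin n) (Fin n) ℝ, A.PosSemidef → B.PosSemidef → e (A + B) = e A * e B)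
    (h1 : ∀ (ξ : Fin n → ℝ) (t : ℝ), 0 ≤ t → e (t • vecMulVec ξ ξ) = 1 + t • (e (vecMulVec ξ ξ) - 1)) :
    ∃ X : (k : ℕ) → (Fin k → Fin n × Fin n) → R, ∀ A : Matrix (Fin n) (Fin n) ℝ, A.PosSemidef →
      e A = ∑ k ∈ Finset.range (n + 1), ∑ p : Fin k → Fin n × Fin n,
        (A.submatrix (fun l => (p l).1) (fun l => (p l).2)).det • X k p := by
  set u : (Fin n → ℝ) → R := fun ξ => e (vecMulVec ξ ξ) - 1 with hu
  let ε : Fin n → Fin n → ℝ := fun i => Pi.single i 1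
  set X : Fin n × Fin n → R := fun p => (1 / 2 : ℝ) • (u (ε p.1 + ε p.2) - u (ε p.1) - u (ε p.2)) with hX
  let B : (Fin n → ℝ) →ₗ[ℝ] (Fin n → ℝ) →ₗ[ℝ] R := LinearMap.mk₂ ℝ
    (fun x y => ∑ p : Fin n × Fin n, (x p.1 * y p.2) • X p)
    (by intros; simp only [Pi.add_apply, add_mul, add_smul, Finset.sum_add_distrib])
    (by intros; simp only [Pi.smul_apply, smul_eq_mul, mul_assoc, mul_smul, Finset.smul_sum])
    (by intros; simp only [Pi.add_apply, mul_add, add_smul, Finset.sum_add_distrib])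
    (by intros; simp only [Pi.smul_apply, smul_eq_mul, mul_left_comm, mul_smul, Finset.smul_sum])
  have hB : ∀ x y, B x y = ∑ p : Fin n × Fin n, (x p.1 * y p.2) • X p := fun x y => rfl
  have hs : ∀ x y, B x y = B y x := fun x y => by
    rw [hB, hB, ← Equiv.sum_comp (Equiv.prodComm _ _)]
    refine Finset.sum_congr rfl fun p _ => ?_
    simp only [Equiv.prodComm_apply, Prod.fst_swap, Prod.snd_swap, hX]
    rw [mul_comm, add_comm (ε p.2), sub_right_comm]
  have hBu : ∀ ξ, u ξ = B ξ ξ := fun ξ => by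
    have := alg_rel h0 ha h1 (Finsupp.single ξ 1 - ∑ p : Fin n × Fin n, (ξ p.1 * ξ p.2) • ((1 / 2 : ℝ) •
      (Finsupp.single (ε p.1 + ε p.2) 1 - Finsupp.single (ε p.1) 1 - Finsupp.single (ε p.2) 1))) (by
      simp only [map_sub, map_sum, map_smul, Finsupp.linearCombination_single, one_smul]
      have e1 : ∀ p : Fin n × Fin n, (1 / 2 : ℝ) • (vecMulVec (ε p.1 + ε p.2) (ε p.1 + ε p.2) -
          vecMulVec (ε p.1) (ε p.1) - vecMulVec (ε p.2) (ε p.2)) =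
          (1 / 2 : ℝ) • (vecMulVec (ε p.1) (ε p.2) + vecMulVec (ε p.2) (ε p.1)) := fun p => by
        rw [vecMulVec_add, add_vecMulVec, add_vecMulVec]; congr 1; abel
      simp only [e1]
      ext i j
      simp only [Matrix.sub_apply, Matrix.sum_apply, Matrix.smul_apply, Matrix.add_apply, vecMulVec_apply, ε,
        Pi.single_apply, Fintype.sum_prod_type, smul_eq_mul, Matrix.zero_apply]
      simp only [mul_add, Finset.sum_add_distrib, mul_ite, mul_zero, mul_one,
        Finset.sum_ite_eq, Finset.mem_univ, if_true]
      simp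
      ring)
    simp only [map_sub, map_sum, map_smul, Finsupp.linearCombination_single, one_smul] at this
    exact sub_eq_zero.1 this
  have hq : ∀ x, B x x * B x x = 0 := fun x => by rw [← hBu]; exact alg_u ha h1 x
  choose c hc hid using minor_id B hs hq X hB
  refine ⟨fun k p => ((k.factorial : ℝ)⁻¹ * (c k)⁻¹) • ∏ l, X (p l), fun A hA => ?_⟩
  obtain ⟨M, hA'⟩ := psd_sum hA
  have hpow : ∀ k, (∑ a, B (M a) (M a)) ^ k = (c k)⁻¹ • ∑ p : Fin k → Fin n × Fin n,
        (A.submatrix (fun l => (p l).1) (fun l => (p l).2)).det • ∏ l, X (p l) := fun k => by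
    rw [hA', hid k M, smul_smul, inv_mul_cancel₀ (hc k).ne', one_smul]
  have hnil : (∑ a, B (M a) (M a)) ^ (n + 1) = 0 := by
    rw [hpow, Finset.sum_eq_zero, smul_zero]
    intro p _
    obtain ⟨i, j, hij, he⟩ := Fintype.exists_ne_map_eq_of_card_lt (fun l => (p l).1) (by simp)
    rw [det_zero_of_row_eq hij (by ext l; simp only [submatrix_apply]; rw [he]), zero_smul]
  obtain ⟨-, h2⟩ := alg_sum h0 ha h1 Finset.univ M (fun _ => 1) (fun _ => zero_le_one)
  simp only [one_smul] at h2
  rw [← hA'] at h2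
  rw [h2, Finset.sum_congr rfl fun a _ => hBu (M a), IsNilpotent.exp_eq_sum hnil]
  refine Finset.sum_congr rfl fun k _ => ?_
  rw [hpow, ← Rat.cast_smul_eq_qsmul ℝ, smul_smul, Finset.smul_sum]
  refine Finset.sum_congr rfl fun p _ => ?_
  rw [smul_comm]; push_cast; rfl
end

/-- The monoid of positive semidefinite matrices. -/
def PSDm (n : ℕ) : AddSubmonoid (Matrix (Fin n) (Fin n) ℝ) where
  carrier := {A | A.PosSemidef}
  add_mem' := fun ha hb => PosSemidef.add ha hb
  zero_mem' := PosSemidef.zero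

lemma minors {n : ℕ} {G : Matrix (Fin n) (Fin n) ℝ → ℂ} (hG : R1A G) :
    ∃ w : (k : ℕ) → (Fin k → Fin n × Fin n) → ℂ, ∀ A : Matrix (Fin n) (Fin n) ℝ, A.PosSemidef →
      G A = ∑ k ∈ Finset.range (n + 1), ∑ p : Fin k → Fin n × Fin n,
        (((A.submatrix (fun l => (p l).1) (fun l => (p l).2)).det : ℝ) : ℂ) * w k p := by
  classical
  let F : AddMonoidAlgebra ℂ (PSDm n) →ₗ[ℂ] ℂ :=
    (Finsupp.linearCombination ℂ (fun A : PSDm n => G A.1)) ∘ₗ (AddMonoidAlgebra.coeffLinearEquiv ℂ).toLinearMap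
  have hF : ∀ (A : PSDm n) (c : ℂ), F (AddMonoidAlgebra.single A c) = c * G A.1 := fun A c => by
    simp [F]
  let I : Ideal (AddMonoidAlgebra ℂ (PSDm n)) :=
    { carrier := {a | ∀ b, F (b * a) = 0}
      add_mem' := fun {x y} hx hy b => by rw [mul_add, map_add, hx, hy, add_zero]
      zero_mem' := fun b => by rw [mul_zero, map_zero]
      smul_mem' := fun c x hx b => by rw [smul_eq_mul, ← mul_assoc]; exact hx _ }
  have hI : ∀ a, (∀ A : PSDm n, F (AddMonoidAlgebra.single A 1 * a) = 0) → a ∈ I := fun a h b => by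
    induction b using AddMonoidAlgebra.induction_on with
    | of m => exact h m
    | add x y hx hy => rw [add_mul, map_add, hx, hy, add_zero]
    | smul r x hx => rw [smul_mul_assoc, map_smul, hx, smul_zero]
  let e : Matrix (Fin n) (Fin n) ℝ → AddMonoidAlgebra ℂ (PSDm n) ⧸ I := fun A =>
    if h : A.PosSemidef then Ideal.Quotient.mk I (AddMonoidAlgebra.single ⟨A, h⟩ 1) else 0
  have he : ∀ A (h : A.PosSemidef), e A = Ideal.Quotient.mk I (AddMonoidAlgebra.single ⟨A, h⟩ 1) :=
    fun A h => dif_pos h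
  have E0 : e 0 = 1 := by rw [he 0 PosSemidef.zero]; rfl
  have E1 : ∀ A B : Matrix (Fin n) (Fin n) ℝ, A.PosSemidef → B.PosSemidef → e (A + B) = e A * e B := by
    intro A B hA hB
    rw [he A hA, he B hB, he _ (hA.add hB), ← map_mul, AddMonoidAlgebra.single_mul_single, one_mul]; rfl
  have E2 : ∀ (ξ : Fin n → ℝ) (t : ℝ), 0 ≤ t → e (t • vecMulVec ξ ξ) = 1 + t • (e (vecMulVec ξ ξ) - 1) := by
    intro ξ t ht
    have h1 : (vecMulVec ξ ξ).PosSemidef := by simpa using posSemidef_vecMulVec_self_star ξ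
    have h2 : (t • vecMulVec ξ ξ).PosSemidef := h1.smul ht
    rw [he _ h1, he _ h2]
    have : Ideal.Quotient.mk I (AddMonoidAlgebra.single ⟨_, h2⟩ 1) = Ideal.Quotient.mk I
        (AddMonoidAlgebra.single 0 1 + (t : ℂ) • (AddMonoidAlgebra.single ⟨_, h1⟩ 1 - AddMonoidAlgebra.single 0 1)) := by
      refine Ideal.Quotient.eq.2 (hI _ fun A => ?_)
      rw [mul_sub, mul_add, mul_smul_comm, mul_sub]
      simp only [AddMonoidAlgebra.single_mul_single, map_sub, map_add, map_smul, hF, one_mul, add_zero, smul_eq_mul]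
      have := hG A.1 A.2 ξ t ht
      linear_combination this
    rw [this]; rfl
  obtain ⟨X, hX⟩ := alg_main (e := e) E0 E1 E2
  choose Y hY using fun k p => Ideal.Quotient.mk_surjective (X k p)
  refine ⟨fun k p => F (Y k p), fun A hA => ?_⟩
  have h := hX A hA
  rw [he A hA] at h
  have h2 : Ideal.Quotient.mk I (AddMonoidAlgebra.single ⟨A, hA⟩ 1) = Ideal.Quotient.mk I
      (∑ k ∈ Finset.range (n + 1), ∑ p : Fin k → Fin n × Fin n,
      (((A.submatrix (fun l => (p l).1) (fun l => (p l).2)).det : ℝ) : ℂ) • Y k p) := by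
    rw [h]
    simp only [map_sum, ← hY]
    rfl
  have h3 := (Ideal.Quotient.eq.1 h2) 1
  rw [one_mul, map_sub, hF, one_mul, sub_eq_zero] at h3
  rw [h3]
  simp only [map_sum, map_smul, smul_eq_mul]

lemma exists_P {n d : ℕ} {Ψ : ConvFn n → RadonMeasure n} (hΨ : MemPdLV d Ψ) (htr : IsTranslationInvariant Ψ) :
    ∃ P ∈ TransInvPolySpace n d, ∀ (z : ℝ × Eucl n) (A : Matrix (Fin n) (Fin n) ℝ) (hA : A.PosSemidef),
      GG Ψ z A = P z.1 ⇑z.2 ⟨A, psd_symm hA⟩ := by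
  obtain ⟨N, zz, b, hb, hint⟩ := interp n d
  choose Q hQ hQb using fun k => (mem_PolyV).1 (hb k)
  choose w hw using fun i => minors (GG_R1A hΨ htr (zz i))
  refine ⟨∑ i, ∑ k ∈ Finset.range (n + 1), ∑ p : Fin k → Fin n × Fin n, w i k p • (fun (s : ℝ) (v : Fin n → ℝ)
    (A : SymMatrix n) => MvPolynomial.eval (Fin.cons (s : ℂ) fun i => (v i : ℂ)) (Q i)
          * (((A.1.submatrix (fun l => (p l).1) (fun l => (p l).2)).det : ℝ) : ℂ)), ?_, ?_⟩
  · refine Submodule.sum_mem _ fun i _ => Submodule.sum_mem _ fun k hk => Submodule.sum_mem _ fun p _ =>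
      Submodule.smul_mem _ _ ?_
    by_cases h1 : Function.Injective (fun l => (p l).1)
    · by_cases h2 : Function.Injective (fun l => (p l).2)
      · exact Submodule.subset_span ⟨Q i, k, ⟨_, h1⟩, ⟨_, h2⟩, Nat.lt_succ_iff.1 (Finset.mem_range.1 hk), hQ i, rfl⟩
      · convert Submodule.zero_mem _
        simp only [Function.Injective, not_forall] at h2
        obtain ⟨a, b, e, hab⟩ := h2
        rw [det_zero_of_column_eq hab (by intro l; simp only [submatrix_apply]; rw [e])]
        simp
    · convert Submodule.zero_mem _
      simp only [Function.Injective, not_forall] at h1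
      obtain ⟨a, b, e, hab⟩ := h1
      rw [det_zero_of_row_eq hab (by ext l; simp only [submatrix_apply]; rw [e])]
      simp
  · intro z A hA
    rw [hint _ (GG_dens hΨ htr hA).1 z]
    simp only [Finset.sum_apply, Pi.smul_apply, smul_eq_mul]
    refine Finset.sum_congr rfl fun i _ => ?_
    rw [hw i A hA, hQb, Finset.sum_mul]
    refine Finset.sum_congr rfl fun k _ => ?_
    rw [Finset.sum_mul]
    refine Finset.sum_congr rfl fun p _ => ?_
    simp only [ev]
    ring

lemma qC_c2 {n : ℕ} {A : Matrix (Fin n) (Fin n) ℝ} (hA : A.PosSemidef) : qC A hA ∈ c2 n := by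
  show ContDiff ℝ 2 (fun x : Eucl n => qf A x)
  simp only [qf, dotProduct, mulVec]
  fun_prop

lemma qC_fderiv {n : ℕ} {A : Matrix (Fin n) (Fin n) ℝ} (hA : A.PosSemidef) (x : Eucl n) :
    fderiv ℝ ⇑(qC A hA).1 x = innerSL ℝ (mv A x) := by
  refine HasFDerivAt.fderiv ?_
  rw [hasFDerivAt_iff_isLittleO_nhds_zero]
  obtain ⟨K, hK⟩ := qf_bound A
  have e : (fun h : Eucl n => (qC A hA).1 (x + h) - (qC A hA).1 x - (innerSL ℝ (mv A x)) h) = fun h => qf A h := by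
    funext h
    rw [qC_apply, qC_apply, qf_add (psd_symm hA)]
    simp only [innerSL_apply_apply]; ring
  rw [e]
  have h1 : (fun h : Eucl n => qf A h) =O[𝓝 0] fun h => ‖h‖ ^ 2 :=
    Asymptotics.IsBigO.of_bound K (Eventually.of_forall fun h => by
      rw [Real.norm_of_nonneg (qf_nonneg hA h), Real.norm_of_nonneg (by positivity)]; exact hK h)
  refine h1.trans_isLittleO ?_
  exact Asymptotics.isLittleO_norm_pow_id one_lt_two

lemma qC_gradVec {n : ℕ} {A : Matrix (Fin n) (Fin n) ℝ} (hA : A.PosSemidef) (x : Eucl n) :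
    gradVec (qC A hA).1 x = ⇑(mv A x) := by
  ext i
  rw [gradVec, qC_fderiv]
  simp [EuclideanSpace.inner_single_right]

lemma qC_hess {n : ℕ} {A : Matrix (Fin n) (Fin n) ℝ} (hA : A.PosSemidef) (x : Eucl n) :
    symHess (qC A hA).1 x = ⟨A, psd_symm hA⟩ := by
  refine Subtype.ext ?_
  rw [symHess_eq (qC_c2 hA)]
  ext i j
  simp only [hessMat, of_apply, qC_fderiv]
  have : (fun y : Eucl n => innerSL ℝ (mv A y) (EuclideanSpace.single j (1 : ℝ))) =
      fun y => innerSL ℝ (WithLp.toLp 2 (A j) : Eucl n) y := by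
    funext y
    rw [innerSL_apply_apply, innerSL_apply_apply, inner_dot (WithLp.toLp 2 (A j) : Eucl n)]
    simp [EuclideanSpace.inner_single_right, mv, mulVec]
  rw [this, ContinuousLinearMap.fderiv]
  simp only [innerSL_apply_apply, EuclideanSpace.inner_single_right]
  simpa using (psd_symm hA).apply i j

lemma rep_quad {n : ℕ} {Ψ : ConvFn n → RadonMeasure n} {P : ℝ → (Fin n → ℝ) → SymMatrix n → ℂ}
    (hr : TransInvRepresentation Ψ P) {A : Matrix (Fin n) (Fin n) ℝ} (hA : A.PosSemidef)
    (z : ℝ × Eucl n) (φ : C_c(Eucl n, ℂ)) :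
    (Ψ (aA (qC A hA) z)).1 φ = ∫ x, φ x * P (tau A z x).1 ⇑(tau A z x).2 ⟨A, psd_symm hA⟩ := by
  rw [hr _ (aA_c2 (qC_c2 hA) z)]
  refine integral_congr_ae (ae_of_all _ fun x => ?_)
  simp only
  rw [gradVec_aA (qC_c2 hA), hess_aA (qC_c2 hA), qC_hess hA]
  congr 2
  ext i
  have := congrFun (qC_gradVec hA x) i
  simp only [gradE, tau, PiLp.add_apply] at this ⊢
  rw [this]

lemma GG_rep {n d : ℕ} {Ψ : ConvFn n → RadonMeasure n} {P : ℝ → (Fin n → ℝ) → SymMatrix n → ℂ}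
    (hP : P ∈ TransInvPolySpace n d) (hΨ : MemPdLV d Ψ) (htr : IsTranslationInvariant Ψ)
    (hr : TransInvRepresentation Ψ P) {A : Matrix (Fin n) (Fin n) ℝ} (hA : A.PosSemidef)
    (z : ℝ × Eucl n) : GG Ψ z A = P z.1 ⇑z.2 ⟨A, psd_symm hA⟩ := by
  have hD := GG_dens hΨ htr hA
  have h := cc_uniq (u := fun x => GG Ψ (tau A z x) A)
    (v := fun x => P (tau A z x).1 ⇑(tau A z x).2 ⟨A, psd_symm hA⟩)
    ((PolyV_continuous hD.1).comp (tau_cont A z)) ((PolyV_continuous (P_polyV hP _)).comp (tau_cont A z))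
    (fun φ => by rw [← rep_quad hr hA z φ]; exact (quad_rep hΨ htr hA hD z φ).symm)
  have := congrFun h 0
  simpa only [tau_zero] using this

lemma same_pq {n d : ℕ} {Ψ Ψ' : ConvFn n → RadonMeasure n} (hΨ : MemPdLV d Ψ) (htr : IsTranslationInvariant Ψ)
    (hΨ' : MemPdLV d Ψ') (htr' : IsTranslationInvariant Ψ')
    (hG : ∀ (A : Matrix (Fin n) (Fin n) ℝ) (_ : A.PosSemidef) (z : ℝ × Eucl n), GG Ψ z A = GG Ψ' z A)
    {K : ℝ≥0} {f : ConvFn n} (hf : CK K f) (hae : ∀ᵐ x : Eucl n, ∃ (A : Matrix (Fin n) (Fin n) ℝ) (hA : A.PosSemidef)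
      (z : ℝ × Eucl n), ∀ᶠ y in 𝓝 x, f.1 y = (translateConv x (aA (qC A hA) z)).1 y) (φ : C_c(Eucl n, ℂ)) :
    (Ψ f).1 φ = (Ψ' f).1 φ := by
  have : ∀ x : Eucl n, ∃ g : ℂ, (∃ (A : Matrix (Fin n) (Fin n) ℝ) (hA : A.PosSemidef)
      (z : ℝ × Eucl n), ∀ᶠ y in 𝓝 x, f.1 y = (translateConv x (aA (qC A hA) z)).1 y) →
      Tendsto (fun m => (Ψ f).1 (etaCc m x)) atTop (𝓝 g) ∧ Tendsto (fun m => (Ψ' f).1 (etaCc m x)) atTop (𝓝 g) := by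
    intro x
    by_cases h : ∃ (A : Matrix (Fin n) (Fin n) ℝ) (hA : A.PosSemidef)
      (z : ℝ × Eucl n), ∀ᶠ y in 𝓝 x, f.1 y = (translateConv x (aA (qC A hA) z)).1 y
    · obtain ⟨A, hA, z, h⟩ := h
      refine ⟨GG Ψ z A, fun _ => ⟨?_, ?_⟩⟩
      · refine ((GG_dens hΨ htr hA).2 z).congr' ?_
        filter_upwards [loc_eta hΨ htr h] with m hm using hm.symm
      · rw [hG A hA]
        refine ((GG_dens hΨ' htr' hA).2 z).congr' ?_
        filter_upwards [loc_eta hΨ' htr' h] with m hm using hm.symm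
    · exact ⟨0, fun h' => absurd h' h⟩
  choose g hg using this
  rw [lemL hΨ htr hf (g := g) (hae.mono fun x hx => (hg x hx).1) φ,
    lemL hΨ' htr' hf (g := g) (hae.mono fun x hx => (hg x hx).2) φ]

lemma symm_shift {n : ℕ} (A : SymMatrix n) (t : ℝ) : (A.1 + t • (1 : Matrix (Fin n) (Fin n) ℝ)).IsSymm :=
  Matrix.IsSymm.add A.2 (Matrix.IsSymm.smul Matrix.isSymm_one t)

lemma psd_shift {n : ℕ} (A : SymMatrix n) :
    ∃ T : ℝ, ∀ t ≥ T, (A.1 + t • (1 : Matrix (Fin n) (Fin n) ℝ)).PosSemidef := by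
  obtain ⟨K, hK⟩ := qf_bound (-A.1)
  refine ⟨2 * K, fun t ht => Matrix.PosSemidef.of_dotProduct_mulVec_nonneg ?_ fun x => ?_⟩
  · rw [Matrix.IsHermitian, Matrix.conjTranspose_eq_transpose_of_trivial]
    exact symm_shift A t
  · have h := hK (WithLp.toLp 2 x)
    rw [← real_inner_self_eq_norm_sq, inner_dot] at h
    simp only [qf, neg_mulVec, dotProduct_neg] at h
    rw [star_trivial, add_mulVec, smul_mulVec, one_mulVec, dotProduct_add, dotProduct_smul, smul_eq_mul]
    have h2 : 0 ≤ x ⬝ᵥ x := Finset.sum_nonneg fun i _ => mul_self_nonneg _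
    nlinarith [mul_nonneg (sub_nonneg.2 ht) h2]

lemma P_unique {n d : ℕ} {Ψ : ConvFn n → RadonMeasure n} {P P' : ℝ → (Fin n → ℝ) → SymMatrix n → ℂ}
    (hΨ : MemPdLV d Ψ) (htr : IsTranslationInvariant Ψ)
    (hP : P ∈ TransInvPolySpace n d) (hP' : P' ∈ TransInvPolySpace n d)
    (hr : TransInvRepresentation Ψ P) (hr' : TransInvRepresentation Ψ P') : P = P' := by
  have h0 : ∀ (s : ℝ) (v : Fin n → ℝ) (A : Matrix (Fin n) (Fin n) ℝ) (hA : A.PosSemidef),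
      (P - P') s v ⟨A, psd_symm hA⟩ = 0 := fun s v A hA => by
    have e1 := GG_rep hP hΨ htr hr hA (s, WithLp.toLp 2 v)
    have e2 := GG_rep hP' hΨ htr hr' hA (s, WithLp.toLp 2 v)
    simp only [Pi.sub_apply]
    rw [sub_eq_zero]
    exact e1.symm.trans e2
  have hd := Submodule.sub_mem _ hP hP'
  have hpoly : ∀ Q ∈ TransInvPolySpace n d, ∀ (s : ℝ) (v : Fin n → ℝ) (A : SymMatrix n),
      ∃ p : Polynomial ℂ, ∀ t : ℝ, Q s v ⟨A.1 + t • 1, symm_shift A t⟩ = p.eval (t : ℂ) := by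
    intro Q hQ s v A
    induction hQ using Submodule.span_induction with
    | mem Q h =>
      obtain ⟨Q, k, σ, τ, -, -, rfl⟩ := h
      refine ⟨Polynomial.C (MvPolynomial.eval (Fin.cons (s : ℂ) fun i => (v i : ℂ)) Q) *
        (((A.1.submatrix σ τ).map fun x => Polynomial.C (x : ℂ)) +
        (Polynomial.X : Polynomial ℂ) • ((1 : Matrix (Fin n) (Fin n) (Polynomial ℂ)).submatrix σ τ)).det, fun t => ?_⟩
      rw [Polynomial.eval_mul, Polynomial.eval_C, ← Polynomial.coe_evalRingHom, RingHom.map_det]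
      refine congrArg (_ * ·) ?_
      refine (Complex.ofRealHom.map_det ((A.1 + t • (1 : Matrix (Fin n) (Fin n) ℝ)).submatrix σ τ)).trans ?_
      congr 1
      ext i j
      by_cases hij : σ i = τ j <;> simp [Matrix.one_apply, hij]
    | zero => exact ⟨0, fun t => by simp⟩
    | add x y _ _ hx hy =>
      obtain ⟨p, hp⟩ := hx
      obtain ⟨q, hq⟩ := hy
      exact ⟨p + q, fun t => by simp [hp, hq]⟩
    | smul c x _ hx =>
      obtain ⟨p, hp⟩ := hx
      exact ⟨Polynomial.C c * p, fun t => by simp [hp]⟩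
  refine sub_eq_zero.1 ?_
  funext s v A
  obtain ⟨p, hp⟩ := hpoly _ hd s v A
  obtain ⟨T, hT⟩ := psd_shift A
  have hp0 : p = 0 := by
    refine Polynomial.eq_zero_of_infinite_isRoot p ?_
    refine Set.Infinite.mono (s := (fun t : ℝ => (t : ℂ)) '' Set.Ici T) ?_
      ((Set.Ici_infinite T).image Complex.ofReal_injective.injOn)
    rintro _ ⟨t, ht, rfl⟩
    show p.eval _ = 0
    rw [← hp t]
    exact h0 s v _ (hT t ht)
  have := hp 0
  simpa [hp0] using this

lemma Q_of {n : ℕ} (M : Eucl n →L[ℝ] Eucl n) (b w : Eucl n) (c : ℝ) {k : ℝ} (hk : 0 ≤ k) :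
    ∃ (A : Matrix (Fin n) (Fin n) ℝ) (hA : A.PosSemidef) (z : ℝ × Eucl n), ∀ y,
      c + inner ℝ w y + k * ‖b + M y‖ ^ 2 = (aA (qC A hA) z).1 y := by
  let A : Matrix (Fin n) (Fin n) ℝ := Matrix.of fun i j =>
    2 * k * inner ℝ (M (EuclideanSpace.single i 1)) (M (EuclideanSpace.single j 1))
  have hM : ∀ y : Eucl n, M y = ∑ i, y i • M (EuclideanSpace.single i (1 : ℝ)) := fun y => by
    have h : y = ∑ i, y i • EuclideanSpace.single i (1 : ℝ) := by
      ext j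
      simp [Pi.single_apply]
    conv_lhs => rw [h, map_sum]
    simp only [map_smul]
  have hq : ∀ y : Eucl n, qf A y = k * ‖M y‖ ^ 2 := fun y => by
    rw [← real_inner_self_eq_norm_sq, hM y, sum_inner]
    simp only [inner_sum, real_inner_smul_left, real_inner_smul_right, qf, dotProduct, mulVec, A, of_apply,
      Finset.mul_sum]
    exact Finset.sum_congr rfl fun i _ => Finset.sum_congr rfl fun j _ => by ring
  have hA : A.PosSemidef := by
    refine Matrix.PosSemidef.of_dotProduct_mulVec_nonneg ?_ fun x => ?_
    · rw [Matrix.IsHermitian, Matrix.conjTranspose_eq_transpose_of_trivial]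
      ext i j
      simp only [A, transpose_apply, of_apply]
      rw [real_inner_comm]
    · have := hq (WithLp.toLp 2 x)
      simp only [qf] at this
      rw [star_trivial]
      nlinarith [mul_nonneg hk (sq_nonneg ‖M (WithLp.toLp 2 x)‖)]
  refine ⟨A, hA, (c + k * ‖b‖ ^ 2, w + (2 * k) • M.adjoint b), fun y => ?_⟩
  rw [aA_apply, qC_apply, hq, norm_add_sq_real, inner_add_left, real_inner_smul_left,
    ContinuousLinearMap.adjoint_inner_left]
  ring

lemma fam_Q {n : ℕ} {ι : Type*} (a : ι → ℝ) (p : ι → Eucl n) {l : ℝ} (hl : 0 < l) (I : Set ι) (o : ι) :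
    ∃ (A : Matrix (Fin n) (Fin n) ℝ) (hA : A.PosSemidef) (z : ℝ × Eucl n), ∀ y x : Eucl n,
      (∀ i ∈ I, a i + inner ℝ (p i) x = a o + inner ℝ (p o) x) →
      y - x - l • p o ∈ Submodule.span ℝ ((fun i => p i - p o) '' I) →
      a o + inner ℝ (p o) x + (2 * l)⁻¹ * ‖y - x‖ ^ 2 = (aA (qC A hA) z).1 y := by
  set V := Submodule.span ℝ ((fun i => p i - p o) '' I) with hV
  by_cases h : ∃ x0 : Eucl n, ∀ i ∈ I, a i + inner ℝ (p i) x0 = a o + inner ℝ (p o) x0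
  · obtain ⟨x0, h0⟩ := h
    set P := V.starProjection
    set b : Eucl n := l • p o - P (x0 + l • p o) with hb
    obtain ⟨A, hA, z, hz⟩ := Q_of P b (p o - P (p o)) (a o - inner ℝ (p o) b) (k := (2 * l)⁻¹) (by positivity)
    refine ⟨A, hA, z, fun y x hx hy => ?_⟩
    have e1 : x - x0 ∈ Vᗮ := by
      have : V ≤ (Submodule.span ℝ {x - x0})ᗮ := by
        rw [hV, Submodule.span_le]
        rintro _ ⟨i, hi, rfl⟩
        show p i - p o ∈ (Submodule.span ℝ {x - x0})ᗮ
        rw [Submodule.mem_orthogonal_singleton_iff_inner_left, inner_sub_left, inner_sub_right, inner_sub_right]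
        linarith [hx i hi, h0 i hi]
      intro u hu
      exact Submodule.mem_orthogonal_singleton_iff_inner_left.1 (this hu)
    have e2 : P (x - x0) = 0 := (Submodule.starProjection_apply_eq_zero_iff _).2 e1
    have e3 : P (y - x - l • p o) = y - x - l • p o := Submodule.starProjection_eq_self_iff.2 hy
    have e4 : y - x = b + P y := by
      have : P y = P (y - x - l • p o) + P (x - x0) + P (x0 + l • p o) := by
        rw [← map_add, ← map_add]; congr 1; abel
      rw [this, e2, e3, hb]; abel
    have e5 : x = y - b - P y := by rw [sub_sub, ← e4]; abel
    have e6 : inner ℝ (p o) (P y) = inner ℝ (P (p o)) y := (Submodule.inner_starProjection_left_eq_right V _ _).symm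
    rw [← hz, ← e4, inner_sub_left, ← e6]
    have e7 : inner ℝ (p o) x = inner ℝ (p o) y - inner ℝ (p o) b - inner ℝ (p o) (P y) := by
      conv_lhs => rw [e5]
      rw [inner_sub_right, inner_sub_right]
    rw [e7]; ring
  · exact ⟨0, Matrix.PosSemidef.zero, 0, fun y x hx => absurd ⟨x, hx⟩ h⟩

lemma quad_fin_ae {n : ℕ} {κ : Type*} [Finite κ] (q : κ → ConvFn n)
    (hq : ∀ k, ∃ (A : Matrix (Fin n) (Fin n) ℝ) (hA : A.PosSemidef) (z : ℝ × Eucl n), q k = aA (qC A hA) z)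
    (e : ConvFn n) (he : ∀ y, ∃ k, e.1 y = (q k).1 y) :
    ∀ᵐ x : Eucl n, ∃ (A : Matrix (Fin n) (Fin n) ℝ) (hA : A.PosSemidef)
      (z : ℝ × Eucl n), ∀ᶠ y in 𝓝 x, e.1 y = (translateConv x (aA (qC A hA) z)).1 y := by
  have h1 : ∀ᵐ x : Eucl n, ∀ k k', q k ≠ q k' → (q k).1 x - (q k').1 x ≠ 0 := by
    rw [ae_all_iff]; intro k
    rw [ae_all_iff]; intro k'
    by_cases h : q k = q k'
    · exact ae_of_all _ fun x h' => absurd h h'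
    · obtain ⟨x1, hx1⟩ : ∃ x1, (q k).1 x1 ≠ (q k').1 x1 := by
        by_contra hh
        push Not at hh
        exact h (conv_ext hh)
      refine (null_zero (h := fun x => (q k).1 x - (q k').1 x) (by fun_prop) x1 fun v => ?_).mono fun x hx _ => hx
      obtain ⟨A, hA, z, e1⟩ := hq k
      obtain ⟨A', hA', z', e2⟩ := hq k'
      refine (quad_count (sub_ne_zero.2 hx1) (inner ℝ (mv A x1) v + inner ℝ z.2 v - inner ℝ (mv A' x1) v - inner ℝ z'.2 v)
        (qf A v - qf A' v)).mono fun t ht => ?_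
      rw [Set.mem_ofPred_eq] at ht ⊢
      rw [← ht, e1, e2]
      simp only [aA_apply, qC_apply, qf_add (psd_symm hA), qf_add (psd_symm hA'), qf_smul, inner_add_right,
        real_inner_smul_right]
      ring
  filter_upwards [h1] with x hx
  obtain ⟨k, hk⟩ := he x
  obtain ⟨A, hA, z, e1⟩ := hq k
  refine ⟨A, hA, tau A z x, ?_⟩
  rw [← q_tau, ← e1]
  have h2 : ∀ k', ∀ᶠ y in 𝓝 x, q k' ≠ q k → (q k').1 y - e.1 y ≠ 0 := fun k' => by
    by_cases h : q k' = q k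
    · exact Eventually.of_forall fun y h' => absurd h h'
    · have hc : Continuous fun y => (q k').1 y - e.1 y := by fun_prop
      have : (q k').1 x - e.1 x ≠ 0 := by rw [hk]; exact hx _ _ h
      exact (hc.continuousAt.eventually_ne this).mono fun y hy _ => hy
  filter_upwards [eventually_all.2 h2] with y hy
  obtain ⟨k', hk'⟩ := he y
  by_cases h : q k' = q k
  · rw [hk', h]
  · exact absurd (by rw [hk', sub_self]) (hy k' h)

lemma argmax {n : ℕ} {ι : Type*} [Fintype ι] [Nonempty ι] (a : ι → ℝ) (p : ι → Eucl n) {l : ℝ} (hl : 0 < l)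
    (y : Eucl n) : ∃ μ ∈ stdSimplex ℝ ι, ∃ c : ℝ,
      (∀ i, a i + inner ℝ (p i) (y - l • ∑ j, μ j • p j) ≤ c) ∧
      (∀ i, 0 < μ i → a i + inner ℝ (p i) (y - l • ∑ j, μ j • p j) = c) := by
  classical
  let V : (ι → ℝ) → ℝ := fun ν => ∑ i, ν i * (a i + inner ℝ (p i) y) - l / 2 * ‖∑ i, ν i • p i‖ ^ 2
  obtain ⟨μ, hμ, hmax⟩ := (isCompact_stdSimplex ℝ ι).exists_isMaxOn
    ⟨_, single_mem_stdSimplex ℝ (Classical.arbitrary ι)⟩ (f := V) (by fun_prop)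
  set w := ∑ j, μ j • p j with hw
  set g : ι → ℝ := fun i => a i + inner ℝ (p i) (y - l • w) with hg
  have key : ∀ i, g i ≤ ∑ j, μ j * g j := fun i => by
    by_contra hlt
    push Not at hlt
    set D := g i - ∑ j, μ j * g j
    have hD : 0 < D := sub_pos.2 hlt
    have hV : ∀ s : ℝ, V ((1 - s) • μ + s • Pi.single i 1) = V μ + s * D - l / 2 * s ^ 2 * ‖p i - w‖ ^ 2 := fun s => by
      have e1 : ∑ j, ((1 - s) • μ + s • Pi.single i 1 : ι → ℝ) j • p j = w + s • (p i - w) := by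
        simp only [Pi.add_apply, Pi.smul_apply, smul_eq_mul, add_smul, mul_smul, Finset.sum_add_distrib,
          ← Finset.smul_sum, ← hw]
        simp only [Pi.single_apply, ite_smul, one_smul, zero_smul, Finset.sum_ite_eq', Finset.mem_univ, if_true]
        module
      have e2 : ∑ j, ((1 - s) • μ + s • Pi.single i 1 : ι → ℝ) j * (a j + inner ℝ (p j) y) =
          (1 - s) * ∑ j, μ j * (a j + inner ℝ (p j) y) + s * (a i + inner ℝ (p i) y) := by
        simp only [Pi.add_apply, Pi.smul_apply, smul_eq_mul, add_mul, mul_assoc, Finset.sum_add_distrib,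
          ← Finset.mul_sum]
        simp [Pi.single_apply]
      have e3 : ∑ j, μ j * g j = ∑ j, μ j * (a j + inner ℝ (p j) y) - l * inner ℝ w w := by
        have : inner ℝ w w = ∑ j, μ j * inner ℝ (p j) w := by
          conv_lhs => rw [hw, sum_inner]
          simp only [real_inner_smul_left, ← hw]
        rw [this, Finset.mul_sum, ← Finset.sum_sub_distrib]
        refine Finset.sum_congr rfl fun j _ => ?_
        simp only [hg, inner_sub_right, real_inner_smul_right]
        ring
      simp only [V, D]
      rw [e1, e2, e3, ← hw, norm_add_sq_real, norm_smul, mul_pow, Real.norm_eq_abs, sq_abs, real_inner_smul_right,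
        inner_sub_right]
      simp only [hg, inner_sub_right, real_inner_smul_right]
      rw [real_inner_comm (p i) w]
      ring
    set C := l / 2 * ‖p i - w‖ ^ 2
    have hC : 0 ≤ C := by positivity
    set s := D / (D + C + 1)
    have hs0 : 0 < s := by positivity
    have hs1 : s ≤ 1 := (div_le_one (by positivity)).2 (by linarith)
    have hm := hmax (a := (1 - s) • μ + s • Pi.single i 1) (convex_stdSimplex ℝ ι hμ (single_mem_stdSimplex ℝ i)
      (by linarith) hs0.le (by ring))
    rw [Set.mem_ofPred_eq, hV s] at hm
    have h3 : s * (D + C + 1) = D := div_mul_cancel₀ _ (by positivity)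
    have : s * (D - s * C) ≤ 0 := by simp only [C]; nlinarith
    have h4 : 0 < D - s * C := by nlinarith
    nlinarith [mul_pos hs0 h4]
  refine ⟨μ, hμ, ∑ j, μ j * g j, key, fun i hi => ?_⟩
  have h0 : ∑ i, μ i * (∑ j, μ j * g j - g i) = 0 := by
    simp only [mul_sub, Finset.sum_sub_distrib, ← Finset.sum_mul, hμ.2, one_mul, sub_self]
  have := (Finset.sum_eq_zero_iff_of_nonneg fun i _ => mul_nonneg (hμ.1 i) (sub_nonneg.2 (key i))).1 h0 i (Finset.mem_univ i)
  rcases mul_eq_zero.1 this with h | h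
  · exact absurd h hi.ne'
  · exact (sub_eq_zero.1 h).symm

lemma moreau {n : ℕ} {ι : Type*} [Fintype ι] [Nonempty ι] (a : ι → ℝ) (p : ι → Eucl n) {l : ℝ} (hl : 0 < l) :
    ∃ (e : ConvFn n) (K : ℝ≥0), CK K e ∧ (∀ᵐ x : Eucl n, ∃ (A : Matrix (Fin n) (Fin n) ℝ) (hA : A.PosSemidef)
      (z : ℝ × Eucl n), ∀ᶠ y in 𝓝 x, e.1 y = (translateConv x (aA (qC A hA) z)).1 y) ∧
      (∀ y i, a i + inner ℝ (p i) y - l / 2 * ‖p i‖ ^ 2 ≤ e.1 y) ∧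
      (∀ y B, (∀ i, a i + inner ℝ (p i) y ≤ B) → e.1 y ≤ B) := by
  choose μ hμ c hc hc' using argmax a p hl
  set w : Eucl n → Eucl n := fun y => ∑ j, μ y j • p j with hw
  set e : Eucl n → ℝ := fun y => c y + l / 2 * ‖w y‖ ^ 2 with he
  have hwi : ∀ y v, inner ℝ (w y) v = ∑ j, μ y j * inner ℝ (p j) v := fun y v => by
    rw [hw, sum_inner]
    simp only [real_inner_smul_left]
  have hsum : ∀ y, c y = ∑ j, μ y j * a j + inner ℝ (w y) (y - l • w y) := fun y => by
    rw [hwi, ← Finset.sum_add_distrib]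
    have : c y = ∑ j, μ y j * c y := by rw [← Finset.sum_mul, (hμ y).2, one_mul]
    rw [this]
    refine Finset.sum_congr rfl fun j _ => ?_
    rcases ((hμ y).1 j).eq_or_lt with h | h
    · simp [← h]
    · rw [← mul_add, hc' y j h]
  have hle : ∀ y y', ∑ j, μ y j * a j + inner ℝ (w y) (y' - l • w y') ≤ c y' := fun y y' => by
    have : c y' = ∑ j, μ y j * c y' := by rw [← Finset.sum_mul, (hμ y).2, one_mul]
    rw [hwi, ← Finset.sum_add_distrib, this]
    refine Finset.sum_le_sum fun j _ => ?_
    rw [← mul_add]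
    exact mul_le_mul_of_nonneg_left (hc y' j) ((hμ y).1 j)
  have hstrong : ∀ y y', l / 2 * ‖w y' - w y‖ ^ 2 ≤ e y' - e y - inner ℝ (w y) (y' - y) := fun y y' => by
    have h1 := hle y y'
    have h2 := hsum y
    simp only [he]
    rw [norm_sub_sq_real]
    simp only [inner_sub_right, real_inner_smul_right, real_inner_self_eq_norm_sq] at h1 h2 ⊢
    rw [real_inner_comm (w y) (w y')] at *
    nlinarith
  have hconv : ConvexOn ℝ Set.univ e := convex_of_sub fun y => ⟨w y, fun y' => by
    have := hstrong y y'
    have h2 : 0 ≤ l / 2 * ‖w y' - w y‖ ^ 2 := by positivity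
    linarith⟩
  let E : ConvFn n := ⟨⟨e, continuousOn_univ.1 (hconv.continuousOn isOpen_univ)⟩, hconv⟩
  have hE : ∀ y, E.1 y = e y := fun _ => rfl
  refine ⟨E, NNReal.mk (2 * l)⁻¹ (by positivity), fun x => ⟨w x, fun h => ⟨?_, ?_⟩⟩, ?_, fun y i => ?_, fun y B hB => ?_⟩
  · have := hstrong x (x + h)
    have h2 : 0 ≤ l / 2 * ‖w (x + h) - w x‖ ^ 2 := by positivity
    rw [add_sub_cancel_left] at this
    rw [hE, hE]; linarith
  · have h1 := hstrong (x + h) x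
    rw [sub_add_cancel_left, inner_neg_right, norm_sub_rev] at h1
    have h2 : inner ℝ (w (x + h) - w x) h ≤ l / 2 * ‖w (x + h) - w x‖ ^ 2 + (2 * l)⁻¹ * ‖h‖ ^ 2 := by
      have h3 := real_inner_le_norm (w (x + h) - w x) h
      set u := ‖w (x + h) - w x‖
      have h4 : l / 2 * u ^ 2 + (2 * l)⁻¹ * ‖h‖ ^ 2 - u * ‖h‖ = (2 * l)⁻¹ * (l * u - ‖h‖) ^ 2 := by
        field_simp
        ring
      have h5 : 0 ≤ (2 * l)⁻¹ * (l * u - ‖h‖) ^ 2 := by positivity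
      linarith
    rw [inner_sub_left] at h2
    rw [hE, hE, NNReal.coe_mk]; linarith
  · choose A hA z hz using fun k : Set ι × ι => fam_Q a p hl k.1 k.2
    refine quad_fin_ae (fun k => aA (qC (A k) (hA k)) (z k)) (fun k => ⟨_, _, _, rfl⟩) E fun y => ?_
    obtain ⟨o, ho⟩ : ∃ o, 0 < μ y o := by
      by_contra h
      push Not at h
      have : ∑ j, μ y j ≤ 0 := Finset.sum_nonpos fun j _ => h j
      rw [(hμ y).2] at this
      linarith
    refine ⟨({i | 0 < μ y i}, o), ?_⟩
    have h1 := hz ({i | 0 < μ y i}, o) y (y - l • w y) (fun i hi => (hc' y i hi).trans (hc' y o ho).symm) ?_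
    · rw [← h1, hE, he]
      simp only
      rw [hc' y o ho, sub_sub_cancel, norm_smul, mul_pow, Real.norm_eq_abs, sq_abs]
      field_simp
    · rw [sub_sub_cancel, ← smul_sub]
      refine Submodule.smul_mem _ _ ?_
      have : w y - p o = ∑ j, μ y j • (p j - p o) := by
        simp only [smul_sub, Finset.sum_sub_distrib, ← Finset.sum_smul, (hμ y).2, one_smul, hw]
      rw [this]
      refine Submodule.sum_mem _ fun j _ => ?_
      rcases ((hμ y).1 j).eq_or_lt with h | h
      · rw [← h, zero_smul]; exact Submodule.zero_mem _
      · exact Submodule.smul_mem _ _ (Submodule.subset_span ⟨j, h, rfl⟩)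
  · have h1 := hc y i
    have h2 : 0 ≤ l / 2 * ‖p i - w y‖ ^ 2 := by positivity
    rw [norm_sub_sq_real] at h2
    change a i + inner ℝ (p i) (y - l • w y) ≤ c y at h1
    rw [inner_sub_right, real_inner_smul_right] at h1
    rw [hE]; simp only [he]
    nlinarith
  · have h1 := hsum y
    have h2 : ∑ j, μ y j * a j + inner ℝ (w y) y ≤ B := by
      rw [hwi, ← Finset.sum_add_distrib]
      have : B = ∑ j, μ y j * B := by rw [← Finset.sum_mul, (hμ y).2, one_mul]
      rw [this]
      refine Finset.sum_le_sum fun j _ => ?_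
      rw [← mul_add]
      exact mul_le_mul_of_nonneg_left (hB j) ((hμ y).1 j)
    rw [inner_sub_right, real_inner_smul_right, real_inner_self_eq_norm_sq] at h1
    have h3 : 0 ≤ l / 2 * ‖w y‖ ^ 2 := by positivity
    rw [hE]; simp only [he]
    nlinarith

lemma approx {n : ℕ} {f : ConvFn n} (hf : f ∈ c2 n) (R : ℝ) {ε : ℝ} (hε : 0 < ε) :
    ∃ (e : ConvFn n) (K : ℝ≥0), CK K e ∧ (∀ᵐ x : Eucl n, ∃ (A : Matrix (Fin n) (Fin n) ℝ) (hA : A.PosSemidef)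
      (z : ℝ × Eucl n), ∀ᶠ y in 𝓝 x, e.1 y = (translateConv x (aA (qC A hA) z)).1 y) ∧
      ∀ y, ‖y‖ ≤ R → |e.1 y - f.1 y| < ε := by
  set p : Eucl n → Eucl n := fun x => gradE f.1 x
  set a : Eucl n → ℝ := fun x => f.1 x - inner ℝ (p x) x with ha
  have hle : ∀ x y, a x + inner ℝ (p x) y ≤ f.1 y := fun x y => by
    have := gradE_ineq hf x y
    rw [inner_sub_right] at this
    simp only [ha]; linarith
  obtain ⟨t, -, ht⟩ := (isCompact_closedBall (0 : Eucl n) R).elim_nhds_subcover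
    (fun x => {y | f.1 y - ε / 2 < a x + inner ℝ (p x) y}) fun x _ => by
      refine (isOpen_lt (by fun_prop) (by fun_prop)).mem_nhds ?_
      simp only [Set.mem_ofPred_eq, ha]; linarith
  classical
  set T : Finset (Eucl n) := insert 0 t
  have : Nonempty T := ⟨⟨0, Finset.mem_insert_self _ _⟩⟩
  set S := ∑ x ∈ T, ‖p x‖ ^ 2
  have hS : 0 ≤ S := Finset.sum_nonneg fun _ _ => by positivity
  obtain ⟨e, K, h1, h2, h3, h4⟩ := moreau (fun x : T => a x) (fun x : T => p x) (l := ε / (S + 1)) (by positivity)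
  refine ⟨e, K, h1, h2, fun y hy => ?_⟩
  have h5 := h4 y (f.1 y) fun i => hle i y
  obtain ⟨x, hx, hxy⟩ := Set.mem_iUnion₂.1 (ht (mem_closedBall_zero_iff.2 hy))
  have h6 := h3 y ⟨x, Finset.mem_insert_of_mem hx⟩
  simp only at h6
  have h7 : ‖p x‖ ^ 2 ≤ S := Finset.single_le_sum (f := fun x => ‖p x‖ ^ 2) (fun _ _ => by positivity)
    (Finset.mem_insert_of_mem hx)
  have h8 : ε / (S + 1) / 2 * ‖p x‖ ^ 2 ≤ ε / 2 := by
    have : ε / (S + 1) * ‖p x‖ ^ 2 ≤ ε := by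
      rw [div_mul_eq_mul_div, div_le_iff₀ (by positivity)]
      nlinarith
    linarith
  rw [Set.mem_ofPred_eq] at hxy
  rw [abs_lt]; constructor <;> linarith

lemma same_all {n d : ℕ} {Ψ Ψ' : ConvFn n → RadonMeasure n} (hΨ : MemPdLV d Ψ) (htr : IsTranslationInvariant Ψ)
    (hΨ' : MemPdLV d Ψ') (htr' : IsTranslationInvariant Ψ')
    (hG : ∀ (A : Matrix (Fin n) (Fin n) ℝ) (_ : A.PosSemidef) (z : ℝ × Eucl n), GG Ψ z A = GG Ψ' z A) : Ψ = Ψ' := by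
  refine eq_of_c2 hΨ.2.1 hΨ'.2.1 fun f hf φ => ?_
  choose e K h1 h2 h3 using fun m : ℕ => approx hf (m : ℝ) (ε := 1 / ((m : ℝ) + 1)) (by positivity)
  have ht : Tendsto e atTop (𝓝 f) := by
    refine tendsto_conv.2 fun R ε hε => ?_
    filter_upwards [eventually_ge_atTop ⌈R⌉₊, (tendsto_one_div_add_atTop_nhds_zero_nat (𝕜 := ℝ)).eventually_lt_const hε]
      with m hm hm' x hx
    exact (h3 m x (hx.trans (Nat.ceil_le.1 hm))).trans hm'
  refine tendsto_nhds_unique (((hΨ.2.1 φ).tendsto f).comp ht) ((((hΨ'.2.1 φ).tendsto f).comp ht).congr fun m => ?_)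
  exact (same_pq hΨ htr hΨ' htr' hG (h1 m) (h2 m) φ).symm

lemma main_thm {n d : ℕ} (Ψ : ConvFn n → RadonMeasure n)
    (hΨ : MemPdLV d Ψ) (htr : IsTranslationInvariant Ψ) :
    (∃! P : ℝ → (Fin n → ℝ) → SymMatrix n → ℂ,
      P ∈ TransInvPolySpace n d ∧ TransInvRepresentation Ψ P) ∧
    (∀ P ∈ TransInvPolySpace n d,
      ∃! Ψ' : ConvFn n → RadonMeasure n,
        (MemPdLV d Ψ' ∧ IsTranslationInvariant Ψ') ∧ TransInvRepresentation Ψ' P) := by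
  refine ⟨?_, fun P hP => converse hP⟩
  obtain ⟨P, hP, hG⟩ := exists_P hΨ htr
  obtain ⟨Ψ', h1, h2⟩ := exists_rep hP
  obtain ⟨h3, h4⟩ := rep_props hP h1 h2
  obtain rfl : Ψ = Ψ' := same_all hΨ htr h3 h4 fun A hA z => by rw [hG z A hA, GG_rep hP h3 h4 h2 hA]
  exact ⟨P, ⟨hP, h2⟩, fun P' h => P_unique hΨ htr h.1 hP h.2 h2⟩

end Helpers

/-- Every translation invariant `Ψ ∈ P_dLV(ℝⁿ)` is represented by a unique
polynomial `P ∈ Poly_d(A(n,ℝ)) ⊗ M_n` via `Ψ(f;B) = ∫_B P(f(x), ∇f(x), D²f(x)) dx` for `C²`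
convex functions; conversely each such `P` arises from a unique translation invariant element
of `P_dLV(ℝⁿ)`. -/
theorem translation_invariant_classification {n d : ℕ} (Ψ : ConvFn n → RadonMeasure n)
    (hΨ : MemPdLV d Ψ) (htr : IsTranslationInvariant Ψ) :
    (∃! P : ℝ → (Fin n → ℝ) → SymMatrix n → ℂ,
      P ∈ TransInvPolySpace n d ∧ TransInvRepresentation Ψ P) ∧
    (∀ P ∈ TransInvPolySpace n d,
      ∃! Ψ' : ConvFn n → RadonMeasure n,
        (MemPdLV d Ψ' ∧ IsTranslationInvariant Ψ') ∧ TransInvRepresentation Ψ' P) :=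
  main_thm Ψ hΨ htr

end
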